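/- arXiv:1305.4071 — 4 statements merged into one kernel-verified Lean document; each statement's English description precedes it below -/
import Mathlib

section
/- Let λ = (λ_m)_{m≥1} be a non-increasing sequence of nonnegative reals with λ₂ > 0, and define the absolute information complexity of the (unscaled) tensor product problem by n(ε,d) = #{ (j₁,…,j_d) ∈ (ℕ_{≥1})^d : λ_{j₁}⋯λ_{j_d} > ε² }. Then: (a) if λ₁ > 1 the problem suffers from the curse of dimensionality; (b) if λ₁ = 1 the problem is not polynomially tractable; if moreover λ₂ = 1 it suffers from the curse of dimensionality, and it is weakly tractable if and only if λ₂ < 1 and λ_n·(ln n)² → 0 as n → ∞; (c) if λ₁ < 1 the problem never suffers from the curse of dimensionality, it is weakly tractable if and only if λ_n·(ln n)² → 0 as n → ∞, and it is polynomially tractable if and only if it is strongly polynomially tractable, which holds if and only if there exists τ ∈ (0,∞) with Σ_{m=1}^∞ λ_m^τ < ∞; in that case the exponent of strong polynomial tractability equals inf{ 2τ : Σ_{m=1}^∞ λ_m^τ ≤ 1 }. -/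
open scoped ENNReal
open Filter

/-- The set counted by the information complexity (absolute error criterion) of the
unscaled tensor product problem: `{ j ∈ (ℕ_{≥1})^d : λ_{j₁}⋯λ_{j_d} > ε² }`. -/
def AbsSet (lam : ℕ → ℝ) (ε : ℝ) (d : ℕ) : Set (Fin d → ℕ) :=
  {j | (∀ k, 1 ≤ j k) ∧ ε ^ 2 < ∏ k, lam (j k)}

/-- The initial error `ε_d^init = λ₁^{d/2}`. -/
noncomputable def eInitAbs (lam : ℕ → ℝ) (d : ℕ) : ℝ := Real.sqrt (lam 1 ^ d)

/-- The curse of dimensionality (absolute error criterion). -/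
def CurseAbs (lam : ℕ → ℝ) : Prop :=
  ∃ ε > (0 : ℝ), ∃ C > (0 : ℝ), ∃ γ > (0 : ℝ), ∀ D : ℕ, ∃ d : ℕ, D ≤ d ∧ 1 ≤ d ∧
    ENNReal.ofReal (C * (1 + γ) ^ d) ≤ ((AbsSet lam ε d).encard : ℝ≥0∞)

/-- Weak tractability (absolute error criterion). -/
def WTAbs (lam : ℕ → ℝ) : Prop :=
  (∀ (d : ℕ) (ε : ℝ), 1 ≤ d → 0 < ε → ε < eInitAbs lam d → (AbsSet lam ε d).Finite) ∧
  ∀ (εs : ℕ → ℝ) (ds : ℕ → ℕ),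
    (∀ k, 0 < εs k ∧ εs k < eInitAbs lam (ds k)) →
    Tendsto (fun k => (εs k)⁻¹ + (ds k : ℝ)) atTop atTop →
    Tendsto (fun k =>
        Real.log (max ((AbsSet lam (εs k) (ds k)).ncard : ℝ) 1) /
          ((εs k)⁻¹ + (ds k : ℝ))) atTop (nhds 0)

/-- Polynomial tractability (absolute error criterion). -/
def PTAbs (lam : ℕ → ℝ) : Prop :=
  ∃ C > (0 : ℝ), ∃ p > (0 : ℝ), ∃ q : ℝ, 0 ≤ q ∧
    ∀ d : ℕ, 1 ≤ d → ∀ ε : ℝ, 0 < ε → ε ≤ 1 →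
      ((AbsSet lam ε d).encard : ℝ≥0∞) ≤ ENNReal.ofReal (C * ε ^ (-p) * (d : ℝ) ^ q)

/-- Strong polynomial tractability (absolute error criterion). -/
def SPTAbs (lam : ℕ → ℝ) : Prop :=
  ∃ C > (0 : ℝ), ∃ p > (0 : ℝ), ∀ d : ℕ, 1 ≤ d → ∀ ε : ℝ, 0 < ε → ε ≤ 1 →
    ((AbsSet lam ε d).encard : ℝ≥0∞) ≤ ENNReal.ofReal (C * ε ^ (-p))

section Counting

lemma encard_le_ofReal {α : Type*} {s : Set α} {x : ℝ}
    (h : ∀ F : Finset α, (F : Set α) ⊆ s → (F.card : ℝ) ≤ x) :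
    (s.encard : ℝ≥0∞) ≤ ENNReal.ofReal x := by
  have hfin : s.Finite := by
    by_contra hinf
    obtain ⟨n, hn⟩ := exists_nat_gt x
    obtain ⟨F, hF, hc⟩ := Set.Infinite.exists_subset_card_eq hinf n
    have := h F hF
    rw [hc] at this
    linarith
  have h1 := h hfin.toFinset (by simp)
  rw [hfin.encard_eq_coe_toFinset_card]
  rw [ENat.toENNReal_coe, ← ENNReal.ofReal_natCast]
  exact ENNReal.ofReal_le_ofReal h1

lemma card_le_of_encard_le {α : Type*} {s : Set α} {x : ℝ} (hx : 0 ≤ x)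
    (h : (s.encard : ℝ≥0∞) ≤ ENNReal.ofReal x) {F : Finset α} (hF : (F : Set α) ⊆ s) :
    (F.card : ℝ) ≤ x := by
  have h1 : ((F : Set α).encard : ℝ≥0∞) ≤ s.encard := by
    exact_mod_cast Set.encard_le_encard hF
  rw [Set.encard_coe_eq_coe_finsetCard, ENat.toENNReal_coe, ← ENNReal.ofReal_natCast] at h1
  exact (ENNReal.ofReal_le_ofReal_iff hx).1 (h1.trans h)

lemma exists_finset_card_of_injective {α β : Type*} [Fintype α] {s : Set β} (g : α → β)
    (hg : Function.Injective g) (hs : ∀ a, g a ∈ s) :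
    ∃ F : Finset β, (F : Set β) ⊆ s ∧ F.card = Fintype.card α := by
  classical
  refine ⟨Finset.univ.image g, ?_, ?_⟩
  · intro b hb
    simp only [Finset.coe_image, Finset.coe_univ, Set.image_univ, Set.mem_range] at hb
    obtain ⟨a, rfl⟩ := hb
    exact hs a
  · rw [Finset.card_image_of_injective _ hg, Finset.card_univ]

lemma ofReal_le_encard {α : Type*} {s : Set α} {x : ℝ} {F : Finset α} (hF : (F : Set α) ⊆ s)
    (hx : x ≤ F.card) : ENNReal.ofReal x ≤ (s.encard : ℝ≥0∞) := by
  have h1 : ((F : Set α).encard : ℝ≥0∞) ≤ s.encard := by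
    exact_mod_cast Set.encard_le_encard hF
  rw [Set.encard_coe_eq_coe_finsetCard, ENat.toENNReal_coe, ← ENNReal.ofReal_natCast] at h1
  exact (ENNReal.ofReal_le_ofReal hx).trans h1

/-- A Markov-type counting bound with product weights. -/
lemma card_mul_le_sum_pow {d : ℕ} (w : ℕ → ℝ) (hw : ∀ m, 0 ≤ w m) (G : Finset ℕ)
    (F : Finset (Fin d → ℕ)) (B : ℝ) (hG : ∀ j ∈ F, ∀ k, j k ∈ G)
    (hB : ∀ j ∈ F, B ≤ ∏ k, w (j k)) :
    F.card * B ≤ (∑ m ∈ G, w m) ^ d := by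
  classical
  calc (F.card : ℝ) * B = ∑ j ∈ F, B := by simp
    _ ≤ ∑ j ∈ F, ∏ k, w (j k) := Finset.sum_le_sum hB
    _ ≤ ∑ j ∈ Fintype.piFinset (fun _ : Fin d => G), ∏ k, w (j k) := by
        apply Finset.sum_le_sum_of_subset_of_nonneg
        · intro j hj
          exact Fintype.mem_piFinset.2 (hG j hj)
        · intro j _ _
          exact Finset.prod_nonneg fun k _ => hw _
    _ = (∑ m ∈ G, w m) ^ d := by
        rw [← Finset.prod_univ_sum]; simp

end Counting

section LowerBounds

variable {lam : ℕ → ℝ}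

lemma exists_two_pow_subset_absSet (h1 : 1 ≤ lam 1) (N : ℕ)
    (hN : 1 ≤ lam 1 ^ N * lam 2) (m : ℕ) {ε : ℝ} (hε : ε ^ 2 < 1) :
    ∃ F : Finset (Fin (m * (N + 1)) → ℕ),
      (F : Set (Fin (m * (N + 1)) → ℕ)) ⊆ AbsSet lam ε (m * (N + 1)) ∧ F.card = 2 ^ m := by
  let g : (Fin m → Bool) → (Fin (m * (N + 1)) → ℕ) := fun b k =>
    if (finProdFinEquiv.symm k).2 = 0 ∧ b (finProdFinEquiv.symm k).1 = true then 2 else 1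
  have key : ∀ b i l, g b (finProdFinEquiv (i, l)) = if l = 0 ∧ b i = true then 2 else 1 := by
    intro b i l
    simp only [g, Equiv.symm_apply_apply]
  obtain ⟨F, hF, hc⟩ := exists_finset_card_of_injective (s := AbsSet lam ε (m * (N + 1))) g
    (by
      intro b b' h
      funext i
      have := congrFun h (finProdFinEquiv (i, 0))
      rw [key, key] at this
      cases hb : b i <;> cases hb' : b' i <;> simp_all)
    (by
      intro b
      refine ⟨fun k => by simp only [g]; split_ifs <;> simp, hε.trans_le ?_⟩
      rw [← finProdFinEquiv.prod_comp, Fintype.prod_prod_type]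
      rw [show (1 : ℝ) = ∏ _i : Fin m, (1 : ℝ) by simp]
      refine Finset.prod_le_prod (fun _ _ => zero_le_one) fun i _ => ?_
      rw [Fin.prod_univ_succ, key]
      have : ∀ l : Fin N, g b (finProdFinEquiv (i, l.succ)) = 1 := by
        intro l; rw [key]; simp
      simp only [this, Finset.prod_const, Finset.card_univ, Fintype.card_fin]
      split_ifs
      · linarith
      · exact one_le_mul_of_one_le_of_one_le h1 (one_le_pow₀ h1))
  exact ⟨F, hF, by simp [hc]⟩

lemma curseAbs_of_one_le (h1 : 1 ≤ lam 1) (N : ℕ)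
    (hN : 1 ≤ lam 1 ^ N * lam 2) : CurseAbs lam := by
  have hlt : (1 : ℝ) < 2 ^ ((N + 1 : ℝ)⁻¹) := Real.one_lt_rpow (by norm_num) (by positivity)
  refine ⟨1 / 2, by norm_num, 1, one_pos, 2 ^ ((N + 1 : ℝ)⁻¹) - 1, by linarith, fun D => ?_⟩
  obtain ⟨F, hF, hc⟩ := exists_two_pow_subset_absSet (ε := 1 / 2) h1 N hN (D + 1) (by norm_num)
  refine ⟨(D + 1) * (N + 1), by nlinarith, by nlinarith, ofReal_le_encard hF ?_⟩
  rw [hc, one_mul, add_sub_cancel, ← Real.rpow_natCast, ← Real.rpow_mul (by norm_num)]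
  push_cast
  rw [mul_comm ((D : ℝ) + 1), inv_mul_cancel_left₀ (by positivity)]
  rw [← Real.rpow_natCast]
  push_cast
  exact le_rfl

lemma exists_pow_subset_absSet (h1 : lam 1 = 1) (k m : ℕ) {ε : ℝ}
    (hε : ε ^ 2 < lam 2 ^ k) :
    ∃ F : Finset (Fin (k * m) → ℕ),
      (F : Set (Fin (k * m) → ℕ)) ⊆ AbsSet lam ε (k * m) ∧ F.card = m ^ k := by
  let g : (Fin k → Fin m) → (Fin (k * m) → ℕ) := fun b i =>
    if (finProdFinEquiv.symm i).2 = b (finProdFinEquiv.symm i).1 then 2 else 1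
  have key : ∀ b i l, g b (finProdFinEquiv (i, l)) = if l = b i then 2 else 1 := by
    intro b i l
    simp only [g, Equiv.symm_apply_apply]
  obtain ⟨F, hF, hc⟩ := exists_finset_card_of_injective (s := AbsSet lam ε (k * m)) g
    (by
      intro b b' h
      funext i
      have := congrFun h (finProdFinEquiv (i, b i))
      rw [key, key] at this
      by_contra hne
      simp [hne] at this)
    (by
      intro b
      refine ⟨fun i => by simp only [g]; split_ifs <;> simp, hε.trans_le ?_⟩
      rw [← finProdFinEquiv.prod_comp, Fintype.prod_prod_type]
      have : ∀ i : Fin k, ∏ l : Fin m, lam (g b (finProdFinEquiv (i, l))) = lam 2 := by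
        intro i
        rw [Finset.prod_eq_single (b i)]
        · simp [key]
        · intro l _ hl
          simp [key, hl, h1]
        · simp
      simp [this])
  exact ⟨F, hF, by simp [hc]⟩

lemma not_ptAbs_of_one (hlam2 : 0 < lam 2) (h1 : lam 1 = 1) (h21 : lam 2 ≤ 1) : ¬ PTAbs lam := by
  rintro ⟨C, hC, p, hp, q, hq, h⟩
  obtain ⟨k, hk⟩ := exists_nat_gt q
  have hk0 : 0 < k := by
    have : (0 : ℝ) < k := hq.trans_lt hk
    exact_mod_cast this
  have hpk : 0 < lam 2 ^ k := by positivity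
  have hpk1 : lam 2 ^ k ≤ 1 := pow_le_one₀ hlam2.le h21
  set ε : ℝ := lam 2 ^ k / 2 with hε
  have hε0 : 0 < ε := by positivity
  set A : ℝ := C * ε ^ (-p) * (k : ℝ) ^ q with hA
  have bound : ∀ m : ℕ, 1 ≤ m → (m : ℝ) ^ ((k : ℝ) - q) ≤ A := by
    intro m hm
    obtain ⟨F, hF, hc⟩ := exists_pow_subset_absSet (ε := ε) h1 k m (by nlinarith)
    have h2 := card_le_of_encard_le (by positivity)
      (h (k * m) (Nat.one_le_iff_ne_zero.2 (by positivity)) ε hε0 (by linarith)) hF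
    have hm0 : (0 : ℝ) < m := by exact_mod_cast hm
    rw [hc] at h2
    push_cast at h2
    rw [Real.mul_rpow (by positivity) (by positivity)] at h2
    rw [Real.rpow_sub hm0, Real.rpow_natCast, div_le_iff₀ (by positivity)]
    linarith
  have ht : Tendsto (fun m : ℕ => (m : ℝ) ^ ((k : ℝ) - q)) atTop atTop :=
    (tendsto_rpow_atTop (by linarith)).comp tendsto_natCast_atTop_atTop
  obtain ⟨m, hm, hm1⟩ := ((ht.eventually_gt_atTop A).and (eventually_ge_atTop 1)).exists
  exact absurd (bound m hm1) (not_le.2 hm)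

end LowerBounds

section SmallInitialError

variable {lam : ℕ → ℝ}

lemma le_lam_one (hord : ∀ m m' : ℕ, 1 ≤ m → m ≤ m' → lam m' ≤ lam m) {m : ℕ} (hm : 1 ≤ m) :
    lam m ≤ lam 1 := hord 1 m le_rfl hm

lemma not_curseAbs_of_lt_one (hnn : ∀ m, 0 ≤ lam m)
    (hord : ∀ m m' : ℕ, 1 ≤ m → m ≤ m' → lam m' ≤ lam m) (h1 : lam 1 < 1) :
    ¬ CurseAbs lam := by
  rintro ⟨ε, hε, C, hC, γ, hγ, h⟩
  obtain ⟨D, hD⟩ := exists_pow_lt_of_lt_one (pow_pos hε 2) h1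
  obtain ⟨d, hDd, -, hle⟩ := h D
  have hempty : AbsSet lam ε d = ∅ := by
    ext j
    simp only [AbsSet, Set.mem_ofPred_eq, Set.mem_empty_iff_false, iff_false, not_and, not_lt]
    intro hj
    calc ∏ k, lam (j k) ≤ ∏ _k : Fin d, lam 1 :=
          Finset.prod_le_prod (fun _ _ => hnn _) fun k _ => le_lam_one hord (hj k)
      _ = lam 1 ^ d := by simp
      _ ≤ lam 1 ^ D := pow_le_pow_of_le_one (hnn 1) h1.le hDd
      _ ≤ ε ^ 2 := hD.le
  rw [hempty] at hle
  simp only [Set.encard_empty, ENat.toENNReal_zero, nonpos_iff_eq_zero, ENNReal.ofReal_eq_zero]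
    at hle
  have : 0 < C * (1 + γ) ^ d := by positivity
  linarith

/-- Uniformly in the dimension, a polynomial bound on the information complexity controls the
`ℓ_τ` sums of the tensor product singular values. -/
lemma sum_rpow_pow_le (hnn : ∀ m, 0 ≤ lam m) (hle : ∀ m, 1 ≤ m → lam m ≤ 1) {C p τ : ℝ}
    (hC : 0 < C) (hp : 0 < p) (hτ : p < 2 * τ) {d : ℕ}
    (h : ∀ ε : ℝ, 0 < ε → ε ≤ 1 →
      ((AbsSet lam ε d).encard : ℝ≥0∞) ≤ ENNReal.ofReal (C * ε ^ (-p)))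
    (F : Finset ℕ) (hF : ∀ m ∈ F, 1 ≤ m) :
    (∑ m ∈ F, lam m ^ τ) ^ d ≤ C * 2 ^ p * (1 - 2 ^ (p - 2 * τ))⁻¹ := by
  classical
  have hτ0 : 0 < τ := by linarith
  set r : ℝ := 2 ^ (p - 2 * τ) with hr
  have hr0 : 0 ≤ r := by positivity
  have hr1 : r < 1 := Real.rpow_lt_one_of_one_lt_of_neg (by norm_num) (by linarith)
  set J : Finset (Fin d → ℕ) := Fintype.piFinset (fun _ => F) with hJ
  set q : ℝ := 4 ^ (-τ) with hq
  have hq0 : 0 < q := by positivity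
  have hq1 : q < 1 := Real.rpow_lt_one_of_one_lt_of_neg (by norm_num) (by linarith)
  let a : (Fin d → ℕ) → ℝ := fun j => ∏ k, lam (j k)
  let ind : (Fin d → ℕ) → ℕ → ℝ := fun j k => if ((1 / 2 : ℝ) ^ (k + 1)) ^ 2 < a j then 1 else 0
  have hsum : ∀ j, Summable fun k : ℕ => q ^ k * ind j k := by
    intro j
    refine Summable.of_nonneg_of_le (fun k => ?_) (fun k => ?_)
      (summable_geometric_of_lt_one hq0.le hq1)
    · simp only [ind]; split_ifs <;> positivity
    · simp only [ind]
      split_ifs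
      · simp
      · simp only [mul_zero]; positivity
  have hpt : ∀ j ∈ J, ∏ k, lam (j k) ^ τ ≤ ∑' k, q ^ k * ind j k := by
    intro j hj
    rw [Real.finsetProd_rpow _ _ fun _ _ => hnn _]
    have ha1 : a j ≤ 1 := Finset.prod_le_one (fun _ _ => hnn _)
      fun k _ => hle _ (hF _ (Fintype.mem_piFinset.1 hj k))
    have ha0 : 0 ≤ a j := Finset.prod_nonneg fun _ _ => hnn _
    change a j ^ τ ≤ _
    have hterm0 : ∀ k, 0 ≤ q ^ k * ind j k := by
      intro k; simp only [ind]; split_ifs <;> positivity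
    rcases ha0.eq_or_lt with h0 | hpos
    · rw [← h0, Real.zero_rpow hτ0.ne']
      exact tsum_nonneg hterm0
    · obtain ⟨k, hk1, hk2⟩ := exists_nat_pow_near_of_lt_one hpos ha1 (y := (1 / 4 : ℝ))
        (by norm_num) (by norm_num)
      refine le_trans ?_ ((hsum j).le_tsum k fun i _ => hterm0 i)
      have hi : ind j k = 1 := by
        simp only [ind]
        rw [if_pos]
        rw [← pow_mul, mul_comm, pow_mul]
        norm_num at hk1 ⊢
        exact hk1
      rw [hi, mul_one]
      calc a j ^ τ ≤ ((1 / 4 : ℝ) ^ k) ^ τ := Real.rpow_le_rpow ha0 hk2 hτ0.le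
        _ = q ^ k := by
          rw [hq, ← Real.rpow_natCast, ← Real.rpow_natCast, ← Real.rpow_mul (by norm_num),
            ← Real.rpow_mul (by norm_num), one_div, Real.inv_rpow (by norm_num),
            ← Real.rpow_neg (by norm_num)]
          congr 1; ring
  have hcount : ∀ k : ℕ, ∑ j ∈ J, q ^ k * ind j k ≤ C * 2 ^ p * r ^ k := by
    intro k
    have h2 := card_le_of_encard_le (by positivity)
      (h ((1 / 2) ^ (k + 1)) (by positivity) (pow_le_one₀ (by norm_num) (by norm_num)))
      (F := J.filter fun j => ((1 / 2 : ℝ) ^ (k + 1)) ^ 2 < a j) (by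
        intro j hj
        simp only [Finset.coe_filter, Set.mem_ofPred_eq] at hj
        exact ⟨fun i => hF _ (Fintype.mem_piFinset.1 hj.1 i), hj.2⟩)
    rw [← Finset.mul_sum]
    have h3 : ∑ j ∈ J, ind j k =
        ((J.filter fun j => ((1 / 2 : ℝ) ^ (k + 1)) ^ 2 < a j).card : ℝ) := by
      simp [ind]
    rw [h3]
    calc _ ≤ q ^ k * (C * ((1 / 2) ^ (k + 1)) ^ (-p)) := by gcongr
      _ = C * 2 ^ p * r ^ k := by
        have e1 : ((1 / 2 : ℝ) ^ (k + 1)) ^ (-p) = 2 ^ p * (2 ^ p) ^ k := by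
          rw [one_div, inv_pow, Real.inv_rpow (by positivity), Real.rpow_neg (by positivity),
            inv_inv, ← Real.rpow_natCast, ← Real.rpow_mul (by norm_num), mul_comm _ p,
            Real.rpow_mul (by norm_num), Real.rpow_natCast, pow_succ, mul_comm]
        have e2 : r = 2 ^ p * q := by
          rw [hr, hq, Real.rpow_sub (by norm_num), div_eq_mul_inv, ← Real.rpow_neg (by norm_num),
            show -(2 * τ) = 2 * (-τ) by ring, Real.rpow_mul (by norm_num)]
          norm_num
        rw [e1, e2, mul_pow]; ring
  calc (∑ m ∈ F, lam m ^ τ) ^ d = ∑ j ∈ J, ∏ k, lam (j k) ^ τ := by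
        rw [hJ, ← Finset.prod_univ_sum (fun _ => F) fun _ m => lam m ^ τ]; simp
    _ ≤ ∑ j ∈ J, ∑' k, q ^ k * ind j k := Finset.sum_le_sum hpt
    _ = ∑' k, ∑ j ∈ J, q ^ k * ind j k := (Summable.tsum_finsetSum fun j _ => hsum j).symm
    _ ≤ ∑' k, C * 2 ^ p * r ^ k :=
        (summable_sum fun j _ => hsum j).tsum_le_tsum hcount
          ((summable_geometric_of_lt_one hr0 hr1).mul_left _)
    _ = C * 2 ^ p * (1 - r)⁻¹ := by
        rw [tsum_mul_left, tsum_geometric_of_lt_one hr0 hr1]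

lemma sum_range_succ_eq_sum_Icc (f : ℕ → ℝ) (n : ℕ) :
    ∑ i ∈ Finset.range n, f (i + 1) = ∑ m ∈ Finset.Icc 1 n, f m := by
  rw [Finset.range_eq_Ico, Finset.sum_Ico_add' f 0 n 1, zero_add,
    Finset.Ico_add_one_right_eq_Icc]

lemma summable_of_encard_le (hnn : ∀ m, 0 ≤ lam m) (hle : ∀ m, 1 ≤ m → lam m ≤ 1) {C p τ : ℝ}
    (hC : 0 < C) (hp : 0 < p) (hτ : p < 2 * τ)
    (h : ∀ ε : ℝ, 0 < ε → ε ≤ 1 →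
      ((AbsSet lam ε 1).encard : ℝ≥0∞) ≤ ENNReal.ofReal (C * ε ^ (-p))) :
    Summable (fun m : ℕ => lam (m + 1) ^ τ) := by
  refine summable_of_sum_range_le (c := C * 2 ^ p * (1 - 2 ^ (p - 2 * τ))⁻¹)
    (fun m => Real.rpow_nonneg (hnn _) _) fun n => ?_
  rw [sum_range_succ_eq_sum_Icc (fun m => lam m ^ τ)]
  have := sum_rpow_pow_le hnn hle hC hp hτ h (Finset.Icc 1 n) (by simp +contextual)
  simpa using this

lemma tsum_le_one_of_encard_le (hnn : ∀ m, 0 ≤ lam m) (hle : ∀ m, 1 ≤ m → lam m ≤ 1)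
    {C p τ : ℝ} (hC : 0 < C) (hp : 0 < p) (hτ : p < 2 * τ)
    (h : ∀ d : ℕ, 1 ≤ d → ∀ ε : ℝ, 0 < ε → ε ≤ 1 →
      ((AbsSet lam ε d).encard : ℝ≥0∞) ≤ ENNReal.ofReal (C * ε ^ (-p))) :
    ∑' m : ℕ, lam (m + 1) ^ τ ≤ 1 := by
  refine Real.tsum_le_of_sum_range_le (fun m => Real.rpow_nonneg (hnn _) _) fun n => ?_
  rw [sum_range_succ_eq_sum_Icc (fun m => lam m ^ τ)]
  by_contra! hgt
  obtain ⟨d, hd, hd1⟩ := (((tendsto_pow_atTop_atTop_of_one_lt hgt).eventually_gt_atTop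
    (C * 2 ^ p * (1 - 2 ^ (p - 2 * τ))⁻¹)).and (eventually_ge_atTop 1)).exists
  exact absurd (sum_rpow_pow_le hnn hle hC hp hτ (h d hd1) (Finset.Icc 1 n)
    (by simp +contextual)) (not_le.2 hd)

lemma encard_le_of_tsum_le_one (hnn : ∀ m, 0 ≤ lam m) {τ : ℝ} (hτ : 0 < τ)
    (hs : Summable (fun m : ℕ => lam (m + 1) ^ τ)) (h1 : ∑' m : ℕ, lam (m + 1) ^ τ ≤ 1)
    (d : ℕ) {ε : ℝ} (hε : 0 < ε) :
    ((AbsSet lam ε d).encard : ℝ≥0∞) ≤ ENNReal.ofReal (ε ^ (-(2 * τ))) := by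
  classical
  refine encard_le_ofReal fun F hF => ?_
  obtain ⟨n, hn⟩ : ∃ n : ℕ, ∀ j ∈ F, ∀ k, j k ≤ n :=
    ⟨F.sup fun j => Finset.univ.sup j, fun j hj k =>
      (Finset.le_sup (f := j) (Finset.mem_univ k)).trans
        (Finset.le_sup (f := fun j : Fin d → ℕ => Finset.univ.sup j) hj)⟩
  have h2 := card_mul_le_sum_pow (fun m => lam m ^ τ) (fun m => Real.rpow_nonneg (hnn _) _)
    (Finset.Icc 1 n) F ((ε ^ 2) ^ τ) (fun j hj k => Finset.mem_Icc.2 ⟨(hF hj).1 k, hn j hj k⟩)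
    (fun j hj => by
      rw [Real.finsetProd_rpow _ _ fun _ _ => hnn _]
      exact Real.rpow_le_rpow (by positivity) (hF hj).2.le hτ.le)
  have h3 : ∑ m ∈ Finset.Icc 1 n, lam m ^ τ ≤ 1 := by
    rw [← sum_range_succ_eq_sum_Icc (fun m => lam m ^ τ)]
    exact (hs.sum_le_tsum _ fun m _ => Real.rpow_nonneg (hnn _) _).trans h1
  have h4 : (∑ m ∈ Finset.Icc 1 n, lam m ^ τ) ^ d ≤ 1 :=
    pow_le_one₀ (Finset.sum_nonneg fun m _ => Real.rpow_nonneg (hnn _) _) h3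
  have e : (ε ^ 2) ^ τ = ε ^ (2 * τ) := by
    rw [← Real.rpow_natCast, ← Real.rpow_mul hε.le]; norm_num
  rw [e] at h2
  rw [Real.rpow_neg hε.le, ← one_div, le_div_iff₀ (by positivity)]
  exact h2.trans h4

lemma exists_tsum_le_one (hnn : ∀ m, 0 ≤ lam m)
    (hord : ∀ m m' : ℕ, 1 ≤ m → m ≤ m' → lam m' ≤ lam m) (h0 : 0 < lam 1) (h1 : lam 1 < 1)
    {τ : ℝ} (hτ : 0 < τ) (hs : Summable (fun m : ℕ => lam (m + 1) ^ τ)) :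
    ∃ σ : ℝ, 0 < σ ∧ Summable (fun m : ℕ => lam (m + 1) ^ σ) ∧
      ∑' m : ℕ, lam (m + 1) ^ σ ≤ 1 := by
  set S := ∑' m : ℕ, lam (m + 1) ^ τ with hS
  have hlim : Tendsto (fun n : ℕ => lam 1 ^ n * S) atTop (nhds 0) := by
    simpa using (tendsto_pow_atTop_nhds_zero_of_lt_one h0.le h1).mul_const S
  obtain ⟨n, hn⟩ := (hlim.eventually (gt_mem_nhds one_pos)).exists
  have hterm : ∀ m : ℕ, lam (m + 1) ^ (n + τ) ≤ lam 1 ^ n * lam (m + 1) ^ τ := by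
    intro m
    rw [Real.rpow_add' (hnn _) (by positivity), Real.rpow_natCast]
    have := pow_le_pow_left₀ (hnn (m + 1)) (le_lam_one hord (Nat.le_add_left 1 m)) n
    exact mul_le_mul_of_nonneg_right this (Real.rpow_nonneg (hnn _) _)
  have hs' : Summable (fun m : ℕ => lam (m + 1) ^ ((n : ℝ) + τ)) :=
    Summable.of_nonneg_of_le (fun m => Real.rpow_nonneg (hnn _) _) hterm (hs.mul_left _)
  refine ⟨n + τ, by positivity, hs', ?_⟩
  calc _ ≤ ∑' m : ℕ, lam 1 ^ n * lam (m + 1) ^ τ := hs'.tsum_le_tsum hterm (hs.mul_left _)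
    _ = lam 1 ^ n * S := tsum_mul_left
    _ ≤ 1 := hn.le

lemma sInf_exponents_eq (hnn : ∀ m, 0 ≤ lam m) (hle : ∀ m, 1 ≤ m → lam m ≤ 1)
    (hne : ∃ σ : ℝ, 0 < σ ∧ Summable (fun m : ℕ => lam (m + 1) ^ σ) ∧
      ∑' m : ℕ, lam (m + 1) ^ σ ≤ 1) :
    sInf {p : ℝ | 0 < p ∧ ∃ C : ℝ, 0 < C ∧
        ∀ d : ℕ, 1 ≤ d → ∀ ε : ℝ, 0 < ε → ε ≤ 1 →
          ((AbsSet lam ε d).encard : ℝ≥0∞) ≤ ENNReal.ofReal (C * ε ^ (-p))} =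
      sInf {x : ℝ | ∃ τ : ℝ, 0 < τ ∧ Summable (fun m : ℕ => lam (m + 1) ^ τ) ∧
        (∑' m : ℕ, lam (m + 1) ^ τ) ≤ 1 ∧ x = 2 * τ} := by
  set P := {p : ℝ | 0 < p ∧ ∃ C : ℝ, 0 < C ∧
        ∀ d : ℕ, 1 ≤ d → ∀ ε : ℝ, 0 < ε → ε ≤ 1 →
          ((AbsSet lam ε d).encard : ℝ≥0∞) ≤ ENNReal.ofReal (C * ε ^ (-p))} with hP
  set T := {x : ℝ | ∃ τ : ℝ, 0 < τ ∧ Summable (fun m : ℕ => lam (m + 1) ^ τ) ∧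
        (∑' m : ℕ, lam (m + 1) ^ τ) ≤ 1 ∧ x = 2 * τ} with hT
  have hTP : T ⊆ P := by
    rintro x ⟨τ, hτ, hs, h1, rfl⟩
    refine ⟨by positivity, 1, one_pos, fun d _ ε hε _ => ?_⟩
    rw [one_mul]
    exact encard_le_of_tsum_le_one hnn hτ hs h1 d hε
  have hTne : T.Nonempty := by
    obtain ⟨σ, h1, h2, h3⟩ := hne
    exact ⟨2 * σ, σ, h1, h2, h3, rfl⟩
  have hPb : BddBelow P := ⟨0, fun p hp => hp.1.le⟩
  apply le_antisymm
  · exact csInf_le_csInf hPb hTne hTP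
  · refine le_csInf (hTne.mono hTP) fun p hp => le_of_forall_gt_imp_ge_of_dense fun t ht => ?_
    obtain ⟨hp0, C, hC, h⟩ := hp
    refine csInf_le (hPb.mono hTP) ⟨t / 2, by linarith, ?_, ?_, by ring⟩
    · exact summable_of_encard_le hnn hle hC hp0 (by linarith) (h 1 le_rfl)
    · exact tsum_le_one_of_encard_le hnn hle hC hp0 (by linarith) h

end SmallInitialError

section WeakTractability

variable {lam : ℕ → ℝ}

lemma wtAbs_iff : WTAbs lam ↔
    (∀ (d : ℕ) (ε : ℝ), 1 ≤ d → 0 < ε → ε < eInitAbs lam d → (AbsSet lam ε d).Finite) ∧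
    ∀ δ > (0 : ℝ), ∃ M : ℝ, ∀ (d : ℕ) (ε : ℝ), 0 < ε → ε < eInitAbs lam d → M ≤ ε⁻¹ + d →
      Real.log (max ((AbsSet lam ε d).ncard : ℝ) 1) ≤ δ * (ε⁻¹ + d) := by
  refine and_congr_right fun _ => ⟨fun h δ hδ => ?_, fun h εs ds hε ht => ?_⟩
  · by_contra! hcon
    choose ds εs h0 h1 h2 h3 using fun k : ℕ => hcon (k : ℝ)
    have ht : Tendsto (fun k => (εs k)⁻¹ + (ds k : ℝ)) atTop atTop :=
      tendsto_atTop_mono h2 tendsto_natCast_atTop_atTop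
    obtain ⟨k, hk⟩ := ((h εs ds (fun k => ⟨h0 k, h1 k⟩) ht).eventually (gt_mem_nhds hδ)).exists
    have hpos : 0 < (εs k)⁻¹ + (ds k : ℝ) :=
      add_pos_of_pos_of_nonneg (inv_pos.2 (h0 k)) (by positivity)
    rw [div_lt_iff₀ hpos] at hk
    linarith [h3 k]
  · rw [Metric.tendsto_atTop']
    intro δ hδ
    obtain ⟨M, hM⟩ := h (δ / 2) (half_pos hδ)
    obtain ⟨n, hn⟩ := eventually_atTop.1 (ht.eventually_ge_atTop M)
    refine ⟨n, fun k hk => ?_⟩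
    have hpos : 0 < (εs k)⁻¹ + (ds k : ℝ) :=
      add_pos_of_pos_of_nonneg (inv_pos.2 (hε k).1) (by positivity)
    have hlog : 0 ≤ Real.log (max ((AbsSet lam (εs k) (ds k)).ncard : ℝ) 1) :=
      Real.log_nonneg (le_max_right _ _)
    rw [Real.dist_eq, sub_zero, abs_of_nonneg (by positivity), div_lt_iff₀ hpos]
    have := hM (ds k) (εs k) (hε k).1 (hε k).2 (hn k hk.le)
    nlinarith

lemma card_le_ncard {α : Type*} {s : Set α} (hs : s.Finite) {F : Finset α}
    (hF : (F : Set α) ⊆ s) : F.card ≤ s.ncard := by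
  rw [← Set.ncard_coe_finset F]
  exact Set.ncard_le_ncard hF hs

lemma lam_two_lt_one_of_wtAbs (h1 : lam 1 = 1) (h21 : lam 2 ≤ 1) (h : WTAbs lam) :
    lam 2 < 1 := by
  refine lt_of_le_of_ne h21 fun h2 => ?_
  obtain ⟨hfin, hb⟩ := wtAbs_iff.1 h
  have hl2 : 0 < Real.log 2 := Real.log_pos (by norm_num)
  obtain ⟨M, hM⟩ := hb (Real.log 2 / 4) (by positivity)
  obtain ⟨n, hn⟩ := exists_nat_ge (max M 2)
  have hn2 : (2 : ℝ) ≤ n := (le_max_right _ _).trans hn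
  have hn2' : 2 ≤ n := by exact_mod_cast hn2
  have hex := exists_two_pow_subset_absSet (lam := lam) (ε := 1 / 2) h1.ge 0
    (by simp [h2]) n (by norm_num)
  rw [zero_add, mul_one] at hex
  obtain ⟨F, hF, hc⟩ := hex
  have he : (1 / 2 : ℝ) < eInitAbs lam n := by
    rw [eInitAbs, h1]; norm_num
  have hcard := card_le_ncard (hfin n (1 / 2) (by omega) (by norm_num) he) hF
  rw [hc] at hcard
  have hcard' : (2 : ℝ) ^ n ≤ max ((AbsSet lam (1 / 2) n).ncard : ℝ) 1 :=
    le_max_of_le_left (by exact_mod_cast hcard)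
  have h3 := Real.log_le_log (by positivity) hcard'
  rw [Real.log_pow] at h3
  have h4 := hM n (1 / 2) (by norm_num) he (by
    have := (le_max_left M 2).trans hn
    norm_num; linarith)
  norm_num at h3 h4
  nlinarith

lemma const_mem_absSet_one {m : ℕ} (hm : 1 ≤ m) {ε : ℝ} (h : ε ^ 2 < lam m) :
    (fun _ => m) ∈ AbsSet lam ε 1 :=
  ⟨fun _ => hm, by simpa using h⟩

lemma tendsto_zero_of_finite (hnn : ∀ m, 0 ≤ lam m) (h0 : 0 < lam 1)
    (hfin : ∀ ε : ℝ, 0 < ε → ε < eInitAbs lam 1 → (AbsSet lam ε 1).Finite) :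
    Tendsto lam atTop (nhds 0) := by
  rw [tendsto_order]
  refine ⟨fun a ha => .of_forall fun m => ha.trans_le (hnn m), fun a ha => ?_⟩
  set s := min (a / 2) (lam 1 / 2) with hs
  have hs0 : 0 < s := lt_min (half_pos ha) (half_pos h0)
  have hfin1 := hfin (√s) (Real.sqrt_pos.2 hs0) (by
    rw [eInitAbs, pow_one]
    exact Real.sqrt_lt_sqrt hs0.le ((min_le_right _ _).trans_lt (half_lt_self h0)))
  have hpre := hfin1.preimage (f := fun (m : ℕ) (_ : Fin 1) => m)
    (fun m _ m' _ h => congrFun h 0)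
  have hev := hpre.compl_mem_cofinite
  rw [Nat.cofinite_eq_atTop] at hev
  filter_upwards [hev, eventually_ge_atTop 1] with m hm hm1
  by_contra! hge
  refine hm (const_mem_absSet_one hm1 ?_)
  rw [Real.sq_sqrt hs0.le]
  have := min_le_left (a / 2) (lam 1 / 2)
  linarith

lemma tendsto_mul_log_sq_of_wtAbs (hnn : ∀ m, 0 ≤ lam m)
    (hord : ∀ m m' : ℕ, 1 ≤ m → m ≤ m' → lam m' ≤ lam m) (h0 : 0 < lam 1) (h1 : lam 1 ≤ 1)
    (h : WTAbs lam) : Tendsto (fun m : ℕ => lam m * Real.log m ^ 2) atTop (nhds 0) := by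
  obtain ⟨hfin, hb⟩ := wtAbs_iff.1 h
  have hzero := tendsto_zero_of_finite hnn h0 fun ε => hfin 1 ε le_rfl
  rw [tendsto_order]
  refine ⟨fun a ha => .of_forall fun m => ha.trans_le (mul_nonneg (hnn m) (sq_nonneg _)),
    fun c hc => ?_⟩
  obtain ⟨M, hM⟩ := hb (√c / 3) (by positivity)
  set M' := max M 1 with hM'
  have hM'0 : 0 < M' := lt_max_of_lt_right one_pos
  filter_upwards [eventually_ge_atTop 1,
    hzero.eventually (gt_mem_nhds (show 0 < (M'⁻¹) ^ 2 by positivity))]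
    with m hm1 hm
  rcases (hnn m).eq_or_lt with hm0 | hm0
  · simpa [← hm0] using hc
  have hle1 : lam m ≤ lam 1 := hord 1 m le_rfl hm1
  set ε := √(lam m / 2) with hε
  have hε0 : 0 < ε := Real.sqrt_pos.2 (by positivity)
  have hεsq : ε ^ 2 = lam m / 2 := Real.sq_sqrt (by positivity)
  have hεi : ε < eInitAbs lam 1 := by
    rw [eInitAbs, pow_one]
    exact Real.sqrt_lt_sqrt (by positivity) (by linarith)
  have hε1 : ε ≤ 1 := by nlinarith
  have hεM : M ≤ ε⁻¹ + (1 : ℕ) := by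
    have : ε ≤ M'⁻¹ := by
      refine le_of_lt (lt_of_pow_lt_pow_left₀ 2 (by positivity) ?_)
      linarith
    have h2 : M' ≤ ε⁻¹ := by
      rw [le_inv_comm₀ hM'0 hε0]; exact this
    have := le_max_left M 1
    push_cast
    linarith
  have h3 := hM 1 ε hε0 hεi hεM
  obtain ⟨F, hF, hcF⟩ := exists_finset_card_of_injective (s := AbsSet lam ε 1)
    (fun (i : Fin m) (_ : Fin 1) => (i : ℕ) + 1)
    (fun i i' hii => by
      have := congrFun hii 0
      exact Fin.ext (by simpa using this))
    (fun i => const_mem_absSet_one (by omega) (by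
      have := hord (i + 1) m (by omega) i.2
      linarith))
  have hcard := card_le_ncard (hfin 1 ε le_rfl hε0 hεi) hF
  rw [hcF, Fintype.card_fin] at hcard
  have h4 : Real.log m ≤ √c / 3 * (ε⁻¹ + (1 : ℕ)) :=
    (Real.log_le_log (by exact_mod_cast hm1)
      (le_max_of_le_left (by exact_mod_cast hcard))).trans h3
  have hl0 : 0 ≤ Real.log m := Real.log_natCast_nonneg m
  have h5 : ε * Real.log m ≤ √c / 3 * 2 := by
    calc ε * Real.log m ≤ ε * (√c / 3 * (ε⁻¹ + (1 : ℕ))) := by gcongr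
      _ = √c / 3 * (1 + ε) := by push_cast; field_simp
      _ ≤ √c / 3 * 2 := by gcongr; linarith
  have h6 : (ε * Real.log m) ^ 2 ≤ (√c / 3 * 2) ^ 2 := pow_le_pow_left₀ (by positivity) h5 2
  rw [mul_pow, hεsq, mul_pow, div_pow, Real.sq_sqrt hc.le] at h6
  nlinarith

lemma log_le_add_div_of_tendsto
    (h : Tendsto (fun m : ℕ => lam m * Real.log m ^ 2) atTop (nhds 0)) {η : ℝ} (hη : 0 < η) :
    ∃ L : ℝ, 0 ≤ L ∧ ∀ s : ℝ, 0 < s → ∀ m : ℕ, 1 ≤ m → s ^ 2 < lam m →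
      Real.log m ≤ L + η / s := by
  obtain ⟨n, hn⟩ := eventually_atTop.1 (h.eventually (gt_mem_nhds (pow_pos hη 2)))
  refine ⟨Real.log n, Real.log_natCast_nonneg n, fun s hs m hm hsm => ?_⟩
  have hdiv : 0 < η / s := by positivity
  rcases le_total m n with hmn | hmn
  · have := Real.log_le_log (by exact_mod_cast hm) (Nat.cast_le (α := ℝ).2 hmn)
    linarith
  · have h1 := hn m hmn
    have h2 : (s * Real.log m) ^ 2 < η ^ 2 := by
      rw [mul_pow]
      exact (mul_le_mul_of_nonneg_right hsm.le (sq_nonneg _)).trans_lt h1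
    have h3 : s * Real.log m < η := lt_of_pow_lt_pow_left₀ 2 hη.le h2
    have h4 : Real.log m ≤ η / s := by
      rw [le_div_iff₀ hs]; linarith
    linarith [Real.log_natCast_nonneg n]

/-- If at most one coordinate of an index can exceed `M` and none can exceed `N`, the number of
indices is controlled by the number of coordinates that may differ from `1`. -/
lemma card_le_exp_of_thresholds (hnn : ∀ m, 0 ≤ lam m)
    (hord : ∀ m m' : ℕ, 1 ≤ m → m ≤ m' → lam m' ≤ lam m) (h0 : 0 < lam 2) (h1 : lam 1 ≤ 1)
    (h2 : lam 2 < 1) {d : ℕ} (hd : 1 ≤ d) {ε : ℝ} (hε : 0 < ε) {M N : ℕ}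
    (hM : 1 ≤ M) (hN : 1 ≤ N) (hMl : ∀ m : ℕ, 1 ≤ m → ε < lam m → m ≤ M)
    (hNl : ∀ m : ℕ, 1 ≤ m → ε ^ 2 < lam m → m ≤ N) {F : Finset (Fin d → ℕ)}
    (hF : (F : Set (Fin d → ℕ)) ⊆ AbsSet lam ε d) :
    (F.card : ℝ) ≤ Real.exp (2 + 2 * Real.log ε⁻¹ / Real.log (lam 2)⁻¹ * Real.log (d * M)
      + Real.log (d * N)) := by
  classical
  have hd' : (1 : ℝ) ≤ d := by exact_mod_cast hd
  have hM' : (1 : ℝ) ≤ M := by exact_mod_cast hM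
  have hN' : (1 : ℝ) ≤ N := by exact_mod_cast hN
  have hl1 : ∀ m, 1 ≤ m → lam m ≤ 1 := fun m hm => (hord 1 m le_rfl hm).trans h1
  set K := 2 * Real.log ε⁻¹ / Real.log (lam 2)⁻¹ with hK
  set x : ℝ := (d * M : ℝ)⁻¹ with hx
  set y : ℝ := (d * N : ℝ)⁻¹ with hy
  have hx0 : 0 < x := by positivity
  have hy0 : 0 < y := by positivity
  have hx1 : x ≤ 1 := inv_le_one_of_one_le₀ (by nlinarith)
  have hy1 : y ≤ 1 := inv_le_one_of_one_le₀ (by nlinarith)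
  let w : ℕ → ℝ := fun m => if m ≤ 1 then 1 else if m ≤ M then x else y
  have hw0 : ∀ m, 0 ≤ w m := by
    intro m; simp only [w]; split_ifs <;> positivity
  have hfac : ∀ j ∈ AbsSet lam ε d, ∀ i, ε ^ 2 < lam (j i) := by
    intro j hj i
    refine hj.2.trans_le ?_
    rw [← Finset.mul_prod_erase _ _ (Finset.mem_univ i)]
    exact mul_le_of_le_one_right (hnn _)
      (Finset.prod_le_one (fun _ _ => hnn _) fun k _ => hl1 _ (hj.1 k))
  have hpair : ∀ j ∈ AbsSet lam ε d, ∀ i i', i ≠ i' → M < j i → j i' ≤ M := by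
    intro j hj i i' hne hi
    by_contra! hi'
    refine absurd hj.2 (not_lt.2 ?_)
    have e1 : lam (j i) ≤ ε := by
      by_contra! hc; exact absurd (hMl _ (hj.1 i) hc) (by omega)
    have e2 : lam (j i') ≤ ε := by
      by_contra! hc; exact absurd (hMl _ (hj.1 i') hc) (by omega)
    rw [← Finset.mul_prod_erase _ _ (Finset.mem_univ i),
      ← Finset.mul_prod_erase _ _ (Finset.mem_erase.2 ⟨hne.symm, Finset.mem_univ i'⟩), sq]
    refine mul_le_mul e1 ?_ (mul_nonneg (hnn _) (Finset.prod_nonneg fun _ _ => hnn _)) hε.le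
    exact (mul_le_of_le_one_right (hnn _)
      (Finset.prod_le_one (fun _ _ => hnn _) fun k _ => hl1 _ (hj.1 k))).trans e2
  have hcountK : ∀ j ∈ AbsSet lam ε d,
      ((Finset.univ.filter fun i => ¬ j i ≤ 1).card : ℝ) ≤ K := by
    intro j hj
    set k := (Finset.univ.filter fun i => ¬ j i ≤ 1).card with hk
    have hlt : ε ^ 2 < lam 2 ^ k := by
      refine hj.2.trans_le ?_
      calc ∏ i, lam (j i) ≤ ∏ i, (if j i ≤ 1 then 1 else lam 2) := by
            refine Finset.prod_le_prod (fun _ _ => hnn _) fun i _ => ?_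
            split_ifs with hi
            · exact hl1 _ (hj.1 i)
            · exact hord 2 _ (by norm_num) (by omega)
        _ = lam 2 ^ k := by simp [Finset.prod_ite, hk]
    have hlog := Real.log_le_log (by positivity) hlt.le
    rw [Real.log_pow, Real.log_pow] at hlog
    have hneg : 0 < Real.log (lam 2)⁻¹ := Real.log_pos (one_lt_inv₀ h0 |>.2 h2)
    rw [hK, le_div_iff₀ hneg, Real.log_inv, Real.log_inv]
    push_cast at hlog
    linarith
  have hprod : ∀ j ∈ F, y * Real.exp (-(K * Real.log (d * M))) ≤ ∏ i, w (j i) := by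
    intro j hj
    have hjA := hF hj
    have hKk := hcountK j hjA
    set k := (Finset.univ.filter fun i => ¬ j i ≤ 1).card with hk
    have hxk : Real.exp (-(K * Real.log (d * M))) ≤ x ^ k := by
      rw [← Real.exp_log (pow_pos hx0 k), Real.log_pow, hx, Real.log_inv]
      refine Real.exp_le_exp.2 ?_
      have : 0 ≤ Real.log ((d : ℝ) * M) := Real.log_nonneg (by nlinarith)
      nlinarith
    have hxprod : ∏ i, (if j i ≤ 1 then 1 else x) = x ^ k := by simp [Finset.prod_ite, hk]
    refine (mul_le_mul_of_nonneg_left hxk hy0.le).trans ?_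
    rw [← hxprod]
    by_cases hex : ∃ i, M < j i
    · obtain ⟨i, hi⟩ := hex
      rw [← Finset.mul_prod_erase _ (fun i => w (j i)) (Finset.mem_univ i),
        ← Finset.mul_prod_erase _ (fun i => if j i ≤ 1 then 1 else x) (Finset.mem_univ i)]
      have e1 : w (j i) = y := by
        simp only [w]; rw [if_neg (by omega), if_neg (by omega)]
      have e2 : ∏ i' ∈ Finset.univ.erase i, w (j i') =
          ∏ i' ∈ Finset.univ.erase i, (if j i' ≤ 1 then 1 else x) := by
        refine Finset.prod_congr rfl fun i' hi' => ?_
        have := hpair j hjA i i' (Finset.ne_of_mem_erase hi').symm hi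
        simp [w, this]
      rw [e1, e2]
      refine mul_le_mul_of_nonneg_left (mul_le_of_le_one_left ?_ ?_) hy0.le
      · exact Finset.prod_nonneg fun _ _ => by split_ifs <;> positivity
      · split_ifs <;> linarith
    · push Not at hex
      have e2 : ∏ i, w (j i) = ∏ i, (if j i ≤ 1 then 1 else x) :=
        Finset.prod_congr rfl fun i _ => by simp [w, hex i]
      rw [e2]
      exact mul_le_of_le_one_left
        (Finset.prod_nonneg fun _ _ => by split_ifs <;> positivity) hy1
  have hsum : ∑ m ∈ Finset.Icc 1 N, w m ≤ 1 + 2 / d := by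
    calc ∑ m ∈ Finset.Icc 1 N, w m
        ≤ ∑ m ∈ Finset.Icc 1 N, ((if m = 1 then 1 else 0) + (if m ∈ Finset.Icc 1 M then x else 0)
            + y) := by
          refine Finset.sum_le_sum fun m hm => ?_
          have hm1 := (Finset.mem_Icc.1 hm).1
          simp only [w, Finset.mem_Icc]
          split_ifs <;> first | omega | linarith
      _ ≤ 1 + M * x + N * y := by
          rw [Finset.sum_add_distrib, Finset.sum_add_distrib]
          gcongr
          · simp [hN]
          · rw [← Finset.sum_filter, Finset.sum_const, nsmul_eq_mul]
            gcongr
            refine (Finset.card_le_card (t := Finset.Icc 1 M) fun m hm => ?_).trans (by simp)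
            exact (Finset.mem_filter.1 hm).2
          · simp
      _ = 1 + 2 / d := by
          rw [hx, hy]; field_simp; ring
  have hmain := card_mul_le_sum_pow w hw0 (Finset.Icc 1 N) F _
    (fun j hj i => Finset.mem_Icc.2 ⟨(hF hj).1 i, hNl _ ((hF hj).1 i) (hfac j (hF hj) i)⟩) hprod
  have hexp : (∑ m ∈ Finset.Icc 1 N, w m) ^ d ≤ Real.exp 2 := by
    calc (∑ m ∈ Finset.Icc 1 N, w m) ^ d ≤ (Real.exp (2 / d)) ^ d := by
          refine pow_le_pow_left₀ (Finset.sum_nonneg fun m _ => hw0 m) (hsum.trans ?_) d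
          linarith [Real.add_one_le_exp (2 / (d : ℝ))]
      _ = Real.exp 2 := by
          rw [← Real.exp_nat_mul]; congr 1; field_simp
  have hB : y * Real.exp (-(K * Real.log (d * M))) =
      Real.exp (-(K * Real.log (d * M) + Real.log (d * N))) := by
    rw [neg_add, Real.exp_add, mul_comm, Real.exp_neg (Real.log _), Real.exp_log (by positivity)]
  rw [hB, Real.exp_neg, ← div_eq_mul_inv, div_le_iff₀ (Real.exp_pos _)] at hmain
  refine (hmain.trans (mul_le_mul_of_nonneg_right hexp (Real.exp_pos _).le)).trans_eq ?_
  rw [← Real.exp_add, add_assoc]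

lemma eventually_log_bound_le (a b L : ℝ) {δ : ℝ} (hδ : 0 < δ) :
    ∀ᶠ s : ℝ in atTop,
      b + a * Real.log s * (Real.log s + L + √s) + Real.log s ≤ δ * s := by
  have hlog : (fun s : ℝ => Real.log s) =o[atTop] fun s => √s := by
    simpa only [Real.sqrt_eq_rpow] using isLittleO_log_rpow_atTop (r := 1 / 2) (by norm_num)
  have hsqrt : (fun s : ℝ => √s) =O[atTop] fun s => √s := Asymptotics.isBigO_refl _ _
  have htop : Tendsto (fun s : ℝ => ‖√s‖) atTop atTop :=
    tendsto_norm_atTop_atTop.comp Real.tendsto_sqrt_atTop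
  have hconst : ∀ c : ℝ, (fun _ : ℝ => c) =O[atTop] fun s => √s := fun c =>
    (Asymptotics.isLittleO_const_left.2 (.inr htop)).isBigO
  have hsq : (fun s : ℝ => √s * √s) =ᶠ[atTop] id := by
    filter_upwards [eventually_ge_atTop 0] with s hs
    exact Real.mul_self_sqrt hs
  have h1 : (fun s : ℝ => a * Real.log s * (Real.log s + L + √s)) =o[atTop] (id : ℝ → ℝ) :=
    ((hlog.const_mul_left a).mul_isBigO ((hlog.isBigO.add (hconst L)).add hsqrt)).trans_eventuallyEq
      hsq
  have h2 : (fun _ : ℝ => b) =o[atTop] (id : ℝ → ℝ) := Asymptotics.isLittleO_const_id_atTop b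
  have h := ((h2.add h1).add Real.isLittleO_log_id_atTop).bound hδ
  filter_upwards [h, eventually_ge_atTop 0] with s hs hs0
  simp only [id, Real.norm_eq_abs, abs_of_nonneg hs0] at hs
  exact (le_abs_self _).trans hs

lemma wtAbs_of_tendsto (hnn : ∀ m, 0 ≤ lam m)
    (hord : ∀ m m' : ℕ, 1 ≤ m → m ≤ m' → lam m' ≤ lam m) (h0 : 0 < lam 2) (h1 : lam 1 ≤ 1)
    (h2 : lam 2 < 1) (h : Tendsto (fun m : ℕ => lam m * Real.log m ^ 2) atTop (nhds 0)) :
    WTAbs lam := by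
  have hexp_floor : ∀ {A : ℝ}, 0 ≤ A → 1 ≤ ⌊Real.exp A⌋₊ ∧ Real.log ⌊Real.exp A⌋₊ ≤ A ∧
      ∀ m : ℕ, 1 ≤ m → Real.log m ≤ A → m ≤ ⌊Real.exp A⌋₊ := by
    intro A hA
    have hfl : 1 ≤ ⌊Real.exp A⌋₊ := Nat.le_floor (by simpa using hA)
    refine ⟨hfl, ?_, fun m hm hmA => Nat.le_floor ?_⟩
    · rw [Real.log_le_iff_le_exp (by exact_mod_cast hfl)]
      exact Nat.floor_le (Real.exp_pos _).le
    · exact (Real.log_le_iff_le_exp (by exact_mod_cast hm)).1 hmA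
  have hlt1 : ∀ {d : ℕ} {ε : ℝ}, ε < eInitAbs lam d → ε < 1 := fun hε =>
    hε.trans_le (Real.sqrt_le_one.2 (pow_le_one₀ (hnn 1) h1))
  set a := 2 / Real.log (lam 2)⁻¹ with ha
  have ha0 : 0 < a := div_pos two_pos (Real.log_pos (one_lt_inv₀ h0 |>.2 h2))
  obtain ⟨L, hL0, hL⟩ := log_le_add_div_of_tendsto h one_pos
  have hbound : ∀ η : ℝ, 0 < η → ∃ R : ℝ, 0 ≤ R ∧ ∀ (d : ℕ) (ε : ℝ), 1 ≤ d → 0 < ε → ε < 1 →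
      ∀ F : Finset (Fin d → ℕ), (F : Set (Fin d → ℕ)) ⊆ AbsSet lam ε d →
        (F.card : ℝ) ≤ Real.exp (2 + R + a * Real.log (ε⁻¹ + d) *
          (Real.log (ε⁻¹ + d) + L + √(ε⁻¹ + d)) + Real.log (ε⁻¹ + d) + η * (ε⁻¹ + d)) := by
    intro η hη
    obtain ⟨R, hR0, hR⟩ := log_le_add_div_of_tendsto h hη
    refine ⟨R, hR0, fun d ε hd hε hε1 F hF => ?_⟩
    obtain ⟨hM1, hM2, hM3⟩ := hexp_floor (A := L + 1 / √ε) (by positivity)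
    obtain ⟨hN1, hN2, hN3⟩ := hexp_floor (A := R + η / ε) (by positivity)
    set M := ⌊Real.exp (L + 1 / √ε)⌋₊
    set N := ⌊Real.exp (R + η / ε)⌋₊
    refine (card_le_exp_of_thresholds hnn hord h0 h1 h2 hd hε hM1 hN1
      (fun m hm hm' => hM3 m hm (hL _ (Real.sqrt_pos.2 hε) m hm (by rwa [Real.sq_sqrt hε.le])))
      (fun m hm hm' => hN3 m hm (hR _ hε m hm hm')) hF).trans (Real.exp_le_exp.2 ?_)
    have hd0 : (1 : ℝ) ≤ d := by exact_mod_cast hd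
    have hM0 : (1 : ℝ) ≤ M := by exact_mod_cast hM1
    have hN0 : (1 : ℝ) ≤ N := by exact_mod_cast hN1
    have hei : 1 < ε⁻¹ := (one_lt_inv₀ hε).2 hε1
    rw [Real.log_mul (by positivity) (by positivity), Real.log_mul (by positivity) (by positivity)]
    set s := ε⁻¹ + (d : ℝ) with hs
    have hlogd : Real.log d ≤ Real.log s := Real.log_le_log (by positivity) (by linarith)
    have hloge : Real.log ε⁻¹ ≤ Real.log s := Real.log_le_log (by positivity) (by linarith)
    have hsqrt : 1 / √ε ≤ √s := by
      rw [one_div, ← Real.sqrt_inv]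
      exact Real.sqrt_le_sqrt (by linarith)
    have hdiv : η / ε ≤ η * s := by
      rw [div_eq_mul_inv]
      exact mul_le_mul_of_nonneg_left (by linarith) hη.le
    have hK : 2 * Real.log ε⁻¹ / Real.log (lam 2)⁻¹ = a * Real.log ε⁻¹ := by rw [ha]; ring
    have hle0 : 0 ≤ Real.log ε⁻¹ := Real.log_nonneg hei.le
    have hmul : a * Real.log ε⁻¹ * (Real.log d + Real.log M) ≤
        a * Real.log s * (Real.log s + L + √s) := by
      have : 0 ≤ Real.log (d : ℝ) := Real.log_nonneg hd0
      have : 0 ≤ Real.log (M : ℝ) := Real.log_nonneg hM0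
      exact mul_le_mul (mul_le_mul_of_nonneg_left hloge ha0.le) (by linarith) (by linarith)
        (mul_nonneg ha0.le (hle0.trans hloge))
    rw [hK]
    linarith
  refine wtAbs_iff.2 ⟨fun d ε hd hε hεi => ?_, fun δ hδ => ?_⟩
  · obtain ⟨R, -, hR⟩ := hbound 1 one_pos
    have := encard_le_ofReal (hR d ε hd hε (hlt1 hεi))
    rw [← Set.encard_lt_top_iff, ← ENat.toENNReal_lt_top]
    exact this.trans_lt ENNReal.ofReal_lt_top
  · obtain ⟨R, hR0, hR⟩ := hbound (δ / 2) (half_pos hδ)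
    obtain ⟨S, hS⟩ := eventually_atTop.1 (eventually_log_bound_le a (2 + R) L (half_pos hδ))
    refine ⟨S, fun d ε hε hεi hSle => ?_⟩
    have hpos : 0 ≤ δ * (ε⁻¹ + d) := by positivity
    rw [Real.log_le_iff_le_exp (lt_max_of_lt_right one_pos)]
    refine max_le ?_ (Real.one_le_exp hpos)
    rcases Nat.eq_zero_or_pos d with rfl | hd
    · refine le_trans ?_ (Real.one_le_exp hpos)
      exact_mod_cast Set.ncard_le_one_of_subsingleton _
    · by_cases hfin : (AbsSet lam ε d).Finite
      · rw [Set.ncard_eq_toFinset_card _ hfin]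
        refine (hR d ε hd hε (hlt1 hεi) hfin.toFinset (by simp)).trans (Real.exp_le_exp.2 ?_)
        linarith [hS _ hSle]
      · rw [Set.Infinite.ncard hfin]
        simpa using (Real.exp_pos _).le

end WeakTractability

/-- **Paper Theorem 2.8** (unweighted tensor product problems, absolute error
criterion).  (a) If `λ₁ > 1` the curse of dimensionality holds.  (b) If `λ₁ = 1` the
problem is not polynomially tractable; if moreover `λ₂ = 1` the curse holds, and the
problem is weakly tractable iff `λ₂ < 1` and `λ_n ∈ o(ln^{-2} n)`.  (c) If `λ₁ < 1` the
curse never holds, weak tractability holds iff `λ_n ∈ o(ln^{-2} n)`, polynomial and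
strong polynomial tractability are equivalent and hold iff `λ ∈ ℓ_τ` for some `τ > 0`,
and the exponent of strong polynomial tractability is `inf {2τ : ∑_m λ_m^τ ≤ 1}`. -/
theorem stmt10 (lam : ℕ → ℝ)
    (hnn : ∀ m, 0 ≤ lam m)
    (hord : ∀ m m' : ℕ, 1 ≤ m → m ≤ m' → lam m' ≤ lam m)
    (hlam2 : 0 < lam 2) :
    (1 < lam 1 → CurseAbs lam) ∧
    (lam 1 = 1 →
      ¬ PTAbs lam ∧
      (lam 2 = 1 → CurseAbs lam) ∧
      (WTAbs lam ↔
        lam 2 < 1 ∧ Tendsto (fun m : ℕ => lam m * Real.log m ^ 2) atTop (nhds 0))) ∧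
    (lam 1 < 1 →
      ¬ CurseAbs lam ∧
      (WTAbs lam ↔ Tendsto (fun m : ℕ => lam m * Real.log m ^ 2) atTop (nhds 0)) ∧
      (PTAbs lam ↔ SPTAbs lam) ∧
      (SPTAbs lam ↔ ∃ τ : ℝ, 0 < τ ∧ Summable (fun m : ℕ => lam (m + 1) ^ τ)) ∧
      (SPTAbs lam →
        sInf {p : ℝ | 0 < p ∧ ∃ C : ℝ, 0 < C ∧
            ∀ d : ℕ, 1 ≤ d → ∀ ε : ℝ, 0 < ε → ε ≤ 1 →
              ((AbsSet lam ε d).encard : ℝ≥0∞) ≤ ENNReal.ofReal (C * ε ^ (-p))} =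
          sInf {x : ℝ | ∃ τ : ℝ, 0 < τ ∧ Summable (fun m : ℕ => lam (m + 1) ^ τ) ∧
            (∑' m : ℕ, lam (m + 1) ^ τ) ≤ 1 ∧ x = 2 * τ})) := by
  have h12 : lam 2 ≤ lam 1 := hord 1 2 le_rfl (by norm_num)
  have h0 : 0 < lam 1 := hlam2.trans_le h12
  refine ⟨fun h1 => ?_, fun h1 => ⟨?_, fun h2 => ?_, ?_⟩, fun h1 => ?_⟩
  · obtain ⟨N, hN⟩ := pow_unbounded_of_one_lt (lam 2)⁻¹ h1
    exact curseAbs_of_one_le h1.le N ((inv_le_iff_one_le_mul₀ hlam2).1 hN.le)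
  · exact not_ptAbs_of_one hlam2 h1 (h12.trans h1.le)
  · exact curseAbs_of_one_le h1.ge 0 (by simp [h2])
  · refine ⟨fun h => ⟨lam_two_lt_one_of_wtAbs h1 (h12.trans h1.le) h,
      tendsto_mul_log_sq_of_wtAbs hnn hord h0 h1.le h⟩, fun h => ?_⟩
    exact wtAbs_of_tendsto hnn hord hlam2 h1.le h.1 h.2
  · have hle : ∀ m, 1 ≤ m → lam m ≤ 1 := fun m hm => (le_lam_one hord hm).trans h1.le
    have hptsum : PTAbs lam → ∃ τ : ℝ, 0 < τ ∧ Summable (fun m : ℕ => lam (m + 1) ^ τ) := by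
      rintro ⟨C, hC, p, hp, q, -, h⟩
      refine ⟨p, hp, summable_of_encard_le hnn hle hC hp (by linarith) fun ε hε hε1 => ?_⟩
      simpa using h 1 le_rfl ε hε hε1
    have hsumspt : (∃ τ : ℝ, 0 < τ ∧ Summable (fun m : ℕ => lam (m + 1) ^ τ)) → SPTAbs lam := by
      rintro ⟨τ, hτ, hs⟩
      obtain ⟨σ, hσ, hs', hσ1⟩ := exists_tsum_le_one hnn hord h0 h1 hτ hs
      refine ⟨1, one_pos, 2 * σ, by positivity, fun d _ ε hε _ => ?_⟩
      rw [one_mul]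
      exact encard_le_of_tsum_le_one hnn hσ hs' hσ1 d hε
    have hsptpt : SPTAbs lam → PTAbs lam := by
      rintro ⟨C, hC, p, hp, h⟩
      exact ⟨C, hC, p, hp, 0, le_rfl, by simpa using h⟩
    refine ⟨not_curseAbs_of_lt_one hnn hord h1,
      ⟨tendsto_mul_log_sq_of_wtAbs hnn hord h0 h1.le,
        wtAbs_of_tendsto hnn hord hlam2 h1.le (h12.trans_lt h1)⟩,
      ⟨hsumspt ∘ hptsum, hsptpt⟩, ⟨hptsum ∘ hsptpt, hsumspt⟩, fun hspt => ?_⟩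
    obtain ⟨τ, hτ, hs⟩ := hptsum (hsptpt hspt)
    exact sInf_exponents_eq hnn hle (exists_tsum_le_one hnn hord h0 h1 hτ hs)
end

section
/- Fix d ≥ 1 and generator weights C_γ ≥ γ_{d,1} ≥ γ_{d,2} ≥ … ≥ γ_{d,d} > 0, and for α ∈ {0,1}^d set γ_α = Π_{j=1}^d γ_{d,j}^{α_j}. Let P_d^γ be the space of all real polynomials on [0,1]^d of degree at most one in each variable, with norm ‖f‖ = max_{α∈{0,1}^d} γ_α^{−1} · sup_{x∈[0,1]^d} |D^α f(x)|. Then there exists an integer s with 0 ≤ s ≤ d and s > (Σ_{j=1}^d γ_{d,j} − 2)/(2 + C_γ) such that for every n < 2^s, for every map φ : ℝⁿ → ([0,1]^d → ℝ), for every r ≥ 0, and for every information map N : P_d^γ → ℝⁿ that is either continuous or of adaptive linear form (N(f) = (y₁,…,yₙ) with y₁ = L₁(f), y_j = L_j(f; y₁,…,y_{j−1}), each L_j(·;y) : P_d^γ → ℝ linear), there exists f ∈ P_d^γ with ‖f‖ ≤ r and sup_{x∈[0,1]^d} |f(x) − (φ(N(f)))(x)| ≥ r. -/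
open scoped ENNReal

/-- The unit cube `[0,1]^d`. -/
def cube01 (d : ℕ) : Set (Fin d → ℝ) := {x | ∀ j, x j ∈ Set.Icc (0 : ℝ) 1}

/-- A `d`-variate polynomial of degree at most one in each variable, given by its
coefficients `c : {0,1}^d → ℝ`: `f(x) = ∑_i c_i x^i`. -/
noncomputable def polyEval {d : ℕ} (c : (Fin d → Bool) → ℝ) (x : Fin d → ℝ) : ℝ :=
  ∑ i : Fin d → Bool, c i * ∏ j : Fin d, if i j then x j else 1

/-- Coefficients of the partial derivative `D^α f` of the multilinear polynomial with
coefficients `c`: `D^α (∑ c_i x^i) = ∑_{m : m ∧ α = 0} c_{m ∨ α} x^m`. -/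
def derivCoef {d : ℕ} (c : (Fin d → Bool) → ℝ) (α : Fin d → Bool) :
    (Fin d → Bool) → ℝ :=
  fun m => if ∀ j, α j = true → m j = false then c (fun j => m j || α j) else 0

/-- The sup norm `‖g‖_{L_∞([0,1]^d)}` of a function on the unit cube. -/
noncomputable def supCube {d : ℕ} (g : (Fin d → ℝ) → ℝ) : ℝ :=
  sSup ((fun x => |g x|) '' cube01 d)

/-- The product weight `γ_α = ∏_{j : α_j = 1} γ_j`. -/
noncomputable def gammaWeight {d : ℕ} (γ : Fin d → ℝ) (α : Fin d → Bool) : ℝ :=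
  ∏ j, if α j then γ j else 1

/-- The weighted norm of `P_d^γ`:
`‖f‖ = max_{α ∈ {0,1}^d} γ_α⁻¹ ‖D^α f‖_{L_∞([0,1]^d)}`. -/
noncomputable def wnorm {d : ℕ} (γ : Fin d → ℝ) (c : (Fin d → Bool) → ℝ) : ℝ :=
  ⨆ α : Fin d → Bool, (gammaWeight γ α)⁻¹ * supCube (polyEval (derivCoef c α))

/-- An information map of adaptive linear form. -/
def IsAdaptiveLinear {F : Type*} [AddCommGroup F] [Module ℝ F] {n : ℕ}
    (N : F → (Fin n → ℝ)) : Prop :=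
  ∃ L : (j : Fin n) → (Fin (j : ℕ) → ℝ) → (F →ₗ[ℝ] ℝ),
    ∀ (f : F) (j : Fin n),
      N f j = L j (fun i : Fin (j : ℕ) => N f ⟨i, i.isLt.trans j.isLt⟩) f

/-- The `k`-th vertex of the simplex of Kuhn's triangulation with base point `c`, where the
coordinate `j` is incremented at time `τ j`. -/
def kuhnVertex {m : ℕ} (c : Fin m → ℕ) (τ : Equiv.Perm (Fin m)) (k : ℕ) : Fin m → ℕ :=
  fun j => c j + if (τ j : ℕ) < k then 1 else 0

lemma kuhnVertex_swap {n : ℕ} (c : Fin (n + 1) → ℕ) (τ : Equiv.Perm (Fin (n + 1))) (i : Fin n)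
    (k : ℕ) (hk : k ≠ i + 1) :
    kuhnVertex c (Equiv.swap i.castSucc i.succ * τ) k = kuhnVertex c τ k := by
  have hik : (i : ℕ) + 1 < k ↔ (i : ℕ) < k := by omega
  funext j
  rcases eq_or_ne (τ j) i.castSucc with h | h
  · have e : (Equiv.swap i.castSucc i.succ * τ) j = i.succ := by
      rw [Equiv.Perm.mul_apply, h, Equiv.swap_apply_left]
    simp [kuhnVertex, e, h, hik]
  rcases eq_or_ne (τ j) i.succ with h' | h'
  · have e : (Equiv.swap i.castSucc i.succ * τ) j = i.castSucc := by
      rw [Equiv.Perm.mul_apply, h', Equiv.swap_apply_right]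
    simp [kuhnVertex, e, h', hik]
  have e : (Equiv.swap i.castSucc i.succ * τ) j = τ j := by
    rw [Equiv.Perm.mul_apply, Equiv.swap_apply_of_ne_of_ne h h']
  simp [kuhnVertex, e]

lemma kuhnVertex_finRotate {n : ℕ} (c : Fin (n + 1) → ℕ) (τ : Equiv.Perm (Fin (n + 1)))
    (k : ℕ) (hk : k ≤ n) :
    kuhnVertex c (finRotate (n + 1) * τ) (k + 1) =
      kuhnVertex (c + Pi.single (τ.symm (Fin.last n)) 1) τ k := by
  funext j
  rcases eq_or_ne (τ j) (Fin.last n) with h | h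
  · have e : (finRotate (n + 1) * τ) j = 0 := by
      rw [Equiv.Perm.mul_apply, h, finRotate_last]
    simp [kuhnVertex, Pi.single_apply, Equiv.eq_symm_apply, e, h, hk]
  · have e : ((finRotate (n + 1) * τ) j : ℕ) = τ j + 1 := by
      rw [Equiv.Perm.mul_apply, coe_finRotate_of_ne_last h]
    have hj : j ≠ τ.symm (Fin.last n) := by rwa [Ne, Equiv.eq_symm_apply]
    simp only [kuhnVertex, Pi.add_apply, e, Pi.single_eq_of_ne hj, add_zero,
      add_lt_add_iff_right]

lemma sum_interior_facets_eq_zero {n : ℕ} (c : Fin (n + 1) → ℕ)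
    (G : (Fin (n + 1) → Fin (n + 1) → ℕ) → ℤ) (i : Fin n) :
    ∑ τ : Equiv.Perm (Fin (n + 1)), (Equiv.Perm.sign τ : ℤ) *
      G (fun l => kuhnVertex c τ (i.castSucc.succ.succAbove l)) = 0 := by
  set f : Equiv.Perm (Fin (n + 1)) → ℤ := fun τ => (Equiv.Perm.sign τ : ℤ) *
      G (fun l => kuhnVertex c τ (i.castSucc.succ.succAbove l)) with hf
  have h : ∀ τ, f (Equiv.swap i.castSucc i.succ * τ) = - f τ := by
    intro τ
    have hne : i.castSucc ≠ i.succ := (Fin.castSucc_lt_succ).ne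
    have hv : (fun l : Fin (n + 1) => kuhnVertex c (Equiv.swap i.castSucc i.succ * τ)
        (i.castSucc.succ.succAbove l)) =
        fun l => kuhnVertex c τ (i.castSucc.succ.succAbove l) := by
      funext l
      apply kuhnVertex_swap
      intro hl
      refine Fin.succAbove_ne i.castSucc.succ l (Fin.ext ?_)
      simpa using hl
    simp only [hf]
    rw [hv, Equiv.Perm.sign_mul, Equiv.Perm.sign_swap hne]
    simp
  have h2 := Equiv.sum_comp (Equiv.mulLeft (Equiv.swap i.castSucc i.succ)) f
  simp only [Equiv.coe_mulLeft, h, Finset.sum_neg_distrib] at h2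
  exact self_eq_neg.mp h2.symm

lemma sum_box_shift {m K : ℕ} (g : (Fin m → ℕ) → ℤ) (j : Fin m)
    (hg : ∀ c, c j = 0 ∨ c j = K → g c = 0) :
    ∑ c ∈ Fintype.piFinset (fun _ : Fin m => Finset.range K), g (c + Pi.single j 1) =
      ∑ c ∈ Fintype.piFinset (fun _ : Fin m => Finset.range K), g c := by
  refine Finset.sum_bij_ne_zero (fun c _ _ => c + Pi.single j 1) ?_ ?_ ?_ ?_
  · intro c hc h
    simp only [Fintype.mem_piFinset, Finset.mem_range] at hc ⊢
    intro a
    rcases eq_or_ne a j with rfl | ha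
    · have h1 : (c + Pi.single a 1 : Fin m → ℕ) a ≠ K := fun h' => h (hg _ (Or.inr h'))
      have := hc a
      simp at h1 ⊢
      omega
    · simpa [ha] using hc a
  · intro c _ _ c' _ _ h
    exact add_right_cancel h
  · intro c hc h
    have h0 : c j ≠ 0 := fun h' => h (hg _ (Or.inl h'))
    have hs : c - Pi.single j 1 + Pi.single j 1 = c := by
      funext a
      rcases eq_or_ne a j with rfl | ha
      · simp; omega
      · simp [ha]
    refine ⟨c - Pi.single j 1, ?_, by rwa [hs], hs⟩
    simp only [Fintype.mem_piFinset, Finset.mem_range] at hc ⊢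
    intro a
    have := hc a
    simp only [Pi.sub_apply]
    omega
  · intros; rfl

/-- A function of facets that vanishes on the facets in the boundary of the cube has zero sum
over the boundaries of all simplices of Kuhn's triangulation. -/
lemma sum_facets_eq_zero {n K : ℕ} (G : (Fin (n + 1) → Fin (n + 1) → ℕ) → ℤ)
    (hG : ∀ y j, (∀ l, y l j = 0) ∨ (∀ l, y l j = K) → G y = 0) :
    ∑ c ∈ Fintype.piFinset (fun _ : Fin (n + 1) => Finset.range K),
      ∑ τ : Equiv.Perm (Fin (n + 1)), (Equiv.Perm.sign τ : ℤ) *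
        ∑ k : Fin (n + 2), (-1) ^ (k : ℕ) *
          G (fun l => kuhnVertex c τ (k.succAbove l)) = 0 := by
  have key : ∑ c ∈ Fintype.piFinset (fun _ : Fin (n + 1) => Finset.range K),
      ∑ τ : Equiv.Perm (Fin (n + 1)), (Equiv.Perm.sign τ : ℤ) *
        G (fun l => kuhnVertex c τ ((0 : Fin (n + 2)).succAbove l)) =
      (-1) ^ n * ∑ c ∈ Fintype.piFinset (fun _ : Fin (n + 1) => Finset.range K),
      ∑ τ : Equiv.Perm (Fin (n + 1)), (Equiv.Perm.sign τ : ℤ) *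
        G (fun l => kuhnVertex c τ ((Fin.last (n + 1)).succAbove l)) := by
    rw [Finset.sum_comm, ← Equiv.sum_comp (Equiv.mulLeft (finRotate (n + 1))), Finset.sum_comm,
      Finset.mul_sum, Finset.sum_comm]
    simp_rw [Finset.mul_sum]
    rw [Finset.sum_comm (s := Fintype.piFinset (fun _ : Fin (n + 1) => Finset.range K))]
    refine Finset.sum_congr rfl fun τ _ => ?_
    simp only [Equiv.coe_mulLeft, Equiv.Perm.sign_mul, sign_finRotate, ← Finset.mul_sum]
    push_cast
    rw [mul_assoc]
    congr 2
    have := sum_box_shift (K := K)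
      (fun c => G (fun l : Fin (n + 1) => kuhnVertex c τ l)) (τ.symm (Fin.last n)) ?_
    · simp only [Fin.succAbove_last, Fin.val_castSucc]
      rw [← this]
      refine Finset.sum_congr rfl fun c _ => ?_
      congr 1
      funext l
      simp only [Fin.zero_succAbove, Fin.val_succ]
      exact kuhnVertex_finRotate c τ l (by omega)
    · intro c hc
      have hv : ∀ l : Fin (n + 1), kuhnVertex c τ l (τ.symm (Fin.last n)) =
          c (τ.symm (Fin.last n)) := by
        intro l
        simp only [kuhnVertex, Equiv.apply_symm_apply, Fin.val_last]
        rw [if_neg (by omega), add_zero]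
      refine hG _ (τ.symm (Fin.last n)) ?_
      rcases hc with hc | hc
      · exact Or.inl fun l => (hv l).trans hc
      · exact Or.inr fun l => (hv l).trans hc
  have mid : ∀ i : Fin n, ∑ c ∈ Fintype.piFinset (fun _ : Fin (n + 1) => Finset.range K),
      ∑ τ : Equiv.Perm (Fin (n + 1)), (Equiv.Perm.sign τ : ℤ) *
        G (fun l => kuhnVertex c τ (i.castSucc.succ.succAbove l)) = 0 := fun i =>
    Finset.sum_eq_zero fun c _ => sum_interior_facets_eq_zero c G i
  have hsplit : ∀ (c : Fin (n + 1) → ℕ) (τ : Equiv.Perm (Fin (n + 1))),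
      (Equiv.Perm.sign τ : ℤ) * ∑ k : Fin (n + 2), (-1) ^ (k : ℕ) *
          G (fun l => kuhnVertex c τ (k.succAbove l)) =
      (Equiv.Perm.sign τ : ℤ) * G (fun l => kuhnVertex c τ ((0 : Fin (n + 2)).succAbove l)) +
      ∑ i : Fin n, (-1) ^ ((i : ℕ) + 1) * ((Equiv.Perm.sign τ : ℤ) *
        G (fun l => kuhnVertex c τ (i.castSucc.succ.succAbove l))) +
      (-1) ^ (n + 1) * ((Equiv.Perm.sign τ : ℤ) *
        G (fun l => kuhnVertex c τ ((Fin.last (n + 1)).succAbove l))) := by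
    intro c τ
    rw [Fin.sum_univ_succ, Fin.sum_univ_castSucc]
    simp only [Fin.val_zero, Fin.val_succ, Fin.val_castSucc, Fin.val_last, Fin.succ_last, mul_add,
      Finset.mul_sum, pow_zero, one_mul, add_assoc]
    congr 2
    · exact Finset.sum_congr rfl fun i _ => by ring
    · exact mul_left_comm _ _ _
  simp_rw [hsplit, Finset.sum_add_distrib]
  rw [key]
  have hm : ∑ c ∈ Fintype.piFinset (fun _ : Fin (n + 1) => Finset.range K),
      ∑ τ : Equiv.Perm (Fin (n + 1)), ∑ i : Fin n, (-1) ^ ((i : ℕ) + 1) *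
        ((Equiv.Perm.sign τ : ℤ) *
        G (fun l => kuhnVertex c τ (i.castSucc.succ.succAbove l))) = 0 := by
    simp_rw [Finset.sum_comm (s := (Finset.univ : Finset (Equiv.Perm (Fin (n + 1)))))
      (t := (Finset.univ : Finset (Fin n)))]
    rw [Finset.sum_comm]
    refine Finset.sum_eq_zero fun i _ => ?_
    simp_rw [← Finset.mul_sum]
    rw [mid i, mul_zero]
  rw [hm]
  simp_rw [← Finset.mul_sum]
  ring

lemma Matrix.det_updateCol_eq_neg_sum {N : ℕ} (A : Matrix (Fin (N + 1)) (Fin (N + 1)) ℤ)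
    {i j : Fin (N + 1)} (hij : i ≠ j) (hA : ∀ k, A k i = 1) (u : Fin (N + 1) → ℤ) :
    (A.updateCol j u).det = -∑ k : Fin (N + 1), (-1) ^ (k + j : ℕ) *
      ((∑ l, u (k.succAbove l)) * (A.submatrix k.succAbove j.succAbove).det) := by
  have expand : ∀ w : Fin (N + 1) → ℤ, (A.updateCol j w).det = ∑ k : Fin (N + 1),
      (-1) ^ (k + j : ℕ) * w k * (A.submatrix k.succAbove j.succAbove).det := by
    intro w
    rw [Matrix.det_succ_column _ j]
    simp [Matrix.submatrix_updateCol_succAbove]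
  have hone : (A.updateCol j 1).det = 0 := by
    refine Matrix.det_zero_of_column_eq hij fun k => ?_
    simp [Matrix.updateCol_ne hij, hA]
  rw [expand] at hone
  have h := congrArg (fun z => (∑ k, u k) * z) hone
  simp only [Finset.mul_sum, mul_zero] at h
  rw [expand, eq_neg_iff_add_eq_zero, ← Finset.sum_add_distrib, ← h]
  refine Finset.sum_congr rfl fun k _ => ?_
  rw [Fin.sum_univ_succAbove u k, Pi.one_apply]
  ring

/-- The matrix of vertices, in homogeneous coordinates, of the image under `s` of a simplex of
Kuhn's triangulation. -/
def kuhnMatrix {m : ℕ} (s : Fin m → (Fin m → ℕ) → ℤ) (c : Fin m → ℕ)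
    (τ : Equiv.Perm (Fin m)) : Matrix (Fin (m + 1)) (Fin (m + 1)) ℤ :=
  Matrix.of fun k => Fin.cons 1 fun j => s j (kuhnVertex c τ k)

/-- The sum of the signed volumes, up to a factorial, of the images under `s` of the simplices
of Kuhn's triangulation of the grid `{0, …, K}^m`. -/
def kuhnDegree {m : ℕ} (K : ℕ) (s : Fin m → (Fin m → ℕ) → ℤ) : ℤ :=
  ∑ c ∈ Fintype.piFinset (fun _ : Fin m => Finset.range K),
    ∑ τ : Equiv.Perm (Fin m), (Equiv.Perm.sign τ : ℤ) * (kuhnMatrix s c τ).det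

/-- Each `s j` vanishes on the face `x j = 0` and is one on the face `x j = K`. -/
def SeparatesFaces {m : ℕ} (K : ℕ) (s : Fin m → (Fin m → ℕ) → ℤ) : Prop :=
  ∀ j x, (x j = 0 → s j x = 0) ∧ (x j = K → s j x = 1)

lemma kuhnDegree_update {n K : ℕ} {s : Fin (n + 1) → (Fin (n + 1) → ℕ) → ℤ}
    (hs : SeparatesFaces K s) (i : Fin (n + 1)) {t : (Fin (n + 1) → ℕ) → ℤ}
    (ht : ∀ x, (x i = 0 → t x = 0) ∧ (x i = K → t x = 1)) :
    kuhnDegree K (Function.update s i t) = kuhnDegree K s := by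
  set G : (Fin (n + 1) → Fin (n + 1) → ℕ) → ℤ := fun y =>
    (∑ l, (s i (y l) - t (y l))) * (Matrix.of fun l j : Fin (n + 1) =>
      (Fin.cons 1 (fun j => s j (y l)) : Fin (n + 2) → ℤ) (i.succ.succAbove j)).det with hG
  have hG0 : ∀ y j, (∀ l, y l j = 0) ∨ (∀ l, y l j = K) → G y = 0 := by
    intro y j hy
    rcases eq_or_ne j i with rfl | hji
    · have : ∀ l, s j (y l) - t (y l) = 0 := by
        intro l
        rcases hy with hy | hy
        · rw [(hs j (y l)).1 (hy l), (ht (y l)).1 (hy l), sub_self]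
        · rw [(hs j (y l)).2 (hy l), (ht (y l)).2 (hy l), sub_self]
      simp only [hG]
      rw [Finset.sum_eq_zero fun l _ => this l, zero_mul]
    · obtain ⟨a, ha⟩ : ∃ a, ∀ l, s j (y l) = a := by
        rcases hy with hy | hy
        · exact ⟨0, fun l => (hs j (y l)).1 (hy l)⟩
        · exact ⟨1, fun l => (hs j (y l)).2 (hy l)⟩
      obtain ⟨p, hp⟩ := Fin.exists_succAbove_eq (x := 0) (y := i.succ)
        (Fin.succ_ne_zero i).symm
      obtain ⟨q, hq⟩ := Fin.exists_succAbove_eq (x := j.succ) (y := i.succ)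
        (fun h => hji (Fin.succ_injective _ h))
      have hpq : q ≠ p := by
        rintro rfl
        exact Fin.succ_ne_zero j (hq.symm.trans hp)
      simp only [hG]
      refine mul_eq_zero_of_right _ ?_
      set A : Matrix (Fin (n + 1)) (Fin (n + 1)) ℤ := Matrix.of fun l j : Fin (n + 1) =>
        (Fin.cons 1 (fun j => s j (y l)) : Fin (n + 2) → ℤ) (i.succ.succAbove j) with hA
      have h1 : ∀ l, A l p = 1 := fun l => by simp [hA, hp]
      have h2 : ∀ l, A l q = a := fun l => by simp [hA, hq, ha]
      have h3 : A.updateCol q (a • (1 : Fin (n + 1) → ℤ)) = A := by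
        ext l r
        rcases eq_or_ne r q with rfl | hr
        · simp [h2]
        · simp [hr]
      rw [← h3, Matrix.det_updateCol_smul]
      refine mul_eq_zero_of_right _ (Matrix.det_zero_of_column_eq hpq fun l => ?_)
      simp [Matrix.updateCol_ne hpq.symm, h1]
  have hdiff : ∀ c τ, (kuhnMatrix s c τ).det - (kuhnMatrix (Function.update s i t) c τ).det =
      (-1) ^ (i : ℕ) * ∑ k : Fin (n + 2), (-1) ^ (k : ℕ) *
        G (fun l => kuhnVertex c τ (k.succAbove l)) := by
    intro c τ
    have h1 : kuhnMatrix s c τ = (kuhnMatrix s c τ).updateCol i.succ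
        ((fun k : Fin (n + 2) => s i (kuhnVertex c τ k) - t (kuhnVertex c τ k)) +
          fun k : Fin (n + 2) => t (kuhnVertex c τ k)) := by
      ext k r
      rcases eq_or_ne r i.succ with rfl | hr
      · simp [kuhnMatrix]
      · simp [hr]
    have h2 : kuhnMatrix (Function.update s i t) c τ = (kuhnMatrix s c τ).updateCol i.succ
          (fun k : Fin (n + 2) => t (kuhnVertex c τ k)) := by
      ext k r
      rcases eq_or_ne r i.succ with rfl | hr
      · simp [kuhnMatrix]
      · refine Fin.cases ?_ (fun r => ?_) r hr
        · intro h0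
          simp [kuhnMatrix, h0]
        · intro hr
          have hri : r ≠ i := fun h => hr (h ▸ rfl)
          simp [kuhnMatrix, hri]
    rw [h2]
    nth_rewrite 1 [h1]
    rw [Matrix.det_updateCol_add, add_sub_cancel_right,
      Matrix.det_updateCol_eq_neg_sum _ (Fin.succ_ne_zero i).symm (fun k => by simp [kuhnMatrix]),
      ← Finset.sum_neg_distrib, Finset.mul_sum]
    refine Finset.sum_congr rfl fun k _ => ?_
    have hm : ((kuhnMatrix s c τ).submatrix k.succAbove i.succ.succAbove) =
      (Matrix.of fun l j : Fin (n + 1) =>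
      (Fin.cons 1 (fun j => s j (kuhnVertex c τ (k.succAbove l))) : Fin (n + 2) → ℤ)
        (i.succ.succAbove j)) := rfl
    rw [hm, Fin.val_succ]
    simp only [hG]
    ring
  have := sum_facets_eq_zero (K := K) G hG0
  rw [eq_comm, ← sub_eq_zero, kuhnDegree, kuhnDegree, ← Finset.sum_sub_distrib]
  simp_rw [← Finset.sum_sub_distrib, ← mul_sub, hdiff, mul_left_comm _ ((-1 : ℤ) ^ (i : ℕ)),
    ← Finset.mul_sum]
  rw [this, mul_zero]

lemma SeparatesFaces.kuhnDegree_eq {n K : ℕ} {s t : Fin (n + 1) → (Fin (n + 1) → ℕ) → ℤ}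
    (hs : SeparatesFaces K s) (ht : SeparatesFaces K t) : kuhnDegree K s = kuhnDegree K t := by
  suffices h : ∀ S : Finset (Fin (n + 1)),
      kuhnDegree K (fun j => if j ∈ S then s j else t j) = kuhnDegree K t by
    simpa using h Finset.univ
  intro S
  induction S using Finset.induction_on with
  | empty => simp
  | insert i S hi ih =>
    rw [← ih, ← kuhnDegree_update (s := fun j => if j ∈ S then s j else t j) (i := i) (t := s i)
      _ (hs i)]
    · congr 1
      funext j
      rcases eq_or_ne j i with rfl | hj
      · simp
      · simp [hj]
    · intro j x
      by_cases hj : j ∈ S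
      · simpa [hj] using hs j x
      · simpa [hj] using ht j x

lemma det_kuhnMatrix_eq_zero {m : ℕ} {s : Fin m → (Fin m → ℕ) → ℤ} {c : Fin m → ℕ}
    {τ : Equiv.Perm (Fin m)} (j : Fin m) (a : ℤ)
    (h : ∀ k : Fin (m + 1), s j (kuhnVertex c τ k) = a) : (kuhnMatrix s c τ).det = 0 := by
  have h3 : (kuhnMatrix s c τ).updateCol j.succ (a • (1 : Fin (m + 1) → ℤ)) =
      kuhnMatrix s c τ := by
    ext l r
    rcases eq_or_ne r j.succ with rfl | hr
    · simp [kuhnMatrix, h]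
    · simp [hr]
  rw [← h3, Matrix.det_updateCol_smul]
  refine mul_eq_zero_of_right _
    (Matrix.det_zero_of_column_eq (Fin.succ_ne_zero j) fun l => ?_)
  rw [Matrix.updateCol_self, Matrix.updateCol_ne (Fin.succ_ne_zero j).symm]
  simp [kuhnMatrix]

lemma kuhnDegree_indicator {n K : ℕ} (hK : 0 < K) :
    kuhnDegree K (fun (j : Fin (n + 1)) x => if x j = 0 then 0 else 1) =
      ((n + 1).factorial : ℤ) := by
  rw [kuhnDegree, Finset.sum_eq_single 0]
  · have : ∀ τ : Equiv.Perm (Fin (n + 1)), (Equiv.Perm.sign τ : ℤ) *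
        (kuhnMatrix (fun (j : Fin (n + 1)) x => if x j = 0 then 0 else 1) 0 τ).det = 1 := by
      intro τ
      set B : Matrix (Fin (n + 2)) (Fin (n + 2)) ℤ := Matrix.of fun k =>
        Fin.cons 1 fun j : Fin (n + 1) => if (j : ℕ) < k then 1 else 0 with hB
      have hBdet : B.det = 1 := by
        rw [Matrix.det_of_isLowerTriangular, Finset.prod_eq_one]
        · intro k _
          refine Fin.cases ?_ (fun k => ?_) k <;> simp [hB]
        · intro k r hkr
          have hkr : k < r := hkr
          revert hkr
          refine Fin.cases ?_ (fun r => ?_) r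
          · simp
          · intro hkr
            simp [hB]
            rw [Fin.lt_def, Fin.val_succ] at hkr
            omega
      have hM : kuhnMatrix (fun (j : Fin (n + 1)) x => if x j = 0 then 0 else 1) 0 τ =
          B.submatrix id (Equiv.Perm.decomposeFin.symm (0, τ)) := by
        ext k r
        refine Fin.cases ?_ (fun r => ?_) r
        · simp [kuhnMatrix, hB]
        · by_cases h : (τ r : ℕ) < k <;> simp [kuhnMatrix, hB, kuhnVertex, h]
      rw [hM, Matrix.det_permute', hBdet, mul_one]
      rw [Equiv.Perm.decomposeFin.symm_sign]
      rcases Int.units_eq_one_or (Equiv.Perm.sign τ) with h | h <;> simp [h]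
    simp only [this]
    simp [Fintype.card_perm]
  · intro c _ hc
    obtain ⟨j, hj⟩ := Function.ne_iff.mp hc
    refine Finset.sum_eq_zero fun τ _ => mul_eq_zero_of_right _
      (det_kuhnMatrix_eq_zero j 1 fun k => ?_)
    have : c j ≠ 0 := hj
    simp [kuhnVertex, this]
  · intro h
    simp [ne_of_gt hK] at h

/-- A discrete form of the Poincaré–Miranda theorem. -/
lemma SeparatesFaces.exists_simplex {n K : ℕ} (hK : 0 < K)
    {s : Fin (n + 1) → (Fin (n + 1) → ℕ) → ℤ} (hs : SeparatesFaces K s) :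
    ∃ (c : Fin (n + 1) → ℕ) (τ : Equiv.Perm (Fin (n + 1))), (∀ j, c j < K) ∧
      ∀ j a, ∃ k : Fin (n + 2), s j (kuhnVertex c τ k) ≠ a := by
  have hdeg : kuhnDegree K s ≠ 0 := by
    rw [hs.kuhnDegree_eq (t := fun j x => if x j = 0 then 0 else 1), kuhnDegree_indicator hK]
    · exact_mod_cast (Nat.factorial_pos _).ne'
    · intro j x
      refine ⟨fun h => by simp [h], fun h => ?_⟩
      simp [h, hK.ne']
  obtain ⟨c, hc, h1⟩ := Finset.exists_ne_zero_of_sum_ne_zero hdeg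
  obtain ⟨τ, -, h2⟩ := Finset.exists_ne_zero_of_sum_ne_zero h1
  refine ⟨c, τ, by simpa [Fintype.mem_piFinset] using hc, fun j a => ?_⟩
  by_contra! h
  exact h2 (mul_eq_zero_of_right _ (det_kuhnMatrix_eq_zero j a h))

/-- The **Poincaré–Miranda theorem**. -/
theorem poincare_miranda {n : ℕ} {h : (Fin (n + 1) → ℝ) → Fin (n + 1) → ℝ} (hc : Continuous h)
    (h0 : ∀ x ∈ Set.Icc (0 : Fin (n + 1) → ℝ) 1, ∀ j, x j = 0 → h x j < 0)
    (h1 : ∀ x ∈ Set.Icc (0 : Fin (n + 1) → ℝ) 1, ∀ j, x j = 1 → 0 < h x j) :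
    ∃ x ∈ Set.Icc (0 : Fin (n + 1) → ℝ) 1, h x = 0 := by
  by_contra! hne
  obtain ⟨ε, hε, hle⟩ := (isCompact_Icc (a := (0 : Fin (n + 1) → ℝ)) (b := 1)).exists_forall_le'
    (f := fun x => ‖h x‖) hc.norm.continuousOn (a := 0) fun x hx => norm_pos_iff.mpr (hne x hx)
  have huc := (isCompact_Icc (a := (0 : Fin (n + 1) → ℝ)) (b := 1)).uniformContinuousOn_of_continuous
    hc.continuousOn
  obtain ⟨δ, hδ, hd⟩ := Metric.uniformContinuousOn_iff.mp huc ε hε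
  obtain ⟨K, hK⟩ := exists_nat_one_div_lt hδ
  set p : (Fin (n + 1) → ℕ) → Fin (n + 1) → ℝ := fun x l => (min (x l) (K + 1) : ℕ) / (K + 1 : ℝ)
    with hp
  have hKpos : (0 : ℝ) < K + 1 := by positivity
  have hpm : ∀ x, p x ∈ Set.Icc (0 : Fin (n + 1) → ℝ) 1 := by
    intro x
    refine ⟨fun l => by simp only [hp, Pi.zero_apply]; positivity, fun l => ?_⟩
    simp only [hp, Pi.one_apply]
    rw [div_le_one hKpos]
    exact_mod_cast min_le_right _ _
  have hs : SeparatesFaces (K + 1) (fun j x => if 0 < h (p x) j then (1 : ℤ) else 0) := by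
    intro j x
    constructor
    · intro hx
      refine if_neg (not_lt.mpr (h0 _ (hpm x) j ?_).le)
      simp only [hp, hx, Nat.zero_min, Nat.cast_zero, zero_div]
    · intro hx
      refine if_pos (h1 _ (hpm x) j ?_)
      simp only [hp, hx, min_self]
      push_cast
      exact div_self hKpos.ne'
  obtain ⟨c, τ, hcK, hk⟩ := hs.exists_simplex K.succ_pos
  have hdist : ∀ k k' : ℕ, dist (p (kuhnVertex c τ k)) (p (kuhnVertex c τ k')) < δ := by
    intro k k'
    refine lt_of_le_of_lt ((dist_pi_le_iff (by positivity)).mpr fun l => ?_) hK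
    have hmin : ∀ k, min (kuhnVertex c τ k l) (K + 1) = kuhnVertex c τ k l := by
      intro k
      have := hcK l
      rw [min_eq_left]
      simp only [kuhnVertex]
      split_ifs <;> omega
    simp only [hp, hmin, Real.dist_eq, ← sub_div, abs_div, abs_of_pos hKpos]
    gcongr
    rw [abs_le]
    simp only [kuhnVertex]
    split_ifs <;> push_cast <;> constructor <;> linarith
  refine (hle _ (hpm (kuhnVertex c τ 0))).not_gt ((pi_norm_lt_iff hε).mpr fun j => ?_)
  have hclose : ∀ k : ℕ, |h (p (kuhnVertex c τ 0)) j - h (p (kuhnVertex c τ k)) j| < ε := fun k =>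
    lt_of_le_of_lt (dist_le_pi_dist (h (p (kuhnVertex c τ 0))) (h (p (kuhnVertex c τ k))) j)
      (hd _ (hpm _) _ (hpm _) (hdist 0 k))
  obtain ⟨k, hk0⟩ := hk j 0
  obtain ⟨k', hk1⟩ := hk j 1
  have hpos : 0 < h (p (kuhnVertex c τ k)) j := by
    by_contra hcon
    exact hk0 (if_neg hcon)
  have hneg : h (p (kuhnVertex c τ k')) j ≤ 0 := by
    by_contra! hcon
    exact hk1 (if_pos hcon)
  have a := abs_lt.mp (hclose k)
  have b := abs_lt.mp (hclose k')
  rw [Real.norm_eq_abs, abs_lt]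
  constructor <;> linarith [a.1, b.2]

/-- A continuous map from the cube to a space of smaller dimension identifies two points of
opposite faces. -/
theorem exists_opposite_faces_map_eq {m n : ℕ} (hnm : n < m) {M : (Fin m → ℝ) → Fin n → ℝ}
    (hM : Continuous M) :
    ∃ x ∈ Set.Icc (0 : Fin m → ℝ) 1, ∃ y ∈ Set.Icc (0 : Fin m → ℝ) 1,
      ∃ i, x i = 1 ∧ y i = 0 ∧ M x = M y := by
  obtain ⟨m, rfl⟩ := Nat.exists_eq_succ_of_ne_zero (Nat.ne_zero_of_lt hnm)
  by_contra! hne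
  let face : ℝ → Fin (m + 1) → Set (Fin (m + 1) → ℝ) := fun a i =>
    Set.Icc (0 : Fin (m + 1) → ℝ) 1 ∩ {x | x i = a}
  have hface : ∀ a i, IsCompact (face a i) := fun a i =>
    isCompact_Icc.inter_right (isClosed_eq (continuous_apply i) continuous_const)
  have hn0 : ∀ i, (M '' face 0 i).Nonempty := fun i => ⟨_, 0, ⟨by simp, rfl⟩, rfl⟩
  have hn1 : ∀ i, (M '' face 1 i).Nonempty := fun i => ⟨_, 1, ⟨by simp, rfl⟩, rfl⟩
  let g : (Fin n → ℝ) → Fin (m + 1) → ℝ := fun y i =>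
    Metric.infDist y (M '' face 0 i) - Metric.infDist y (M '' face 1 i)
  have hg : LipschitzWith (1 + 1) g := by
    rw [lipschitzWith_iff_dist_le_mul]
    intro x y
    refine (dist_pi_le_iff (by positivity)).mpr fun i => ?_
    exact ((Metric.lipschitz_infDist_pt (M '' face 0 i)).sub
      (Metric.lipschitz_infDist_pt (M '' face 1 i))).dist_le_mul x y
  have hgM : ∀ i, Continuous fun x => g (M x) i := fun i =>
    (continuous_apply i).comp (hg.continuous.comp hM)
  have hneg : ∀ i, ∀ x ∈ face 0 i, 0 < - g (M x) i := by
    intro i x hx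
    have h1 : 0 < Metric.infDist (M x) (M '' face 1 i) := by
      rw [← ((hface 1 i).image hM).isClosed.notMem_iff_infDist_pos (hn1 i)]
      rintro ⟨y, hy, hxy⟩
      exact hne y hy.1 x hx.1 i hy.2 hx.2 hxy
    simp only [g, Metric.infDist_zero_of_mem (Set.mem_image_of_mem M hx)]
    linarith
  have hpos : ∀ i, ∀ x ∈ face 1 i, 0 < g (M x) i := by
    intro i x hx
    have h1 : 0 < Metric.infDist (M x) (M '' face 0 i) := by
      rw [← ((hface 0 i).image hM).isClosed.notMem_iff_infDist_pos (hn0 i)]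
      rintro ⟨y, hy, hxy⟩
      exact hne x hx.1 y hy.1 i hx.2 hy.2 hxy.symm
    simp only [g, Metric.infDist_zero_of_mem (Set.mem_image_of_mem M hx)]
    linarith
  choose η hη hη' using fun i => (hface 0 i).exists_forall_le' (hgM i).neg.continuousOn (hneg i)
  choose θ hθ hθ' using fun i => (hface 1 i).exists_forall_le' (hgM i).continuousOn (hpos i)
  have hnhds : Set.range g ∈ nhds (0 : Fin (m + 1) → ℝ) := by
    have hev : ∀ᶠ p in nhds (0 : Fin (m + 1) → ℝ), ∀ i, - η i < p i ∧ p i < θ i :=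
      Filter.eventually_all.mpr fun i =>
        (continuous_apply i).continuousAt.preimage_mem_nhds (t := Set.Ioo (-η i) (θ i))
          (Ioo_mem_nhds (neg_lt_zero.mpr (hη i)) (hθ i))
    filter_upwards [hev] with p hp
    obtain ⟨x, -, hx⟩ := poincare_miranda (h := fun x => g (M x) - p)
      ((hg.continuous.comp hM).sub continuous_const)
      (fun x hx j hj => by
        have := hη' j x ⟨hx, hj⟩
        have := (hp j).1
        simp only [Pi.sub_apply, Pi.neg_apply] at *
        linarith)
      (fun x hx j hj => by
        have := hθ' j x ⟨hx, hj⟩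
        have := (hp j).2
        simp only [Pi.sub_apply] at *
        linarith)
    exact ⟨M x, sub_eq_zero.mp hx⟩
  have hdim := hg.dimH_range_le
  rw [Real.dimH_of_mem_nhds hnhds, Real.dimH_univ_pi_fin, Module.finrank_fin_fun] at hdim
  have : m + 1 ≤ n := by exact_mod_cast hdim
  omega

section Multilinear

variable {d : ℕ}

lemma sum_bool_fun_split (A : (Fin d → Bool) → ℝ) (j : Fin d) :
    ∑ i, A i = ∑ i : Fin d → Bool,
      if i j then 0 else A i + A (Function.update i j true) := by
  have hinv : Function.Involutive fun i : Fin d → Bool => Function.update i j (!i j) := by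
    intro i
    simp
  have h := Equiv.sum_comp hinv.toPerm (fun i : Fin d → Bool => if i j then A i else 0)
  simp only [Function.Involutive.coe_toPerm, Function.update_self] at h
  have h1 : ∑ i, A i = ∑ i : Fin d → Bool, (if i j then 0 else A i) +
      ∑ i : Fin d → Bool, (if i j then A i else 0) := by
    rw [← Finset.sum_add_distrib]
    refine Finset.sum_congr rfl fun i _ => ?_
    split_ifs <;> simp
  rw [h1, ← h, ← Finset.sum_add_distrib]
  refine Finset.sum_congr rfl fun i _ => ?_
  cases hi : i j <;> simp

lemma monomial_update_coord (i : Fin d → Bool) (x : Fin d → ℝ) (j : Fin d) (hi : i j = false)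
    (t : ℝ) : (∏ l, if i l then Function.update x j t l else 1) = ∏ l, if i l then x l else 1 := by
  refine Finset.prod_congr rfl fun l _ => ?_
  rcases eq_or_ne l j with rfl | hl
  · simp [hi]
  · simp [hl]

lemma monomial_update_index (i : Fin d → Bool) (x : Fin d → ℝ) (j : Fin d) (hi : i j = false) :
    (∏ l, if Function.update i j true l then x l else 1) =
      x j * ∏ l, if i l then x l else 1 := by
  rw [← Finset.mul_prod_erase _ _ (Finset.mem_univ j),
    ← Finset.mul_prod_erase (a := j) _ (fun l => if i l then x l else 1) (Finset.mem_univ j)]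
  simp only [Function.update_self, hi, if_true, Bool.false_eq_true, if_false, one_mul]
  congr 1
  refine Finset.prod_congr rfl fun l hl => ?_
  rw [Function.update_of_ne (Finset.ne_of_mem_erase hl)]

lemma polyEval_update_zero (c : (Fin d → Bool) → ℝ) (x : Fin d → ℝ) (j : Fin d) :
    polyEval c (Function.update x j 0) = ∑ i : Fin d → Bool,
      if i j then 0 else c i * ∏ l, if i l then x l else 1 := by
  refine Finset.sum_congr rfl fun i _ => ?_
  cases hi : i j
  · simp [monomial_update_coord i x j hi]
  · rw [if_pos rfl, Finset.prod_eq_zero (Finset.mem_univ j), mul_zero]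
    simp [hi]

lemma polyEval_derivCoef_of_false (c : (Fin d → Bool) → ℝ) (α : Fin d → Bool) (x : Fin d → ℝ)
    (j : Fin d) (hα : α j = false) :
    polyEval (derivCoef c α) x = polyEval (derivCoef c α) (Function.update x j 0) +
      x j * polyEval (derivCoef c (Function.update α j true)) (Function.update x j 0) := by
  rw [polyEval_update_zero, polyEval_update_zero, polyEval, sum_bool_fun_split _ j,
    Finset.mul_sum, ← Finset.sum_add_distrib]
  refine Finset.sum_congr rfl fun i _ => ?_
  cases hi : i j
  · have hd : derivCoef c (Function.update α j true) i =
        derivCoef c α (Function.update i j true) := by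
      have hiff : (∀ l, Function.update α j true l = true → i l = false) ↔
          ∀ l, α l = true → Function.update i j true l = false := by
        refine forall_congr' fun l => ?_
        rcases eq_or_ne l j with rfl | hl
        · simp [hi, hα]
        · simp [hl]
      have harg : (fun l => i l || Function.update α j true l) =
          fun l => Function.update i j true l || α l := by
        funext l
        rcases eq_or_ne l j with rfl | hl
        · simp
        · simp [hl]
      simp only [derivCoef, hiff, harg]
    rw [hd, monomial_update_index i x j hi]
    simp only [Bool.false_eq_true, if_false]
    ring
  · simp

lemma polyEval_derivCoef_of_true (c : (Fin d → Bool) → ℝ) (α : Fin d → Bool) (x : Fin d → ℝ)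
    (j : Fin d) (hα : α j = true) :
    polyEval (derivCoef c α) (Function.update x j 0) = polyEval (derivCoef c α) x := by
  rw [polyEval_update_zero, polyEval]
  refine Finset.sum_congr rfl fun i _ => ?_
  cases hi : i j
  · simp
  · have : derivCoef c α i = 0 := if_neg fun h => by simpa [hi] using h j hα
    simp [this]

lemma polyEval_derivCoef_zero (c : (Fin d → Bool) → ℝ) (α : Fin d → Bool) :
    polyEval (derivCoef c α) 0 = c α := by
  rw [polyEval, Finset.sum_eq_single fun _ => false]
  · simp [derivCoef]
  · intro i _ hi
    obtain ⟨j, hj⟩ := Function.ne_iff.mp hi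
    rw [Finset.prod_eq_zero (Finset.mem_univ j), mul_zero]
    simpa using hj
  · simp

lemma derivCoef_false (c : (Fin d → Bool) → ℝ) : derivCoef c (fun _ => false) = c := by
  funext m
  simp [derivCoef]

/-- A family `F` satisfying the first-order Taylor formulas of the mixed derivatives of a
multilinear polynomial is the family of derivatives of the polynomial with coefficients
`F i 0`. -/
lemma eq_polyEval_derivCoef (F : (Fin d → Bool) → (Fin d → ℝ) → ℝ)
    (h0 : ∀ α x j, α j = false → F α x = F α (Function.update x j 0) +
      x j * F (Function.update α j true) (Function.update x j 0))
    (h1 : ∀ α x j, α j = true → F α (Function.update x j 0) = F α x)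
    (α : Fin d → Bool) (x : Fin d → ℝ) :
    F α x = polyEval (derivCoef (fun i => F i 0) α) x := by
  suffices h : ∀ (S : Finset (Fin d)) (α : Fin d → Bool) (x : Fin d → ℝ),
      (∀ j, j ∉ S → x j = 0) → F α x = polyEval (derivCoef (fun i => F i 0) α) x from
    h Finset.univ α x (by simp)
  intro S
  induction S using Finset.induction_on with
  | empty =>
    intro α x hx
    have : x = 0 := funext fun j => hx j (by simp)
    rw [this, polyEval_derivCoef_zero]
  | insert j S _ ih =>
    intro α x hx
    have hx_zero : ∀ l, l ∉ S → Function.update x j 0 l = 0 := by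
      intro l hl
      rcases eq_or_ne l j with rfl | hlj
      · simp
      · simpa [hlj] using hx l (by simp [hlj, hl])
    cases hα : α j
    · rw [h0 α x j hα, polyEval_derivCoef_of_false _ α x j hα, ih _ _ hx_zero, ih _ _ hx_zero]
    · rw [← h1 α x j hα, ← polyEval_derivCoef_of_true _ α x j hα, ih _ _ hx_zero]

/-- The mixed derivative `D^α` of the affine form `p + ∑_{j ∈ B} q_j x_j` with respect to those
variables that belong to `B`. -/
noncomputable def affineDeriv (B : Finset (Fin d)) (p : ℝ) (q : Fin d → ℝ) (α : Fin d → Bool)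
    (x : Fin d → ℝ) : ℝ :=
  if (B.filter (α · = true)).card = 0 then p + ∑ j ∈ B, q j * x j
  else if (B.filter (α · = true)).card = 1 then ∑ j ∈ B.filter (α · = true), q j
  else 0

lemma affineDeriv_update_coord {B : Finset (Fin d)} (p : ℝ) (q : Fin d → ℝ) {α : Fin d → Bool}
    (x : Fin d → ℝ) {j : Fin d} (h : j ∉ B ∨ α j = true) (t : ℝ) :
    affineDeriv B p q α (Function.update x j t) = affineDeriv B p q α x := by
  by_cases hj : j ∈ B
  · have hα := h.resolve_left (not_not.mpr hj)
    have : (B.filter (α · = true)).card ≠ 0 :=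
      Finset.card_ne_zero_of_mem (Finset.mem_filter.mpr ⟨hj, hα⟩)
    simp [affineDeriv, this]
  · have : ∑ l ∈ B, q l * Function.update x j t l = ∑ l ∈ B, q l * x l :=
      Finset.sum_congr rfl fun l hl => by
        rw [Function.update_of_ne (ne_of_mem_of_not_mem hl hj)]
    simp only [affineDeriv, this]

lemma affineDeriv_update_index {B : Finset (Fin d)} (p : ℝ) (q : Fin d → ℝ) (α : Fin d → Bool)
    (x : Fin d → ℝ) {j : Fin d} (hj : j ∉ B) (t : Bool) :
    affineDeriv B p q (Function.update α j t) x = affineDeriv B p q α x := by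
  have : B.filter (Function.update α j t · = true) = B.filter (α · = true) :=
    Finset.filter_congr fun l hl => by
      rw [Function.update_of_ne (ne_of_mem_of_not_mem hl hj)]
  simp only [affineDeriv, this]

lemma affineDeriv_of_mem {B : Finset (Fin d)} (p : ℝ) (q : Fin d → ℝ) {α : Fin d → Bool}
    (x : Fin d → ℝ) {j : Fin d} (hj : j ∈ B) (hα : α j = false) :
    affineDeriv B p q α x = affineDeriv B p q α (Function.update x j 0) +
      x j * affineDeriv B p q (Function.update α j true) (Function.update x j 0) := by
  have hf : B.filter (Function.update α j true · = true) = insert j (B.filter (α · = true)) := by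
    ext l
    rcases eq_or_ne l j with rfl | hl
    · simp [hj]
    · simp [hl]
  have hn : j ∉ B.filter (α · = true) := by simp [hα]
  have hsum : ∑ l ∈ B, q l * x l = ∑ l ∈ B, q l * Function.update x j 0 l + x j * q j := by
    rw [← Finset.add_sum_erase _ _ hj, ← Finset.add_sum_erase _ (fun l => q l * _) hj,
      Finset.sum_congr rfl fun l hl => by
        rw [← Function.update_of_ne (Finset.ne_of_mem_erase hl) 0 x]]
    simp
    ring
  by_cases h0 : (B.filter (α · = true)).card = 0
  · have hemp := Finset.card_eq_zero.mp h0
    simp only [affineDeriv, hf, hemp]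
    simp [hsum]
    ring
  · have h2 : (insert j (B.filter (α · = true))).card = (B.filter (α · = true)).card + 1 :=
      Finset.card_insert_of_notMem hn
    simp only [affineDeriv, hf, h2]
    simp [h0]

lemma abs_affineDeriv_one_le {B : Finset (Fin d)} {γ : Fin d → ℝ} (hpos : ∀ j, 0 < γ j)
    (α : Fin d → Bool) (x : Fin d → ℝ) :
    |affineDeriv B 1 0 α x| ≤ ∏ j ∈ B, if α j then γ j else 1 := by
  by_cases h0 : (B.filter (α · = true)).card = 0
  · have hemp := Finset.card_eq_zero.mp h0
    rw [Finset.prod_eq_one]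
    · simp [affineDeriv, h0]
    · intro j hj
      rw [Finset.filter_eq_empty_iff] at hemp
      simp [hemp hj]
  · have : affineDeriv B 1 0 α x = 0 := by simp [affineDeriv, h0]
    rw [this, abs_zero]
    exact Finset.prod_nonneg fun j _ => by split_ifs <;> linarith [hpos j]

lemma abs_affineDeriv_add_le {B : Finset (Fin d)} {γ : Fin d → ℝ} (hpos : ∀ j, 0 < γ j)
    (hB : 2 ≤ ∑ j ∈ B, γ j) (α : Fin d → Bool) {x : Fin d → ℝ} (hx : x ∈ cube01 d) :
    |affineDeriv B 0 (fun j => γ j / ∑ l ∈ B, γ l) α x| +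
      |affineDeriv B 1 (fun j => -(γ j / ∑ l ∈ B, γ l)) α x| ≤
        ∏ j ∈ B, if α j then γ j else 1 := by
  set Γ := ∑ l ∈ B, γ l with hΓ
  have hΓpos : 0 < Γ := by linarith
  by_cases h0 : (B.filter (α · = true)).card = 0
  · have hemp := Finset.card_eq_zero.mp h0
    have hz0 : 0 ≤ ∑ j ∈ B, γ j / Γ * x j := Finset.sum_nonneg fun j _ =>
      mul_nonneg (div_nonneg (hpos j).le hΓpos.le) (hx j).1
    have hz1 : ∑ j ∈ B, γ j / Γ * x j ≤ 1 := by
      calc ∑ j ∈ B, γ j / Γ * x j ≤ ∑ j ∈ B, γ j / Γ := Finset.sum_le_sum fun j _ =>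
            mul_le_of_le_one_right (div_nonneg (hpos j).le hΓpos.le) (hx j).2
        _ = 1 := by rw [← Finset.sum_div, div_self hΓpos.ne']
    rw [Finset.prod_eq_one]
    · simp only [affineDeriv, h0, if_true, neg_mul, Finset.sum_neg_distrib, zero_add]
      rw [abs_of_nonneg hz0, abs_of_nonneg (by linarith)]
      linarith
    · intro j hj
      rw [Finset.filter_eq_empty_iff] at hemp
      simp [hemp hj]
  by_cases h1 : (B.filter (α · = true)).card = 1
  · obtain ⟨j, hj⟩ := Finset.card_eq_one.mp h1
    have hprod : (∏ l ∈ B, if α l then γ l else 1) = γ j := by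
      rw [← Finset.prod_filter, hj, Finset.prod_singleton]
    rw [hprod]
    simp only [affineDeriv, hj, Finset.sum_singleton]
    simp only [Finset.card_singleton, one_ne_zero, if_false, if_true, abs_neg]
    rw [abs_of_nonneg (div_nonneg (hpos j).le hΓpos.le), ← add_div, div_le_iff₀ hΓpos]
    nlinarith [hpos j]
  · simp only [affineDeriv, h0, h1, if_false, abs_zero, add_zero]
    exact Finset.prod_nonneg fun j _ => by split_ifs <;> linarith [hpos j]

end Multilinear

section CornerFunctions

variable {d : ℕ}

lemma prod_affineDeriv_of_false {κ : Type*} [Fintype κ] [DecidableEq κ] (b : Fin d → κ)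
    (P : κ → ℝ) (Q : κ → Fin d → ℝ) {α : Fin d → Bool} (x : Fin d → ℝ) {j : Fin d}
    (hα : α j = false) :
    ∏ k, affineDeriv (Finset.univ.filter (b · = k)) (P k) (Q k) α x =
      ∏ k, affineDeriv (Finset.univ.filter (b · = k)) (P k) (Q k) α (Function.update x j 0) +
      x j * ∏ k, affineDeriv (Finset.univ.filter (b · = k)) (P k) (Q k)
        (Function.update α j true) (Function.update x j 0) := by
  simp only [← Finset.mul_prod_erase _ _ (Finset.mem_univ (b j))]
  have hne : ∀ k ∈ Finset.univ.erase (b j), j ∉ Finset.univ.filter (b · = k) := by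
    intro k hk
    simpa using (Finset.ne_of_mem_erase hk).symm
  have h1 : ∏ k ∈ Finset.univ.erase (b j), affineDeriv (Finset.univ.filter (b · = k)) (P k) (Q k)
        α (Function.update x j 0) =
      ∏ k ∈ Finset.univ.erase (b j),
        affineDeriv (Finset.univ.filter (b · = k)) (P k) (Q k) α x :=
    Finset.prod_congr rfl fun k hk =>
      affineDeriv_update_coord _ _ _ (Or.inl (hne k hk)) _
  have h2 : ∏ k ∈ Finset.univ.erase (b j), affineDeriv (Finset.univ.filter (b · = k)) (P k) (Q k)
        (Function.update α j true) (Function.update x j 0) =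
      ∏ k ∈ Finset.univ.erase (b j),
        affineDeriv (Finset.univ.filter (b · = k)) (P k) (Q k) α x :=
    Finset.prod_congr rfl fun k hk => by
      rw [affineDeriv_update_index _ _ _ _ (hne k hk),
        affineDeriv_update_coord _ _ _ (Or.inl (hne k hk))]
  rw [h1, h2, affineDeriv_of_mem _ _ x (j := j) (by simp) hα]
  ring

lemma prod_affineDeriv_of_true {κ : Type*} [Fintype κ] [DecidableEq κ] (b : Fin d → κ)
    (P : κ → ℝ) (Q : κ → Fin d → ℝ) {α : Fin d → Bool} (x : Fin d → ℝ) {j : Fin d}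
    (hα : α j = true) :
    ∏ k, affineDeriv (Finset.univ.filter (b · = k)) (P k) (Q k) α (Function.update x j 0) =
      ∏ k, affineDeriv (Finset.univ.filter (b · = k)) (P k) (Q k) α x :=
  Finset.prod_congr rfl fun _ _ => affineDeriv_update_coord _ _ _ (Or.inr hα) _

/-- Constant terms of the affine factors: each block labelled `some k` carries the normalized
weighted mean of its variables or its complement to one, according to the corner `e`. -/
noncomputable def cornerConst {s : ℕ} (e : Fin s → Bool) (k : Option (Fin s)) : ℝ :=
  k.elim 1 fun k => if e k then 0 else 1

/-- Linear coefficients of the affine factors of the corner function of `e`. -/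
noncomputable def cornerSlope {s : ℕ} (γ : Fin d → ℝ) (b : Fin d → Option (Fin s))
    (e : Fin s → Bool) (k : Option (Fin s)) : Fin d → ℝ :=
  k.elim 0 fun k => if e k
    then fun j => γ j / ∑ l with b l = some k, γ l
    else fun j => -(γ j / ∑ l with b l = some k, γ l)

/-- The mixed derivatives of the product, over all blocks of the labelling `b`, of the affine
factors of the corner `e`. -/
noncomputable def cornerDeriv {s : ℕ} (γ : Fin d → ℝ) (b : Fin d → Option (Fin s))
    (e : Fin s → Bool) (α : Fin d → Bool) (x : Fin d → ℝ) : ℝ :=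
  ∏ k, affineDeriv (Finset.univ.filter (b · = k)) (cornerConst e k) (cornerSlope γ b e k) α x

lemma sum_abs_cornerDeriv_le {s : ℕ} {γ : Fin d → ℝ} (hpos : ∀ j, 0 < γ j)
    {b : Fin d → Option (Fin s)} (hb : ∀ k, 2 ≤ ∑ j with b j = some k, γ j)
    (α : Fin d → Bool) {x : Fin d → ℝ} (hx : x ∈ cube01 d) :
    ∑ e, |cornerDeriv γ b e α x| ≤ gammaWeight γ α := by
  have hW : gammaWeight γ α =
      ∏ k, ∏ j ∈ Finset.univ.filter (b · = k), if α j then γ j else 1 :=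
    (Finset.prod_fiberwise Finset.univ b fun j => if α j then γ j else 1).symm
  have hsum : ∑ e, |cornerDeriv γ b e α x| =
      |affineDeriv (Finset.univ.filter (b · = none)) 1 0 α x| *
        ∏ k : Fin s, ∑ t : Bool, |affineDeriv (Finset.univ.filter (b · = some k))
          (if t then 0 else 1)
          (if t then fun j => γ j / ∑ l with b l = some k, γ l
            else fun j => -(γ j / ∑ l with b l = some k, γ l)) α x| := by
    rw [Finset.prod_univ_sum, Fintype.piFinset_univ, Finset.mul_sum]
    refine Finset.sum_congr rfl fun e _ => ?_
    rw [cornerDeriv, Finset.abs_prod, Fintype.prod_option]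
    rfl
  rw [hsum, hW, Fintype.prod_option]
  refine mul_le_mul (abs_affineDeriv_one_le hpos α x) ?_
    (Finset.prod_nonneg fun k _ => Finset.sum_nonneg fun t _ => abs_nonneg _)
    (Finset.prod_nonneg fun j _ => by split_ifs <;> linarith [hpos j])
  refine Finset.prod_le_prod (fun k _ => Finset.sum_nonneg fun t _ => abs_nonneg _) fun k _ => ?_
  rw [Fintype.sum_bool]
  simpa using abs_affineDeriv_add_le hpos (hb k) α hx

lemma cornerDeriv_vertex {s : ℕ} {γ : Fin d → ℝ}
    {b : Fin d → Option (Fin s)} (hb : ∀ k, 2 ≤ ∑ j with b j = some k, γ j)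
    (e e' : Fin s → Bool) :
    cornerDeriv γ b e' (fun _ => false)
      (fun j => (b j).elim 0 fun k => if e k then 1 else 0) = if e' = e then 1 else 0 := by
  have hfac : ∀ k : Fin s, affineDeriv (Finset.univ.filter (b · = some k))
      (cornerConst e' (some k)) (cornerSlope γ b e' (some k)) (fun _ => false)
      (fun j => (b j).elim 0 fun k => if e k then 1 else 0) = if e' k = e k then 1 else 0 := by
    intro k
    have hΓ : (∑ j with b j = some k, γ j) ≠ 0 := by linarith [hb k]
    have hx : ∀ q : Fin d → ℝ, ∑ j with b j = some k,
        q j * (b j).elim 0 (fun k => if e k then 1 else 0) =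
          (∑ j with b j = some k, q j) * if e k then 1 else 0 := by
      intro q
      rw [Finset.sum_mul]
      refine Finset.sum_congr rfl fun j hj => ?_
      rw [(Finset.mem_filter.mp hj).2]
      rfl
    have h1 : ∑ j with b j = some k, γ j / ∑ l with b l = some k, γ l = 1 := by
      rw [← Finset.sum_div, div_self hΓ]
    simp only [affineDeriv, hx, cornerConst, cornerSlope, Option.elim_some]
    cases e' k <;> cases e k <;> simp [h1]
  rw [cornerDeriv, Fintype.prod_option]
  simp only [hfac]
  have hnone : affineDeriv (Finset.univ.filter (b · = none))
      (cornerConst e' none) (cornerSlope γ b e' none) (fun _ => false)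
      (fun j => (b j).elim 0 fun k => if e k then 1 else 0) = 1 := by
    simp [affineDeriv, cornerConst, cornerSlope]
  rw [hnone, one_mul]
  split_ifs with h
  · simp [h]
  · obtain ⟨k, hk⟩ := Function.ne_iff.mp h
    exact Finset.prod_eq_zero (Finset.mem_univ k) (if_neg hk)

/-- The ball of `ℓ_∞` over the corners of an `s`-dimensional cube embeds into the unit ball of the
weighted norm, as functions whose values at suitable points of the cube are prescribed. -/
lemma exists_linearMap_wnorm_le {s : ℕ} {γ : Fin d → ℝ} (hpos : ∀ j, 0 < γ j)
    {b : Fin d → Option (Fin s)} (hb : ∀ k, 2 ≤ ∑ j with b j = some k, γ j) :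
    ∃ c : ((Fin s → Bool) → ℝ) →ₗ[ℝ] ((Fin d → Bool) → ℝ),
      (∀ v r, (∀ e, |v e| ≤ r) → wnorm γ (c v) ≤ r) ∧
      ∀ e, ∃ x ∈ cube01 d, ∀ v, polyEval (c v) x = v e := by
  set c : ((Fin s → Bool) → ℝ) →ₗ[ℝ] ((Fin d → Bool) → ℝ) :=
    Fintype.linearCombination ℝ fun e i => cornerDeriv γ b e i 0 with hc
  have heval : ∀ v α x, polyEval (derivCoef (c v) α) x = ∑ e, v e * cornerDeriv γ b e α x := by
    intro v α x
    have := eq_polyEval_derivCoef (fun α x => ∑ e, v e * cornerDeriv γ b e α x) ?_ ?_ α x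
    · rw [this]
      congr 2
      funext i
      simp [hc, Fintype.linearCombination_apply]
    · intro α x j hα
      simp only [cornerDeriv, Finset.mul_sum, ← Finset.sum_add_distrib]
      refine Finset.sum_congr rfl fun e _ => ?_
      rw [prod_affineDeriv_of_false b _ _ x hα]
      ring
    · intro α x j hα
      simp only [cornerDeriv, prod_affineDeriv_of_true b _ _ x hα]
  refine ⟨c, fun v r hv => ?_, fun e => ?_⟩
  · have hr : 0 ≤ r := (abs_nonneg _).trans (hv fun _ => false)
    refine ciSup_le fun α => ?_
    have hW : 0 < gammaWeight γ α :=
      Finset.prod_pos fun j _ => by split_ifs <;> linarith [hpos j]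
    rw [inv_mul_le_iff₀ hW]
    refine csSup_le (Set.Nonempty.image _ ⟨0, fun _ => by simp⟩) ?_
    rintro _ ⟨x, hx, rfl⟩
    simp only [heval]
    calc |∑ e, v e * cornerDeriv γ b e α x| ≤ ∑ e, |v e * cornerDeriv γ b e α x| :=
          Finset.abs_sum_le_sum_abs _ _
      _ ≤ ∑ e, r * |cornerDeriv γ b e α x| := Finset.sum_le_sum fun e _ => by
          rw [abs_mul]
          exact mul_le_mul_of_nonneg_right (hv e) (abs_nonneg _)
      _ = r * ∑ e, |cornerDeriv γ b e α x| := (Finset.mul_sum _ _ _).symm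
      _ ≤ r * gammaWeight γ α :=
          mul_le_mul_of_nonneg_left (sum_abs_cornerDeriv_le hpos hb α hx) hr
      _ = gammaWeight γ α * r := mul_comm _ _
  · refine ⟨fun j => (b j).elim 0 fun k => if e k then 1 else 0, fun j => ?_, fun v => ?_⟩
    · dsimp only
      cases b j with
      | none => simp
      | some k =>
        rw [Option.elim_some]
        split_ifs <;> simp
    · rw [← derivCoef_false (c v), heval]
      simp [cornerDeriv_vertex hb]

/-- Greedy grouping of weights into `s` blocks of weight at least two, with a remainder of weight
less than two. -/
lemma exists_greedy_blocks {ι : Type*} [DecidableEq ι] {γ : ι → ℝ} {C : ℝ}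
    (hbd : ∀ j, γ j ≤ C) (T : Finset ι) :
    ∃ (s : ℕ) (b : ι → ℕ), s ≤ T.card ∧ (∀ j ∈ T, b j ≤ s) ∧
      (∀ k < s, 2 ≤ ∑ j ∈ T with b j = k, γ j) ∧
      ∑ j ∈ T with b j = s, γ j < 2 ∧
      ∑ j ∈ T, γ j ≤ s * (2 + C) + ∑ j ∈ T with b j = s, γ j := by
  induction T using Finset.induction_on with
  | empty => exact ⟨0, fun _ => 0, by simp⟩
  | insert j T hj ih =>
    obtain ⟨s, b, hcard, hle, hblock, hrem, htot⟩ := ih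
    have hcongr : ∀ k, ∑ i ∈ T with Function.update b j s i = k, γ i =
        ∑ i ∈ T with b i = k, γ i := fun k => by
      refine congrArg (fun S => ∑ i ∈ S, γ i) (Finset.filter_congr fun i hi => ?_)
      rw [Function.update_of_ne (ne_of_mem_of_not_mem hi hj)]
    have hin : ∑ i ∈ insert j T with Function.update b j s i = s, γ i =
        γ j + ∑ i ∈ T with b i = s, γ i := by
      rw [Finset.filter_insert, if_pos (by simp), Finset.sum_insert (by simp [hj]), hcongr]
    have hout : ∀ k, s ≠ k → ∑ i ∈ insert j T with Function.update b j s i = k, γ i =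
        ∑ i ∈ T with b i = k, γ i := fun k hk => by
      rw [Finset.filter_insert, if_neg (by simpa using hk), hcongr]
    have hle' : ∀ i ∈ insert j T, Function.update b j s i ≤ s := by
      intro i hi
      rcases eq_or_ne i j with rfl | hij
      · simp
      · rw [Function.update_of_ne hij]
        exact hle i (Finset.mem_of_mem_insert_of_ne hi hij)
    rcases lt_or_ge (γ j + ∑ i ∈ T with b i = s, γ i) 2 with h | h
    · refine ⟨s, Function.update b j s, ?_, hle', fun k hk => ?_, by rwa [hin], ?_⟩
      · rw [Finset.card_insert_of_notMem hj]
        omega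
      · rw [hout k hk.ne']
        exact hblock k hk
      · rw [hin, Finset.sum_insert hj]
        linarith
    · have hz : ∑ i ∈ insert j T with Function.update b j s i = s + 1, γ i = 0 := by
        rw [Finset.filter_false_of_mem, Finset.sum_empty]
        intro i hi
        have := hle' i hi
        omega
      refine ⟨s + 1, Function.update b j s, ?_, fun i hi => (hle' i hi).trans s.le_succ,
        fun k hk => ?_, by rw [hz]; norm_num, ?_⟩
      · rw [Finset.card_insert_of_notMem hj]
        omega
      · rcases (Nat.lt_succ_iff_lt_or_eq.mp hk) with hk | rfl
        · rw [hout k hk.ne']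
          exact hblock k hk
        · rwa [hin]
      · rw [hz, Finset.sum_insert hj]
        push_cast
        linarith [hbd j]

end CornerFunctions

section Information

/-- Fewer than `card ι` real numbers, depending on a vector linearly and adaptively, do not
distinguish the vectors on some line through the origin. -/
lemma IsAdaptiveLinear.exists_ne_zero_map_smul_eq {ι E : Type*} [Fintype ι] [AddCommGroup E]
    [Module ℝ E] {n : ℕ} (hn : n < Fintype.card ι) {N : E → Fin n → ℝ} (hN : IsAdaptiveLinear N)
    (c : (ι → ℝ) →ₗ[ℝ] E) : ∃ v : ι → ℝ, v ≠ 0 ∧ ∀ t : ℝ, N (c (t • v)) = 0 := by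
  obtain ⟨L, hL⟩ := hN
  have hker := LinearMap.ker_ne_bot_of_finrank_lt
    (f := LinearMap.pi fun j : Fin n => (L j 0).comp c) (by simpa using hn)
  obtain ⟨v, hv, hv0⟩ := (Submodule.ne_bot_iff _).mp hker
  refine ⟨v, hv0, fun t => ?_⟩
  have hLv : ∀ j, L j 0 (c (t • v)) = 0 := fun j => by
    have : L j 0 (c v) = 0 := congrFun (LinearMap.mem_ker.mp hv) j
    rw [map_smul, map_smul, this, smul_zero]
  have h : ∀ m (hm : m < n), N (c (t • v)) ⟨m, hm⟩ = 0 := by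
    intro m
    induction m using Nat.strong_induction_on with
    | _ m ih =>
      intro hm
      rw [hL, ← hLv ⟨m, hm⟩]
      congr 2
      funext i
      exact ih i i.isLt _
  exact funext fun j => h j j.isLt

lemma IsAdaptiveLinear.exists_map_eq {ι E : Type*} [Fintype ι] [AddCommGroup E] [Module ℝ E]
    {n : ℕ} (hn : n < Fintype.card ι) {N : E → Fin n → ℝ} (hN : IsAdaptiveLinear N)
    (c : (ι → ℝ) →ₗ[ℝ] E) {r : ℝ} (hr : 0 ≤ r) :
    ∃ v w : ι → ℝ, (∀ e, |v e| ≤ r) ∧ (∀ e, |w e| ≤ r) ∧ N (c v) = N (c w) ∧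
      ∃ e, v e = r ∧ w e = -r := by
  obtain ⟨v, hv0, hv⟩ := hN.exists_ne_zero_map_smul_eq hn c
  obtain ⟨i, hi⟩ := Function.ne_iff.mp hv0
  have : Nonempty ι := ⟨i⟩
  obtain ⟨e, he⟩ := Finite.exists_max fun e => |v e|
  have hpos : 0 < |v e| := (abs_pos.mpr hi).trans_le (he i)
  have hle : ∀ l, |r / v e * v l| ≤ r := fun l => by
    rw [abs_mul, abs_div, abs_of_nonneg hr, div_mul_eq_mul_div, div_le_iff₀ hpos]
    exact mul_le_mul_of_nonneg_left (he l) hr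
  have hval : r / v e * v e = r := div_mul_cancel₀ _ (abs_pos.mp hpos)
  refine ⟨(r / v e) • v, (-(r / v e)) • v, hle, fun l => ?_, by rw [hv, hv], e, hval, ?_⟩
  · simpa using hle l
  · simpa using hval

lemma exists_map_eq_of_continuous {ι : Type*} [Fintype ι] {n : ℕ} (hn : n < Fintype.card ι)
    {M : (ι → ℝ) → Fin n → ℝ} (hM : Continuous M) {r : ℝ} (hr : 0 ≤ r) :
    ∃ v w : ι → ℝ, (∀ e, |v e| ≤ r) ∧ (∀ e, |w e| ≤ r) ∧ M v = M w ∧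
      ∃ e, v e = r ∧ w e = -r := by
  let σ := Fintype.equivFin ι
  let g : (Fin (Fintype.card ι) → ℝ) → ι → ℝ := fun x e => r * (2 * x (σ e) - 1)
  have hg : Continuous g := by fun_prop
  have habs : ∀ x ∈ Set.Icc (0 : Fin (Fintype.card ι) → ℝ) 1, ∀ e, |g x e| ≤ r := by
    intro x hx e
    have h0 : 0 ≤ x (σ e) := hx.1 (σ e)
    have h1 : x (σ e) ≤ 1 := hx.2 (σ e)
    exact abs_le.mpr ⟨by simp only [g]; nlinarith, by simp only [g]; nlinarith⟩
  obtain ⟨x, hx, y, hy, i, hxi, hyi, hxy⟩ := exists_opposite_faces_map_eq hn (hM.comp hg)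
  refine ⟨g x, g y, habs x hx, habs y hy, hxy, σ.symm i, ?_, ?_⟩
  · simp only [g, Equiv.apply_symm_apply, hxi]
    ring
  · simp only [g, Equiv.apply_symm_apply, hyi]
    ring

end Information

section EssentialSupremum

variable {d : ℕ}

lemma continuous_polyEval (c : (Fin d → Bool) → ℝ) : Continuous (polyEval c) := by
  refine continuous_finsetSum _ fun i _ => continuous_const.mul ?_
  refine continuous_finsetProd _ fun j _ => ?_
  split_ifs
  · exact continuous_apply j
  · exact continuous_const

lemma cube01_subset_closure_interior : cube01 d ⊆ closure (interior (cube01 d)) := by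
  have h : cube01 d = Set.univ.pi fun _ => Set.Icc (0 : ℝ) 1 := by
    ext x
    simp only [cube01, Set.mem_pi, Set.mem_univ, forall_const, Set.mem_ofPred_eq]
  rw [h, interior_pi_set Set.finite_univ, closure_pi_set]
  simp

lemma restrict_cube01_pos {U : Set (Fin d → ℝ)} (hU : IsOpen U) {x : Fin d → ℝ} (hxU : x ∈ U)
    (hx : x ∈ cube01 d) : 0 < MeasureTheory.volume.restrict (cube01 d) U := by
  have hne : (U ∩ interior (cube01 d)).Nonempty :=
    mem_closure_iff.mp (cube01_subset_closure_interior hx) U hU hxU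
  refine ((hU.inter isOpen_interior).measure_pos MeasureTheory.volume hne).trans_le ?_
  rw [MeasureTheory.Measure.restrict_apply hU.measurableSet]
  exact MeasureTheory.measure_mono (Set.inter_subset_inter_right _ interior_subset)

/-- If two continuous functions differ by `2 r` at a point of the cube, then every function has
distance at least `r` to one of them. -/
lemma le_essSup_or_le_essSup {f g : (Fin d → ℝ) → ℝ} (hf : Continuous f) (hg : Continuous g)
    (h : (Fin d → ℝ) → ℝ) {r : ℝ} {x : Fin d → ℝ} (hx : x ∈ cube01 d)
    (hfg : f x - g x = 2 * r) :
    ENNReal.ofReal r ≤ essSup (fun x => ENNReal.ofReal |f x - h x|)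
        (MeasureTheory.volume.restrict (cube01 d)) ∨
      ENNReal.ofReal r ≤ essSup (fun x => ENNReal.ofReal |g x - h x|)
        (MeasureTheory.volume.restrict (cube01 d)) := by
  by_contra! hlt
  obtain ⟨h1, h2⟩ := hlt
  obtain ⟨a, ha1, har⟩ := exists_between h1
  obtain ⟨b, hb1, hbr⟩ := exists_between h2
  have har' := ENNReal.toReal_lt_of_lt_ofReal har
  have hbr' := ENNReal.toReal_lt_of_lt_ofReal hbr
  have hpos : 0 < MeasureTheory.volume.restrict (cube01 d)
      {y | a.toReal + b.toReal < |f y - g y|} := by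
    refine restrict_cube01_pos (isOpen_lt continuous_const (hf.sub hg).abs) ?_ hx
    rw [Set.mem_ofPred_eq, hfg]
    exact (by linarith : a.toReal + b.toReal < 2 * r).trans_le (le_abs_self _)
  refine hpos.ne' (MeasureTheory.measure_mono_null (fun y hy => ?_)
    (MeasureTheory.ae_iff.mp ((ae_lt_of_essSup_lt ha1).and (ae_lt_of_essSup_lt hb1))))
  rintro ⟨hya, hyb⟩
  have hya' := (ENNReal.ofReal_lt_iff_lt_toReal (abs_nonneg _) har.ne_top).mp hya
  have hyb' := (ENNReal.ofReal_lt_iff_lt_toReal (abs_nonneg _) hbr.ne_top).mp hyb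
  have := abs_sub_le (f y) (h y) (g y)
  rw [abs_sub_comm (h y)] at this
  rw [Set.mem_ofPred_eq] at hy
  linarith

end EssentialSupremum

/-- **Paper Theorem 4.1** (lower bound for `L_∞`-approximation on the weighted space
`P_d^γ` of multilinear polynomials): there is an integer `0 ≤ s ≤ d` with
`s > (∑_j γ_{d,j} − 2)/(2 + C_γ)` such that every algorithm `φ ∘ N` using `n < 2^s`
pieces of information (with `N` continuous or adaptive linear) has worst case error at
least `r` on the ball of radius `r` of `P_d^γ`. -/
theorem stmt11 (d : ℕ) (hd : 1 ≤ d) (Cγ : ℝ) (γ : Fin d → ℝ)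
    (hpos : ∀ j, 0 < γ j) (hbd : ∀ j, γ j ≤ Cγ)
    (hmono : ∀ i j : Fin d, i ≤ j → γ j ≤ γ i) :
    ∃ s : ℕ, s ≤ d ∧ ((∑ j, γ j) - 2) / (2 + Cγ) < s ∧
      ∀ n : ℕ, n < 2 ^ s →
        ∀ N : ((Fin d → Bool) → ℝ) → (Fin n → ℝ), Continuous N ∨ IsAdaptiveLinear N →
          ∀ φ : (Fin n → ℝ) → (Fin d → ℝ) → ℝ, ∀ r : ℝ, 0 ≤ r →
            ∃ c : (Fin d → Bool) → ℝ, wnorm γ c ≤ r ∧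
              ENNReal.ofReal r ≤
                essSup (fun x => ENNReal.ofReal |polyEval c x - φ (N c) x|)
                  (MeasureTheory.volume.restrict (cube01 d)) := by
  classical
  have hC : 0 < 2 + Cγ := by linarith [hpos ⟨0, hd⟩, hbd ⟨0, hd⟩]
  obtain ⟨s, b, hcard, hle, hblock, hrem, htot⟩ := exists_greedy_blocks hbd Finset.univ
  refine ⟨s, by simpa using hcard, ?_, fun n hn N hN φ r hr => ?_⟩
  · rw [div_lt_iff₀ hC]
    linarith
  let β : Fin d → Option (Fin s) := fun j => if h : b j < s then some ⟨b j, h⟩ else none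
  have hβ : ∀ k : Fin s, 2 ≤ ∑ j with β j = some k, γ j := by
    intro k
    convert hblock k k.isLt using 3 with j
    by_cases h : b j < s
    · simp [β, h, Fin.ext_iff]
    · simp only [β, h, dite_false, reduceCtorEq, false_iff]
      exact fun hk => h (hk ▸ k.isLt)
  obtain ⟨c, hnorm, hval⟩ := exists_linearMap_wnorm_le hpos hβ
  have hn' : n < Fintype.card (Fin s → Bool) := by simpa using hn
  obtain ⟨v, w, hv, hw, hN', e, hve, hwe⟩ : ∃ v w : (Fin s → Bool) → ℝ,
      (∀ e, |v e| ≤ r) ∧ (∀ e, |w e| ≤ r) ∧ N (c v) = N (c w) ∧ ∃ e, v e = r ∧ w e = -r := by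
    rcases hN with hN | hN
    · exact exists_map_eq_of_continuous hn'
        (hN.comp (LinearMap.continuous_of_finiteDimensional c)) hr
    · exact hN.exists_map_eq hn' c hr
  obtain ⟨x, hx, hxc⟩ := hval e
  have hdiff : polyEval (c v) x - polyEval (c w) x = 2 * r := by
    rw [hxc, hxc, hve, hwe]
    ring
  rcases le_essSup_or_le_essSup (continuous_polyEval (c v)) (continuous_polyEval (c w))
    (φ (N (c v))) hx hdiff with h | h
  · exact ⟨c v, hnorm v r hv, h⟩
  · exact ⟨c w, hnorm w r hw, hN' ▸ h⟩
end

section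
/- For every real p with 1 ≤ p < ∞ and every integer k ≥ 1, the integral of |z₁ + z₂ + … + z_k|^p over the cube [−1/2, 1/2]^k with respect to k-dimensional Lebesgue measure satisfies ∫_{[−1/2,1/2]^k} |Σ_{m=1}^k z_m|^p dλ^k(z) ≥ k^{p/2} / ( (2√2)^p · (1+p) ). -/
/-- The average of a function over all sign vectors. -/
noncomputable def signAvg {n : ℕ} (f : (Fin n → Bool) → ℝ) : ℝ := (∑ ε, f ε) / 2 ^ n

/-- The real sign encoded by a Boolean. -/
def boolSign (b : Bool) : ℝ := if b then 1 else -1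

/-- Flip one coordinate of a sign vector. -/
def flipAt {n : ℕ} (i : Fin n) (ε : Fin n → Bool) : Fin n → Bool := Function.update ε i (!ε i)

/-- The Dirichlet form of the random walk on the discrete cube. -/
noncomputable def dirichletForm {n : ℕ} (f : (Fin n → Bool) → ℝ) : ℝ :=
  (1 / 4) * ∑ i, signAvg fun ε => (f ε - f (flipAt i ε)) ^ 2

/-- The Rademacher sum with coefficients `a`. -/
def rademacherSum {n : ℕ} (a : Fin n → ℝ) (ε : Fin n → Bool) : ℝ := ∑ i, boolSign (ε i) * a i

@[simp] lemma boolSign_true : boolSign true = 1 := rfl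

@[simp] lemma boolSign_false : boolSign false = -1 := rfl

lemma boolSign_not (b : Bool) : boolSign (!b) = -boolSign b := by cases b <;> simp

lemma signAvg_add {n : ℕ} (f g : (Fin n → Bool) → ℝ) :
    signAvg (fun ε => f ε + g ε) = signAvg f + signAvg g := by
  simp only [signAvg, Finset.sum_add_distrib, add_div]

lemma signAvg_const_mul {n : ℕ} (c : ℝ) (f : (Fin n → Bool) → ℝ) :
    signAvg (fun ε => c * f ε) = c * signAvg f := by
  simp only [signAvg, ← Finset.mul_sum, mul_div_assoc]

lemma signAvg_sub {n : ℕ} (f g : (Fin n → Bool) → ℝ) :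
    signAvg (fun ε => f ε - g ε) = signAvg f - signAvg g := by
  simp only [signAvg, Finset.sum_sub_distrib, sub_div]

lemma signAvg_const {n : ℕ} (c : ℝ) : signAvg (fun _ : Fin n → Bool => c) = c := by
  simp [signAvg]

lemma signAvg_sum {n : ℕ} {ι : Type*} (s : Finset ι) (f : ι → (Fin n → Bool) → ℝ) :
    signAvg (fun ε => ∑ i ∈ s, f i ε) = ∑ i ∈ s, signAvg (f i) := by
  simp only [signAvg]
  rw [Finset.sum_comm, Finset.sum_div]

lemma signAvg_mono {n : ℕ} {f g : (Fin n → Bool) → ℝ} (h : ∀ ε, f ε ≤ g ε) :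
    signAvg f ≤ signAvg g := by
  unfold signAvg
  gcongr with ε
  exact h ε

lemma signAvg_comp_equiv {n : ℕ} (e : (Fin n → Bool) ≃ (Fin n → Bool))
    (f : (Fin n → Bool) → ℝ) : signAvg (fun ε => f (e ε)) = signAvg f := by
  simp only [signAvg, Equiv.sum_comp e f]

lemma signAvg_succ {n : ℕ} (f : (Fin (n + 1) → Bool) → ℝ) :
    signAvg f = (signAvg (fun ε => f (Fin.cons true ε)) +
      signAvg (fun ε => f (Fin.cons false ε))) / 2 := by
  simp only [signAvg]
  rw [← (Fin.consEquiv fun _ : Fin (n + 1) => Bool).sum_comp, Fintype.sum_prod_type]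
  simp only [Fin.consEquiv, Equiv.coe_fn_mk, Fintype.sum_bool, pow_succ]
  ring

lemma signAvg_sq_le {n : ℕ} (f : (Fin n → Bool) → ℝ) :
    signAvg f ^ 2 ≤ signAvg fun ε => f ε ^ 2 := by
  have h : 0 ≤ signAvg fun ε => (f ε - signAvg f) ^ 2 := by
    rw [← signAvg_const (n := n) 0]
    exact signAvg_mono fun ε => sq_nonneg _
  have h2 : (fun ε => (f ε - signAvg f) ^ 2) =
      fun ε => (f ε ^ 2 - (2 * signAvg f) * f ε) + signAvg f ^ 2 := by
    ext ε; ring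
  rw [h2, signAvg_add, signAvg_sub, signAvg_const_mul, signAvg_const] at h
  linarith

lemma flipAt_cons_zero {n : ℕ} (b : Bool) (ε : Fin n → Bool) :
    flipAt 0 (Fin.cons b ε : Fin (n + 1) → Bool) = Fin.cons (!b) ε := by
  simp [flipAt, Fin.update_cons_zero]

lemma flipAt_cons_succ {n : ℕ} (i : Fin n) (b : Bool) (ε : Fin n → Bool) :
    flipAt i.succ (Fin.cons b ε : Fin (n + 1) → Bool) = Fin.cons b (flipAt i ε) := by
  simp [flipAt, Fin.cons_update]

lemma flipAt_involutive {n : ℕ} (i : Fin n) : Function.Involutive (flipAt i) := by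
  intro ε
  simp [flipAt]

lemma dirichletForm_succ {n : ℕ} (f : (Fin (n + 1) → Bool) → ℝ) :
    dirichletForm f = (dirichletForm (fun ε => f (Fin.cons true ε)) +
        dirichletForm (fun ε => f (Fin.cons false ε))) / 2 +
      (1 / 4) * signAvg fun ε => (f (Fin.cons true ε) - f (Fin.cons false ε)) ^ 2 := by
  have h : ∀ ε : Fin n → Bool, (f (Fin.cons false ε) - f (Fin.cons true ε)) ^ 2 =
      (f (Fin.cons true ε) - f (Fin.cons false ε)) ^ 2 := fun ε => by ring
  simp only [dirichletForm, Fin.sum_univ_succ, signAvg_succ (n := n), flipAt_cons_zero,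
    flipAt_cons_succ, Bool.not_true, Bool.not_false, h, ← Finset.sum_div,
    Finset.sum_add_distrib]
  ring

lemma dirichletForm_parallelogram {n : ℕ} (u v : (Fin n → Bool) → ℝ) :
    dirichletForm (fun ε => (u ε + v ε) / 2) + dirichletForm (fun ε => (u ε - v ε) / 2) =
      (dirichletForm u + dirichletForm v) / 2 := by
  simp only [dirichletForm]
  rw [← mul_add, ← mul_add, mul_div_assoc, ← Finset.sum_add_distrib, ← Finset.sum_add_distrib,
    Finset.sum_div]
  congr 1
  refine Finset.sum_congr rfl fun i _ => ?_
  simp only [← signAvg_add]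
  rw [div_eq_inv_mul, ← signAvg_const_mul]
  congr 1
  ext ε
  ring

/-- The Poincaré inequality on the discrete cube. -/
lemma signAvg_variance_le_dirichletForm {n : ℕ} (f : (Fin n → Bool) → ℝ) :
    signAvg (fun ε => f ε ^ 2) - signAvg f ^ 2 ≤ dirichletForm f := by
  induction n with
  | zero => simp [signAvg, dirichletForm]
  | succ n ih =>
    have h := signAvg_sq_le fun ε => f (Fin.cons true ε) - f (Fin.cons false ε)
    rw [signAvg_sub] at h
    have hu := ih fun ε => f (Fin.cons true ε)
    have hv := ih fun ε => f (Fin.cons false ε)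
    rw [dirichletForm_succ, signAvg_succ, signAvg_succ f]
    nlinarith

/-- A Poincaré inequality with spectral gap `2` away from the first Walsh chaos. -/
lemma two_mul_signAvg_variance_le {n : ℕ} (f : (Fin n → Bool) → ℝ) :
    2 * (signAvg (fun ε => f ε ^ 2) - signAvg f ^ 2) ≤
      dirichletForm f + ∑ i, signAvg (fun ε => boolSign (ε i) * f ε) ^ 2 := by
  induction n with
  | zero => simp [signAvg, dirichletForm]
  | succ n ih =>
    set u : (Fin n → Bool) → ℝ := fun ε => f (Fin.cons true ε) with hu
    set v : (Fin n → Bool) → ℝ := fun ε => f (Fin.cons false ε) with hv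
    have hg := ih fun ε => (u ε + v ε) / 2
    have hh := signAvg_variance_le_dirichletForm fun ε => (u ε - v ε) / 2
    have hp := dirichletForm_parallelogram u v
    have hsum : ∑ i, signAvg (fun ε => boolSign (ε i) * f ε) ^ 2 =
        signAvg (fun ε => (u ε - v ε) / 2) ^ 2 +
          ∑ i, signAvg (fun ε => boolSign (ε i) * ((u ε + v ε) / 2)) ^ 2 := by
      rw [Fin.sum_univ_succ]
      congr 1
      · rw [signAvg_succ]
        simp only [Fin.cons_zero, boolSign_true, boolSign_false, ← signAvg_add]
        rw [div_eq_inv_mul, ← signAvg_const_mul]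
        congr 2
        ext ε
        simp only [hu, hv]
        ring
      · refine Finset.sum_congr rfl fun i _ => ?_
        rw [signAvg_succ]
        simp only [Fin.cons_succ, ← signAvg_add]
        rw [div_eq_inv_mul, ← signAvg_const_mul]
        congr 2
        ext ε
        simp only [hu, hv]
        ring
    have hsq : signAvg (fun ε => f ε ^ 2) = signAvg (fun ε => ((u ε + v ε) / 2) ^ 2) +
        signAvg (fun ε => ((u ε - v ε) / 2) ^ 2) := by
      rw [signAvg_succ]
      simp only [← signAvg_add]
      rw [div_eq_inv_mul, ← signAvg_const_mul]
      congr 1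
      ext ε
      simp only [hu, hv]
      ring
    have hmean : signAvg f = signAvg (fun ε => (u ε + v ε) / 2) := by
      rw [signAvg_succ]
      simp only [← signAvg_add]
      rw [div_eq_inv_mul, ← signAvg_const_mul]
      congr 1
      ext ε
      simp only [hu, hv]
      ring
    have hdiff : (1 / 4) * signAvg (fun ε => (u ε - v ε) ^ 2) =
        signAvg (fun ε => ((u ε - v ε) / 2) ^ 2) := by
      rw [← signAvg_const_mul]
      congr 1
      ext ε
      ring
    rw [dirichletForm_succ, hsum, hsq, hmean]
    change _ ≤ (dirichletForm u + dirichletForm v) / 2 +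
      (1 / 4) * signAvg (fun ε => (u ε - v ε) ^ 2) + _
    linarith

lemma signAvg_rademacherSum_sq {n : ℕ} (a : Fin n → ℝ) :
    signAvg (fun ε => rademacherSum a ε ^ 2) = ∑ i, a i ^ 2 := by
  induction n with
  | zero => simp [signAvg, rademacherSum]
  | succ n ih =>
    rw [signAvg_succ, Fin.sum_univ_succ, ← ih fun i => a i.succ, ← signAvg_add, div_eq_inv_mul,
      ← signAvg_const_mul, ← signAvg_const (n := n) (a 0 ^ 2), ← signAvg_add]
    congr 1
    ext ε
    simp only [rademacherSum, Fin.sum_univ_succ, Fin.cons_zero, Fin.cons_succ, boolSign_true,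
      boolSign_false]
    ring

lemma rademacherSum_flipAt {n : ℕ} (a : Fin n → ℝ) (i : Fin n) (ε : Fin n → Bool) :
    rademacherSum a (flipAt i ε) = rademacherSum a ε - 2 * (boolSign (ε i) * a i) := by
  have h : ∀ j, boolSign (flipAt i ε j) * a j =
      boolSign (ε j) * a j - if j = i then 2 * (boolSign (ε i) * a i) else 0 := by
    intro j
    by_cases hj : j = i
    · subst hj
      simp only [flipAt, Function.update_self, boolSign_not, if_true]
      ring
    · simp [flipAt, hj]
  simp only [rademacherSum, h, Finset.sum_sub_distrib, Finset.sum_ite_eq', Finset.mem_univ,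
    if_true]

lemma rademacherSum_not {n : ℕ} (a : Fin n → ℝ) (ε : Fin n → Bool) :
    rademacherSum a (fun i => !ε i) = -rademacherSum a ε := by
  simp [rademacherSum, boolSign_not]

lemma dirichletForm_eq {n : ℕ} (f : (Fin n → Bool) → ℝ) :
    dirichletForm f = (1 / 2) * signAvg fun ε => f ε * (n * f ε - ∑ i, f (flipAt i ε)) := by
  have h : ∀ ε, f ε * (n * f ε - ∑ i, f (flipAt i ε)) =
      ∑ i : Fin n, (f ε ^ 2 - f ε * f (flipAt i ε)) := by
    intro ε
    rw [Finset.sum_sub_distrib, ← Finset.mul_sum]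
    simp
    ring
  simp only [h, signAvg_sum, dirichletForm]
  rw [Finset.mul_sum, Finset.mul_sum]
  refine Finset.sum_congr rfl fun i _ => ?_
  have h1 : signAvg (fun ε => f (flipAt i ε) ^ 2) = signAvg fun ε => f ε ^ 2 :=
    signAvg_comp_equiv (flipAt_involutive i).toPerm fun ε => f ε ^ 2
  have h2 : (fun ε => (f ε - f (flipAt i ε)) ^ 2) =
      fun ε => (f ε ^ 2 - 2 * (f ε * f (flipAt i ε))) + f (flipAt i ε) ^ 2 := by
    ext ε; ring
  rw [h2, signAvg_add, signAvg_sub, signAvg_sub, signAvg_const_mul, h1]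
  ring

lemma dirichletForm_abs_rademacherSum_le {n : ℕ} (a : Fin n → ℝ) :
    dirichletForm (fun ε => |rademacherSum a ε|) ≤ ∑ i, a i ^ 2 := by
  rw [dirichletForm_eq, ← signAvg_rademacherSum_sq, ← signAvg_const_mul]
  refine signAvg_mono fun ε => ?_
  have h1 : ∑ i, rademacherSum a (flipAt i ε) = (n - 2) * rademacherSum a ε := by
    simp only [rademacherSum_flipAt, Finset.sum_sub_distrib, ← Finset.mul_sum]
    simp [rademacherSum]
    ring
  have h2 : (n - 2) * |rademacherSum a ε| ≤ ∑ i, |rademacherSum a (flipAt i ε)| := by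
    refine le_trans ?_ (Finset.abs_sum_le_sum_abs _ _)
    rw [h1, abs_mul]
    gcongr
    exact le_abs_self _
  rw [← sq_abs (rademacherSum a ε)]
  nlinarith [abs_nonneg (rademacherSum a ε)]

/-- The `L¹`–`L²` Khintchine inequality with Szarek's optimal constant, by the argument of
Latała and Oleszkiewicz. -/
lemma sum_sq_le_two_mul_signAvg_abs_sq {n : ℕ} (a : Fin n → ℝ) :
    ∑ i, a i ^ 2 ≤ 2 * signAvg (fun ε => |rademacherSum a ε|) ^ 2 := by
  have h := two_mul_signAvg_variance_le fun ε => |rademacherSum a ε|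
  have h0 : ∀ i, signAvg (fun ε => boolSign (ε i) * |rademacherSum a ε|) = 0 := by
    intro i
    have hinv : Function.Involutive fun (ε : Fin n → Bool) j => !ε j := by
      intro ε; simp
    have := signAvg_comp_equiv hinv.toPerm fun ε => boolSign (ε i) * |rademacherSum a ε|
    simp only [Function.Involutive.coe_toPerm, rademacherSum_not, boolSign_not, abs_neg] at this
    have hneg := signAvg_const_mul (-1) fun ε => boolSign (ε i) * |rademacherSum a ε|
    simp only [neg_one_mul] at hneg
    simp only [neg_mul, hneg] at this
    linarith
  simp only [h0, sq_abs, signAvg_rademacherSum_sq] at h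
  have := dirichletForm_abs_rademacherSum_le a
  norm_num at h
  linarith

/-- The uniform probability measure on `[-1/2, 1/2]`. -/
noncomputable def unifIcc : MeasureTheory.Measure ℝ :=
  MeasureTheory.volume.restrict (Set.Icc (-(1 / 2) : ℝ) (1 / 2))

/-- The uniform probability measure on the cube `[-1/2, 1/2]^k`. -/
noncomputable def unifCube (k : ℕ) : MeasureTheory.Measure (Fin k → ℝ) :=
  MeasureTheory.Measure.pi fun _ => unifIcc

section Cube

open MeasureTheory

instance : IsProbabilityMeasure unifIcc := ⟨by simp [unifIcc]; norm_num⟩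

instance (k : ℕ) : IsProbabilityMeasure (unifCube k) := by
  unfold unifCube; infer_instance

lemma unifCube_eq_restrict (k : ℕ) :
    unifCube k = volume.restrict {z : Fin k → ℝ | ∀ m, z m ∈ Set.Icc (-(1 / 2) : ℝ) (1 / 2)} := by
  unfold unifCube unifIcc
  rw [← Measure.restrict_pi_pi, ← volume_pi]
  congr 1
  ext z
  simp only [Set.mem_univ_pi, Set.mem_ofPred_eq]

lemma integral_unifIcc (f : ℝ → ℝ) :
    ∫ x, f x ∂unifIcc = ∫ x in (-(1 / 2) : ℝ)..(1 / 2), f x := by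
  rw [unifIcc, integral_Icc_eq_integral_Ioc, intervalIntegral.integral_of_le (by norm_num)]

lemma Continuous.integrable_unifCube {k : ℕ} {f : (Fin k → ℝ) → ℝ} (hf : Continuous f) :
    Integrable f (unifCube k) := by
  rw [unifCube_eq_restrict]
  refine hf.continuousOn.integrableOn_compact ?_
  have : {z : Fin k → ℝ | ∀ m, z m ∈ Set.Icc (-(1 / 2) : ℝ) (1 / 2)} =
      Set.univ.pi fun _ => Set.Icc (-(1 / 2) : ℝ) (1 / 2) := by
    ext z
    simp only [Set.mem_univ_pi, Set.mem_ofPred_eq]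
  rw [this]
  exact isCompact_univ_pi fun _ => isCompact_Icc

lemma integral_unifCube_succ {k : ℕ} {g : ℝ → ℝ} (hg : Continuous g) :
    ∫ z, g (∑ m, z m) ∂unifCube (k + 1) =
      ∫ z, (∫ x, g (x + ∑ m, z m) ∂unifIcc) ∂unifCube k := by
  have hmp := measurePreserving_piFinSuccAbove (fun _ : Fin (k + 1) => unifIcc) 0
  have hcomp : (fun z : Fin (k + 1) → ℝ => g (∑ m, z m)) =
      (fun y : ℝ × (Fin k → ℝ) => g (y.1 + ∑ m, y.2 m)) ∘
        MeasurableEquiv.piFinSuccAbove (fun _ : Fin (k + 1) => ℝ) 0 := by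
    ext z
    simp [Fin.sum_univ_succ, MeasurableEquiv.piFinSuccAbove, Fin.tail]
  have hint : Integrable (fun z : Fin (k + 1) → ℝ => g (∑ m, z m)) (unifCube (k + 1)) :=
    Continuous.integrable_unifCube (by fun_prop)
  rw [hcomp] at hint
  have hint' := (hmp.integrable_comp_emb (MeasurableEquiv.measurableEmbedding _)).1 hint
  rw [hcomp]
  exact (hmp.integral_comp' _).trans (integral_prod_symm _ hint')

lemma integral_unifIcc_add_sq (s : ℝ) : ∫ x, (x + s) ^ 2 ∂unifIcc = s ^ 2 + 1 / 12 := by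
  rw [integral_unifIcc, intervalIntegral.integral_comp_add_right fun x => x ^ 2, integral_pow]
  norm_num
  ring

lemma integral_unifIcc_add_pow_six (s : ℝ) :
    ∫ x, (x + s) ^ 6 ∂unifIcc = s ^ 6 + 5 / 4 * s ^ 4 + 3 / 16 * s ^ 2 + 1 / 448 := by
  rw [integral_unifIcc, intervalIntegral.integral_comp_add_right fun x => x ^ 6, integral_pow]
  norm_num
  ring

lemma integral_unifIcc_abs_rpow {p : ℝ} (hp : 1 ≤ p) :
    ∫ x, |x| ^ p ∂unifIcc = 1 / (2 ^ p * (1 + p)) := by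
  have hc : Continuous fun x : ℝ => |x| ^ p :=
    continuous_abs.rpow_const fun _ => Or.inr (by linarith)
  have hpos : ∫ x in (0 : ℝ)..(1 / 2), |x| ^ p = (1 / 2) ^ (p + 1) / (p + 1) := by
    have : ∫ x in (0 : ℝ)..(1 / 2), |x| ^ p = ∫ x in (0 : ℝ)..(1 / 2), x ^ p := by
      refine intervalIntegral.integral_congr fun x hx => ?_
      rw [Set.uIcc_of_le (by norm_num)] at hx
      simp only [abs_of_nonneg hx.1]
    rw [this, integral_rpow (Or.inl (by linarith)), Real.zero_rpow (by linarith), sub_zero]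
  have hneg : ∫ x in (-(1 / 2) : ℝ)..0, |x| ^ p = ∫ x in (0 : ℝ)..(1 / 2), |x| ^ p := by
    have := intervalIntegral.integral_comp_neg (a := -(1 / 2)) (b := 0) fun x : ℝ => |x| ^ p
    simpa using this
  rw [integral_unifIcc, ← intervalIntegral.integral_add_adjacent_intervals
    (hc.intervalIntegrable _ 0) (hc.intervalIntegrable _ _), hneg, hpos,
    Real.rpow_add (by norm_num), Real.rpow_one, Real.div_rpow (by norm_num) (by norm_num),
    Real.one_rpow]
  have : (2 : ℝ) ^ p ≠ 0 := by positivity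
  have : 1 + p ≠ 0 := by linarith
  have : p + 1 ≠ 0 := by linarith
  field_simp
  ring

lemma integral_unifCube_sum_sq (k : ℕ) : ∫ z, (∑ m, z m) ^ 2 ∂unifCube k = k / 12 := by
  induction k with
  | zero => simp
  | succ k ih =>
    rw [integral_unifCube_succ (g := fun x => x ^ 2) (by fun_prop)]
    simp only [integral_unifIcc_add_sq]
    rw [integral_add (Continuous.integrable_unifCube (by fun_prop)) (integrable_const _), ih]
    simp
    ring

lemma le_integral_unifCube_sum_pow_six (k : ℕ) :
    (k : ℝ) ^ 3 / 448 ≤ ∫ z, (∑ m, z m) ^ 6 ∂unifCube k := by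
  induction k with
  | zero => simp
  | succ k ih =>
    rw [integral_unifCube_succ (g := fun x => x ^ 6) (by fun_prop)]
    simp only [integral_unifIcc_add_pow_six]
    have hlow : ∫ z, ((∑ m, z m) ^ 6 + ((5 / 24 * k + 3 / 16) * (∑ m, z m) ^ 2 +
        (1 / 448 - 5 / 4 * (k / 12) ^ 2))) ∂unifCube k ≤
        ∫ z, ((∑ m, z m) ^ 6 + 5 / 4 * (∑ m, z m) ^ 4 + 3 / 16 * (∑ m, z m) ^ 2 + 1 / 448)
          ∂unifCube k := by
      refine integral_mono (Continuous.integrable_unifCube (by fun_prop))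
        (Continuous.integrable_unifCube (by fun_prop)) fun z => ?_
      simp only
      nlinarith [sq_nonneg ((∑ m, z m) ^ 2 - (k : ℝ) / 12)]
    refine le_trans ?_ hlow
    rw [integral_add (Continuous.integrable_unifCube (by fun_prop))
      (Continuous.integrable_unifCube (by fun_prop)),
      integral_add (Continuous.integrable_unifCube (by fun_prop)) (integrable_const _),
      integral_const_mul, integral_unifCube_sum_sq]
    simp
    nlinarith [(Nat.cast_nonneg k : (0 : ℝ) ≤ k), sq_nonneg (k : ℝ)]

lemma continuous_abs_rpow {X : Type*} [TopologicalSpace X] {f : X → ℝ} (hf : Continuous f) {p : ℝ}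
    (hp : 0 ≤ p) : Continuous fun x => |f x| ^ p :=
  hf.abs.rpow_const fun _ => Or.inr hp

lemma rpow_integral_pow_le {k n : ℕ} (hn : Even n) (hn0 : n ≠ 0) {p : ℝ} (hp : n ≤ p) {c : ℝ}
    (hc : 0 ≤ c) (h : c ≤ ∫ z, (∑ m, z m) ^ n ∂unifCube k) :
    c ^ (p / n) ≤ ∫ z, |∑ m, z m| ^ p ∂unifCube k := by
  have hn' : (0 : ℝ) < n := by positivity
  have hr : 1 ≤ p / n := by rwa [le_div_iff₀ hn', one_mul]
  have hpow : ∀ x : ℝ, (x ^ n) ^ (p / n) = |x| ^ p := by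
    intro x
    rw [← hn.pow_abs, ← Real.rpow_natCast, ← Real.rpow_mul (abs_nonneg x),
      mul_div_cancel₀ _ hn'.ne']
  have hj := (convexOn_rpow hr).map_integral_le (μ := unifCube k)
    (f := fun z => (∑ m, z m) ^ n)
    (Real.continuous_rpow_const (by linarith)).continuousOn isClosed_Ici
    (Filter.Eventually.of_forall fun z => Set.mem_Ici.2 (hn.pow_nonneg _))
    (Continuous.integrable_unifCube (by fun_prop)) (by
      simp only [Function.comp_def, hpow]
      exact Continuous.integrable_unifCube (continuous_abs_rpow (by fun_prop) (by linarith)))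
  simp only [hpow] at hj
  exact (Real.rpow_le_rpow hc h (by linarith)).trans hj

lemma integral_unifCube_rademacherSum {k : ℕ} (ε : Fin k → Bool) {g : ℝ → ℝ}
    (hg : Continuous g) :
    ∫ z, g (rademacherSum z ε) ∂unifCube k = ∫ z, g (∑ m, z m) ∂unifCube k := by
  have hone : ∀ b : Bool, MeasurePreserving (fun x => boolSign b * x) unifIcc unifIcc := by
    rintro (_ | _)
    · have := (Measure.measurePreserving_neg (volume : Measure ℝ)).restrict_preimage
        (s := Set.Icc (-(1 / 2) : ℝ) (1 / 2)) measurableSet_Icc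
      simpa [unifIcc] using this
    · simpa [Function.id_def] using MeasurePreserving.id unifIcc
  have he : MeasurePreserving (fun (z : Fin k → ℝ) i => boolSign (ε i) * z i)
      (unifCube k) (unifCube k) :=
    measurePreserving_pi (fun _ => unifIcc) (fun _ => unifIcc) fun i => hone (ε i)
  have hcont : Continuous fun z : Fin k → ℝ => g (∑ m, z m) := by fun_prop
  have h := integral_map he.aemeasurable (f := fun z => g (∑ m, z m))
    hcont.aestronglyMeasurable
  rw [he.map_eq] at h
  exact h.symm

lemma signAvg_rpow_le {n : ℕ} {f : (Fin n → Bool) → ℝ} (hf : ∀ ε, 0 ≤ f ε) {p : ℝ}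
    (hp : 1 ≤ p) : signAvg f ^ p ≤ signAvg fun ε => f ε ^ p := by
  have := Real.rpow_arith_mean_le_arith_mean_rpow Finset.univ
    (fun _ : Fin n → Bool => (1 : ℝ) / 2 ^ n) f (fun _ _ => by positivity) (by simp)
    (fun ε _ => hf ε) hp
  simp only [one_div_mul_eq_div, ← Finset.sum_div] at this
  exact this

lemma le_signAvg_abs_rademacherSum_rpow {k : ℕ} (hk : 1 ≤ k) {p : ℝ} (hp : 1 ≤ p) (hp2 : p ≤ 2)
    (a : Fin k → ℝ) :
    (k / 2 : ℝ) ^ (p / 2) * ((1 / k) * ∑ m, |a m| ^ p) ≤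
      signAvg fun ε => |rademacherSum a ε| ^ p := by
  have hk0 : (0 : ℝ) < k := by exact_mod_cast hk
  have hmean : (1 / k) * ∑ m, |a m| ^ p ≤ ((1 / k) * ∑ m, a m ^ 2) ^ (p / 2) := by
    have h := Real.rpow_arith_mean_le_arith_mean_rpow Finset.univ
      (fun _ : Fin k => (1 : ℝ) / k) (fun m => |a m| ^ p) (fun _ _ => by positivity)
      (by simp; field_simp) (fun m _ => by positivity) (p := 2 / p)
      (by rw [le_div_iff₀ (by linarith)]; linarith)
    have hpow : ∀ m, (|a m| ^ p) ^ (2 / p) = a m ^ 2 := fun m => by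
      rw [← Real.rpow_mul (abs_nonneg _), mul_div_cancel₀ _ (by linarith)]
      norm_num
    simp only [hpow, ← Finset.mul_sum] at h
    have h0 : (0 : ℝ) ≤ (1 / k) * ∑ m, |a m| ^ p := by positivity
    have h' := Real.rpow_le_rpow (by positivity) h (by linarith : 0 ≤ p / 2)
    rwa [← Real.rpow_mul h0, div_mul_div_cancel₀ (by linarith : p ≠ 0), div_self two_ne_zero,
      Real.rpow_one] at h'
  have hA : 0 ≤ signAvg fun ε => |rademacherSum a ε| := by
    unfold signAvg; positivity
  have hkh := sum_sq_le_two_mul_signAvg_abs_sq a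
  calc (k / 2 : ℝ) ^ (p / 2) * ((1 / k) * ∑ m, |a m| ^ p)
      ≤ (k / 2 : ℝ) ^ (p / 2) * ((1 / k) * ∑ m, a m ^ 2) ^ (p / 2) := by gcongr
    _ = ((∑ m, a m ^ 2) / 2) ^ (p / 2) := by
        rw [← Real.mul_rpow (by positivity) (by positivity)]
        congr 1
        field_simp
    _ ≤ ((signAvg fun ε => |rademacherSum a ε|) ^ 2) ^ (p / 2) := by
        gcongr
        linarith
    _ = (signAvg fun ε => |rademacherSum a ε|) ^ p := by
        rw [← Real.rpow_natCast, ← Real.rpow_mul hA]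
        congr 1
        push_cast
        ring
    _ ≤ _ := signAvg_rpow_le (fun ε => abs_nonneg _) hp

lemma rpow_div_le_integral_of_le_two {k : ℕ} (hk : 1 ≤ k) {p : ℝ} (hp : 1 ≤ p) (hp2 : p ≤ 2) :
    (k / 2 : ℝ) ^ (p / 2) * (1 / (2 ^ p * (1 + p))) ≤ ∫ z, |∑ m, z m| ^ p ∂unifCube k := by
  have hk0 : (0 : ℝ) < k := by exact_mod_cast hk
  have hcont : ∀ f : (Fin k → ℝ) → ℝ, Continuous f →
      Integrable (fun z => |f z| ^ p) (unifCube k) := fun f hf =>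
    Continuous.integrable_unifCube (continuous_abs_rpow hf (by linarith))
  have hrad : ∀ ε : Fin k → Bool, Integrable (fun z => |rademacherSum z ε| ^ p) (unifCube k) :=
    fun ε => hcont _ (by unfold rademacherSum; fun_prop)
  have hcoord : ∀ m : Fin k, Integrable (fun z => |z m| ^ p) (unifCube k) :=
    fun m => hcont _ (by fun_prop)
  have hmono : ∫ z, (k / 2 : ℝ) ^ (p / 2) * ((1 / k) * ∑ m, |z m| ^ p) ∂unifCube k ≤
      ∫ z, (signAvg fun ε => |rademacherSum z ε| ^ p) ∂unifCube k := by
    refine integral_mono (((integrable_finsetSum _ fun m _ => hcoord m).const_mul _).const_mul _)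
      ((integrable_finsetSum _ fun ε _ => hrad ε).div_const _) fun z =>
        le_signAvg_abs_rademacherSum_rpow hk hp hp2 z
  have hright : ∫ z, (signAvg fun ε => |rademacherSum z ε| ^ p) ∂unifCube k =
      ∫ z, |∑ m, z m| ^ p ∂unifCube k := by
    simp only [signAvg]
    rw [integral_div, integral_finsetSum _ fun ε _ => hrad ε]
    simp only [integral_unifCube_rademacherSum _ (g := fun x => |x| ^ p)
      (continuous_abs_rpow continuous_id (by linarith))]
    simp
  have hleft : ∀ m : Fin k, ∫ z, |z m| ^ p ∂unifCube k = 1 / (2 ^ p * (1 + p)) := fun m => by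
    rw [← integral_unifIcc_abs_rpow hp]
    exact integral_comp_eval (μ := fun _ : Fin k => unifIcc) (f := fun x => |x| ^ p)
      (continuous_abs_rpow continuous_id (by linarith)).aestronglyMeasurable
  rw [hright, integral_const_mul, integral_const_mul, integral_finsetSum _ fun m _ => hcoord m]
    at hmono
  simp only [hleft, Finset.sum_const, Finset.card_univ, Fintype.card_fin, nsmul_eq_mul] at hmono
  rwa [← mul_assoc (1 / (k : ℝ)), one_div_mul_cancel hk0.ne', one_mul] at hmono

lemma three_halves_rpow_le {p : ℝ} (hp : 0 ≤ p) (hp6 : p ≤ 6) :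
    (3 / 2 : ℝ) ^ (p / 2) ≤ 1 + p := by
  have h := rpow_one_add_le_one_add_mul_self (s := 19 / 8) (by norm_num) (p := p / 6)
    (by linarith) (by linarith)
  have h27 : (1 + 19 / 8 : ℝ) = (3 / 2) ^ (3 : ℝ) := by norm_num
  rw [h27, ← Real.rpow_mul (by norm_num), show 3 * (p / 6) = p / 2 by ring] at h
  linarith

end Cube

/-- **Paper Lemma 4.6**: for `1 ≤ p < ∞` and `k ≥ 1`,
`∫_{[-1/2,1/2]^k} |z₁ + ⋯ + z_k|^p dλ^k(z) ≥ k^{p/2} / ((2√2)^p (1+p))`. -/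
theorem stmt13 (p : ℝ) (hp : 1 ≤ p) (k : ℕ) (hk : 1 ≤ k) :
    (k : ℝ) ^ (p / 2) / ((2 * Real.sqrt 2) ^ p * (1 + p)) ≤
      ∫ z in {z : Fin k → ℝ | ∀ m, z m ∈ Set.Icc (-(1 / 2) : ℝ) (1 / 2)},
        |∑ m, z m| ^ p := by
  have hk0 : (0 : ℝ) < k := by exact_mod_cast hk
  rw [← unifCube_eq_restrict]
  have hsqrt : (2 * Real.sqrt 2) ^ p = (8 : ℝ) ^ (p / 2) := by
    have h8 : (8 : ℝ) = (2 * Real.sqrt 2) ^ (2 : ℝ) := by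
      rw [Real.rpow_two, mul_pow, Real.sq_sqrt (by norm_num)]
      norm_num
    rw [h8, ← Real.rpow_mul (by positivity), mul_div_cancel₀ _ two_ne_zero]
  rw [hsqrt]
  rcases le_total p 2 with hp2 | hp2
  · refine le_trans (le_of_eq ?_) (rpow_div_le_integral_of_le_two hk hp hp2)
    have h8 : (8 : ℝ) ^ (p / 2) = 2 ^ (p / 2) * 2 ^ p := by
      rw [show (8 : ℝ) = 2 ^ (3 : ℝ) by norm_num, ← Real.rpow_mul (by norm_num),
        ← Real.rpow_add (by norm_num)]
      congr 1
      ring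
    rw [h8, Real.div_rpow hk0.le (by norm_num)]
    field_simp
  rcases le_total p 6 with hp6 | hp6
  · have h := rpow_integral_pow_le (k := k) even_two two_ne_zero (p := p) (by exact_mod_cast hp2)
      (by positivity) (integral_unifCube_sum_sq k).ge
    refine le_trans ?_ h
    have h12 : (12 : ℝ) ^ (p / 2) = 8 ^ (p / 2) * (3 / 2) ^ (p / 2) := by
      rw [← Real.mul_rpow (by norm_num) (by norm_num)]
      norm_num
    rw [Nat.cast_ofNat, Real.div_rpow hk0.le (by norm_num), h12]
    gcongr
    exact three_halves_rpow_le (by linarith) hp6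
  · have h := rpow_integral_pow_le (k := k) (n := 6) (by decide) (by norm_num) (p := p)
      (by exact_mod_cast hp6) (by positivity) (le_integral_unifCube_sum_pow_six k)
    refine le_trans ?_ h
    calc (k : ℝ) ^ (p / 2) / (8 ^ (p / 2) * (1 + p)) ≤ (k : ℝ) ^ (p / 2) / 8 ^ (p / 2) := by
          gcongr
          exact le_mul_of_one_le_right (by positivity) (by linarith)
      _ = ((k : ℝ) ^ 3 / 512) ^ (p / 6) := by
          rw [← Real.div_rpow hk0.le (by norm_num),
            show (k : ℝ) ^ 3 / 512 = (k / 8 : ℝ) ^ (3 : ℝ) by norm_num; ring,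
            ← Real.rpow_mul (by positivity)]
          congr 1
          ring
      _ ≤ ((k : ℝ) ^ 3 / 448) ^ (p / (6 : ℕ)) := by
          push_cast
          gcongr
          norm_num
end

section
/- Let λ = (λ_m)_{m≥1} be a non-increasing sequence of nonnegative reals with λ₂ > 0. For each d ≥ 2 fix a nonempty subset I_d = {i₁ < … < i_{#I_d}} ⊆ {1,…,d} and let ∇_d = { k ∈ (ℕ_{≥1})^d : k_{i₁} ≤ k_{i₂} ≤ … ≤ k_{i_{#I_d}} }, with ∇₁ = ℕ_{≥1}; define n(ε,d) = #{ k ∈ ∇_d : Π_{l=1}^d λ_{k_l} > ε² }. Consider the absolute error criterion. Then the symmetric problem is strongly polynomially tractable (∃ C,p>0 ∀d≥1 ∀ε∈(0,1]: n(ε,d) ≤ C·ε^{−p}) if and only if Σ_{m=1}^∞ λ_m^τ < ∞ for some τ ∈ (0,∞) and, in addition, either λ₁ < 1, or λ₁ = 1 > λ₂ and sup_{d} (d − #I_d) < ∞. Moreover, if λ₁ ≤ 1, the problem is polynomially tractable (∃ C,p>0, q≥0 ∀d,ε∈(0,1]: n(ε,d) ≤ C·ε^{−p}·d^q) if and only if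 Σ_{m=1}^∞ λ_m^τ < ∞ for some τ ∈ (0,∞) and, in addition, either λ₁ < 1, or λ₁ = 1 and there is a constant K with d − #I_d ≤ K·ln d for all d ≥ 2. -/
open scoped ENNReal

/-- The index set `∇_d` for the `I_d`-symmetric problem: multi-indices
`k ∈ (ℕ_{≥1})^d` non-decreasing along the ordered coordinates of `I d`. -/
def nablaSym (I : (d : ℕ) → Finset (Fin d)) (d : ℕ) : Set (Fin d → ℕ) :=
  {k | (∀ l, 1 ≤ k l) ∧ ∀ a ∈ I d, ∀ b ∈ I d, a ≤ b → k a ≤ k b}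

/-- The information complexity (absolute error criterion) of the `I_d`-symmetric
problem: `n(ε,d) = #{k ∈ ∇_d : ∏_l λ_{k_l} > ε²}`. -/
noncomputable def nSym (lam : ℕ → ℝ) (I : (d : ℕ) → Finset (Fin d)) (ε : ℝ) (d : ℕ) :
    ℕ∞ :=
  ({k | k ∈ nablaSym I d ∧ ε ^ 2 < ∏ l, lam (k l)} : Set (Fin d → ℕ)).encard

/-- Strong polynomial tractability of the symmetric problem. -/
def SPTSym (lam : ℕ → ℝ) (I : (d : ℕ) → Finset (Fin d)) : Prop :=
  ∃ C > (0 : ℝ), ∃ p > (0 : ℝ), ∀ d : ℕ, 1 ≤ d → ∀ ε : ℝ, 0 < ε → ε ≤ 1 →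
    (nSym lam I ε d : ℝ≥0∞) ≤ ENNReal.ofReal (C * ε ^ (-p))

/-- Polynomial tractability of the symmetric problem. -/
def PTSym (lam : ℕ → ℝ) (I : (d : ℕ) → Finset (Fin d)) : Prop :=
  ∃ C > (0 : ℝ), ∃ p > (0 : ℝ), ∃ q : ℝ, 0 ≤ q ∧
    ∀ d : ℕ, 1 ≤ d → ∀ ε : ℝ, 0 < ε → ε ≤ 1 →
      (nSym lam I ε d : ℝ≥0∞) ≤ ENNReal.ofReal (C * ε ^ (-p) * (d : ℝ) ^ q)

/-- The sum of `∏ l, μ (k l)` over the index set of the symmetric problem. -/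
noncomputable def symSum (μ : ℕ → ℝ≥0∞) (I : (d : ℕ) → Finset (Fin d)) (d : ℕ) : ℝ≥0∞ :=
  ∑' k : nablaSym I d, ∏ l, μ ((k : Fin d → ℕ) l)

/-- The sum of `∏ i, μ (k i)` over non-decreasing `k` of length `a` with values at least `m`. -/
noncomputable def monoSum (μ : ℕ → ℝ≥0∞) (m a : ℕ) : ℝ≥0∞ :=
  ∑' k : {k : Fin a → ℕ | Monotone k ∧ ∀ i, m ≤ k i}, ∏ i, μ ((k : Fin a → ℕ) i)

theorem tsum_pi_prod_eq_pow (ν : ℕ → ℝ≥0∞) (a : ℕ) :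
    ∑' k : Fin a → ℕ, ∏ i, ν (k i) = (∑' j, ν j) ^ a := by
  induction a with
  | zero => simp
  | succ a ih =>
    rw [← (Fin.consEquiv (fun _ : Fin (a + 1) => ℕ)).tsum_eq]
    simp only [Fin.consEquiv, Equiv.coe_fn_mk, Fin.prod_univ_succ, Fin.cons_zero, Fin.cons_succ]
    rw [ENNReal.tsum_prod (f := fun x (y : Fin a → ℕ) => ν x * ∏ i, ν (y i))]
    simp_rw [ENNReal.tsum_mul_left, ih, ENNReal.tsum_mul_right]
    rw [pow_succ']

theorem tsum_le_tail_pow (μ : ℕ → ℝ≥0∞) (m a : ℕ) (s : Set (Fin a → ℕ))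
    (hs : ∀ k ∈ s, ∀ i, m ≤ k i) :
    ∑' k : s, ∏ i, μ ((k : Fin a → ℕ) i) ≤ (∑' j, μ (m + j)) ^ a := by
  rw [← tsum_pi_prod_eq_pow (fun j => μ (m + j))]
  have hinj : Function.Injective (fun (k : s) (i : Fin a) => (k : Fin a → ℕ) i - m) := by
    rintro ⟨k, hk⟩ ⟨k', hk'⟩ h
    ext i
    have h1 := congrFun h i
    have h2 := hs k hk i
    have h3 := hs k' hk' i
    simp only at h1 ⊢
    omega
  refine le_trans (le_of_eq ?_)
    (ENNReal.tsum_comp_le_tsum_of_injective hinj (fun k => ∏ i, μ (m + k i)))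
  refine tsum_congr fun k => Finset.prod_congr rfl fun i _ => ?_
  rw [Nat.add_sub_cancel' (hs k k.2 i)]

theorem monoSum_le_tail_pow (μ : ℕ → ℝ≥0∞) (m a : ℕ) :
    monoSum μ m a ≤ (∑' j, μ (m + j)) ^ a :=
  tsum_le_tail_pow μ m a _ fun _ hk => hk.2

theorem monoSum_succ_le (μ : ℕ → ℝ≥0∞) (m a : ℕ) (hμ : μ m ≤ 1) :
    monoSum μ m (a + 1) ≤ monoSum μ m a + monoSum μ (m + 1) (a + 1) := by
  set A : Set (Fin a → ℕ) := {k | Monotone k ∧ ∀ i, m ≤ k i} with hA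
  have hsub : {k : Fin (a + 1) → ℕ | Monotone k ∧ ∀ i, m ≤ k i} ⊆
      ((fun k : Fin a → ℕ => (Fin.cons m k : Fin (a + 1) → ℕ)) '' A) ∪
        {k : Fin (a + 1) → ℕ | Monotone k ∧ ∀ i, m + 1 ≤ k i} := by
    rintro k ⟨hk, hm⟩
    by_cases h0 : k 0 = m
    · refine Or.inl ⟨Fin.tail k, ⟨fun i j hij => hk (Fin.succ_le_succ_iff.2 hij),
        fun i => hm i.succ⟩, ?_⟩
      simp only [← h0, Fin.cons_self_tail]
    · refine Or.inr ⟨hk, fun i => ?_⟩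
      have h1 := hk (Fin.zero_le i)
      have h2 := hm 0
      omega
  refine (ENNReal.tsum_mono_subtype (fun k : Fin (a + 1) → ℕ => ∏ i, μ (k i)) hsub).trans ?_
  refine (ENNReal.tsum_union_le (fun k : Fin (a + 1) → ℕ => ∏ i, μ (k i)) _ _).trans ?_
  refine add_le_add ?_ le_rfl
  rw [tsum_image (fun k : Fin (a + 1) → ℕ => ∏ i, μ (k i))
    (Fin.cons_right_injective (α := fun _ => ℕ) m).injOn]
  refine ENNReal.tsum_le_tsum fun k => ?_
  rw [Fin.prod_univ_succ]
  simp only [Fin.cons_zero, Fin.cons_succ]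
  exact mul_le_of_le_one_left zero_le hμ

theorem monoSum_le_sum (μ : ℕ → ℝ≥0∞) (m a : ℕ) (hμ : μ m ≤ 1) :
    monoSum μ m a ≤ ∑ i ∈ Finset.range (a + 1), monoSum μ (m + 1) i := by
  induction a with
  | zero => simp [monoSum, Monotone]
  | succ a ih =>
    rw [Finset.sum_range_succ]
    exact (monoSum_succ_le μ m a hμ).trans (add_le_add ih le_rfl)

theorem monoSum_le_pow (μ : ℕ → ℝ≥0∞) (M : ℕ) :
    ∀ m : ℕ, (∀ j < M, μ (m + j) ≤ 1) → ∑' j, μ (m + M + j) ≤ 1 →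
      ∀ a : ℕ, monoSum μ m a ≤ ((a : ℝ≥0∞) + 1) ^ M := by
  induction M with
  | zero =>
    intro m _ h a
    rw [pow_zero]
    exact (monoSum_le_tail_pow μ m a).trans (pow_le_one₀ zero_le h)
  | succ M ih =>
    intro m h1 h2 a
    have h3 := ih (m + 1) (fun j hj => by
      have := h1 (j + 1) (by omega)
      rwa [show m + (j + 1) = m + 1 + j by ring] at this)
      (by rwa [show m + (M + 1) = m + 1 + M by ring] at h2)
    calc monoSum μ m a ≤ ∑ i ∈ Finset.range (a + 1), monoSum μ (m + 1) i :=
          monoSum_le_sum μ m a (h1 0 (by omega))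
      _ ≤ ∑ _i ∈ Finset.range (a + 1), ((a : ℝ≥0∞) + 1) ^ M := by
          refine Finset.sum_le_sum fun i hi => (h3 i).trans ?_
          have : i ≤ a := by simpa [Nat.lt_succ_iff] using hi
          gcongr
      _ = ((a : ℝ≥0∞) + 1) ^ (M + 1) := by
          rw [Finset.sum_const, Finset.card_range, nsmul_eq_mul, pow_succ']
          push_cast
          rfl

theorem monoSum_le_two (μ : ℕ → ℝ≥0∞) (m a : ℕ) (h1 : μ m ≤ 1)
    (h2 : ∑' j, μ (m + 1 + j) ≤ 2⁻¹) : monoSum μ m a ≤ 2 := by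
  calc monoSum μ m a ≤ ∑ i ∈ Finset.range (a + 1), monoSum μ (m + 1) i :=
        monoSum_le_sum μ m a h1
    _ ≤ ∑ i ∈ Finset.range (a + 1), (2⁻¹ : ℝ≥0∞) ^ i := by
        refine Finset.sum_le_sum fun i _ => (monoSum_le_tail_pow μ (m + 1) i).trans ?_
        gcongr
    _ ≤ ∑' i, (2⁻¹ : ℝ≥0∞) ^ i := ENNReal.sum_le_tsum _
    _ = 2 := by rw [ENNReal.tsum_geometric, ENNReal.one_sub_inv_two, inv_inv]

theorem symSum_le_mul (μ : ℕ → ℝ≥0∞) (I : (d : ℕ) → Finset (Fin d)) (d : ℕ) :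
    symSum μ I d ≤ (∑' j, μ (1 + j)) ^ (d - (I d).card) * monoSum μ 1 (I d).card := by
  have hc : (I d)ᶜ.card = d - (I d).card := by simp [Finset.card_compl]
  set e := (I d).orderEmbOfFin rfl with he
  set f := (I d)ᶜ.orderEmbOfFin hc with hf
  set A : Set (Fin (d - (I d).card) → ℕ) := {k | ∀ i, 1 ≤ k i} with hA
  set B : Set (Fin (I d).card → ℕ) := {k | Monotone k ∧ ∀ i, 1 ≤ k i} with hB
  have heI : ∀ i, e i ∈ I d := fun i => Finset.orderEmbOfFin_mem _ _ i
  let g : nablaSym I d → A × B := fun k =>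
    (⟨fun i => k.1 (f i), fun i => k.2.1 _⟩,
      ⟨fun i => k.1 (e i), fun i j hij => k.2.2 _ (heI i) _ (heI j) (e.monotone hij),
        fun i => k.2.1 _⟩)
  have hinj : Function.Injective g := by
    intro k k' h
    ext l
    by_cases hl : l ∈ I d
    · have : l ∈ Set.range e := by rw [he, Finset.range_orderEmbOfFin]; exact hl
      obtain ⟨i, rfl⟩ := this
      exact congrFun (congrArg (fun p => (p.2 : Fin (I d).card → ℕ)) h) i
    · have : l ∈ Set.range f := by
        rw [hf, Finset.range_orderEmbOfFin]; simpa using hl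
      obtain ⟨i, rfl⟩ := this
      exact congrFun (congrArg (fun p => (p.1 : Fin (d - (I d).card) → ℕ)) h) i
  have hprod : ∀ k : nablaSym I d, ∏ l, μ ((k : Fin d → ℕ) l) =
      (∏ i, μ ((g k).1.1 i)) * ∏ i, μ ((g k).2.1 i) := by
    intro k
    have h1 : ∏ i, μ ((g k).1.1 i) = ∏ l ∈ (I d)ᶜ, μ ((k : Fin d → ℕ) l) := by
      conv_rhs => rw [← Finset.map_orderEmbOfFin_univ _ hc, Finset.prod_map]
      rfl
    have h2 : ∏ i, μ ((g k).2.1 i) = ∏ l ∈ I d, μ ((k : Fin d → ℕ) l) := by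
      conv_rhs => rw [← Finset.map_orderEmbOfFin_univ (I d) rfl, Finset.prod_map]
      rfl
    rw [h1, h2, Finset.prod_compl_mul_prod]
  calc symSum μ I d
      = ∑' k, (fun p : A × B => (∏ i, μ (p.1.1 i)) * ∏ i, μ (p.2.1 i)) (g k) :=
        tsum_congr hprod
    _ ≤ ∑' p : A × B, (∏ i, μ (p.1.1 i)) * ∏ i, μ (p.2.1 i) :=
        ENNReal.tsum_comp_le_tsum_of_injective hinj _
    _ = (∑' k : A, ∏ i, μ (k.1 i)) * ∑' k : B, ∏ i, μ (k.1 i) := by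
        rw [ENNReal.tsum_prod (f := fun (x : A) (y : B) =>
          (∏ i, μ (x.1 i)) * ∏ i, μ (y.1 i))]
        simp_rw [ENNReal.tsum_mul_left, ENNReal.tsum_mul_right]
    _ ≤ _ := mul_le_mul' (tsum_le_tail_pow μ 1 _ A fun k hk => hk) le_rfl

theorem one_add_pow_le_symSum (μ : ℕ → ℝ≥0∞) (hμ : μ 1 = 1)
    (I : (d : ℕ) → Finset (Fin d)) (d : ℕ) :
    (1 + μ 2) ^ (d - (I d).card) ≤ symSum μ I d := by
  have hc : (I d)ᶜ.card = d - (I d).card := by simp [Finset.card_compl]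
  let g : ((I d)ᶜ.powerset : Finset (Finset (Fin d))) → nablaSym I d := fun T =>
    ⟨fun l => if l ∈ T.1 then 2 else 1, fun l => by dsimp only; split_ifs <;> simp, by
      intro a ha b hb _
      have hT := Finset.mem_powerset.1 T.2
      have h1 : a ∉ T.1 := fun h => Finset.mem_compl.1 (hT h) ha
      simp only [h1, if_false]
      split_ifs <;> simp⟩
  have hinj : Function.Injective g := by
    intro T T' h
    ext l
    have := congrFun (congrArg Subtype.val h) l
    simp only [g] at this
    by_cases h1 : l ∈ T.1 <;> by_cases h2 : l ∈ T'.1 <;> simp_all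
  refine le_trans (le_of_eq ?_) (ENNReal.tsum_comp_le_tsum_of_injective hinj
    (fun k : nablaSym I d => ∏ l, μ ((k : Fin d → ℕ) l)))
  have hval : ∀ T, ∏ l, μ ((g T : Fin d → ℕ) l) = μ 2 ^ T.1.card := by
    intro T
    simp only [g, apply_ite μ, hμ]
    rw [Finset.prod_ite_mem, Finset.univ_inter, Finset.prod_const]
  simp_rw [hval]
  rw [Finset.tsum_subtype _ (fun T : Finset (Fin d) => μ 2 ^ T.card), ← hc, add_comm 1,
    ← Finset.sum_pow_mul_eq_add_pow]
  simp

theorem tsum_le_symSum_one (μ : ℕ → ℝ≥0∞) (I : (d : ℕ) → Finset (Fin d)) :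
    ∑' j, μ (1 + j) ≤ symSum μ I 1 := by
  let g : ℕ → nablaSym I 1 := fun j => ⟨fun _ => 1 + j, fun _ => by simp, fun _ _ _ _ _ => le_rfl⟩
  have hinj : Function.Injective g := by
    intro j j' h
    have := congrFun (congrArg Subtype.val h) 0
    simpa [g] using this
  refine le_trans (le_of_eq ?_) (ENNReal.tsum_comp_le_tsum_of_injective hinj
    (fun k : nablaSym I 1 => ∏ l, μ ((k : Fin 1 → ℕ) l)))
  simp [g]

theorem prod_ofReal_rpow_eq (lam : ℕ → ℝ) (hnn : ∀ m, 0 ≤ lam m) {τ : ℝ} (hτ : 0 < τ) {d : ℕ}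
    (k : Fin d → ℕ) :
    ∏ l, ENNReal.ofReal (lam (k l)) ^ τ = ENNReal.ofReal (∏ l, lam (k l)) ^ τ := by
  rw [ENNReal.prod_rpow_of_nonneg hτ.le, ENNReal.ofReal_prod_of_nonneg fun i _ => hnn _]

theorem nSym_mul_le_symSum (lam : ℕ → ℝ) (hnn : ∀ m, 0 ≤ lam m) (I : (d : ℕ) → Finset (Fin d))
    {τ : ℝ} (hτ : 0 < τ) (ε : ℝ) (d : ℕ) :
    (nSym lam I ε d : ℝ≥0∞) * ENNReal.ofReal (ε ^ 2) ^ τ ≤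
      symSum (fun m => ENNReal.ofReal (lam m) ^ τ) I d := by
  rw [nSym, ← ENNReal.tsum_set_const]
  refine le_trans ?_ (ENNReal.tsum_mono_subtype
    (fun k : Fin d → ℕ => ∏ l, ENNReal.ofReal (lam (k l)) ^ τ)
    (s := {k | k ∈ nablaSym I d ∧ ε ^ 2 < ∏ l, lam (k l)}) fun k hk => hk.1)
  refine ENNReal.tsum_le_tsum fun k => ?_
  rw [prod_ofReal_rpow_eq lam hnn hτ]
  exact ENNReal.rpow_le_rpow (ENNReal.ofReal_le_ofReal k.2.2.le) hτ.le

theorem nSym_le_of_symSum_le (lam : ℕ → ℝ) (hnn : ∀ m, 0 ≤ lam m)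
    (I : (d : ℕ) → Finset (Fin d)) {τ : ℝ} (hτ : 0 < τ) {ε : ℝ} (hε : 0 < ε) (d : ℕ) {B : ℝ}
    (h : symSum (fun m => ENNReal.ofReal (lam m) ^ τ) I d ≤ ENNReal.ofReal B) :
    (nSym lam I ε d : ℝ≥0∞) ≤ ENNReal.ofReal (B * ε ^ (-(2 * τ))) := by
  have h1 := (nSym_mul_le_symSum lam hnn I hτ ε d).trans h
  have hpos : 0 < (ε ^ 2) ^ τ := by positivity
  rw [ENNReal.ofReal_rpow_of_nonneg (by positivity) hτ.le,
    ← ENNReal.le_div_iff_mul_le (Or.inl (ENNReal.ofReal_pos.2 hpos).ne')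
      (Or.inl ENNReal.ofReal_ne_top), ← ENNReal.ofReal_div_of_pos hpos] at h1
  convert h1 using 2
  rw [div_eq_mul_inv, Real.rpow_neg hε.le, Real.rpow_mul hε.le, Real.rpow_two]

/-- The constant relating polynomial bounds on the complexity to bounds on `symSum`. -/
noncomputable def dyadicConst (p : ℝ) : ℝ≥0∞ :=
  ENNReal.ofReal (2 ^ p) * ∑' j : ℕ, ENNReal.ofReal (2 ^ (-p)) ^ j

theorem dyadicConst_ne_top {p : ℝ} (hp : 0 < p) : dyadicConst p ≠ ⊤ := by
  refine ENNReal.mul_ne_top ENNReal.ofReal_ne_top ?_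
  rw [ENNReal.tsum_geometric]
  refine ENNReal.inv_ne_top.2 (tsub_pos_of_lt ?_).ne'
  rw [ENNReal.ofReal_lt_one]
  exact Real.rpow_lt_one_of_one_lt_of_neg (by norm_num) (by linarith)

theorem tsum_nablaSym_ite (lam : ℕ → ℝ) (I : (d : ℕ) → Finset (Fin d)) (ε : ℝ) (d : ℕ) :
    ∑' k : nablaSym I d, {k : Fin d → ℕ | ε ^ 2 < ∏ l, lam (k l)}.indicator
      (fun _ => (1 : ℝ≥0∞)) (k : Fin d → ℕ) = nSym lam I ε d := by
  rw [tsum_subtype (nablaSym I d) ({k : Fin d → ℕ | ε ^ 2 < ∏ l, lam (k l)}.indicator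
      (fun _ => (1 : ℝ≥0∞))), Set.indicator_indicator, ← tsum_subtype, ENNReal.tsum_set_one]
  rfl

theorem symSum_le_of_nSym_le (lam : ℕ → ℝ) (hnn : ∀ m, 0 ≤ lam m)
    (hle : ∀ m, 1 ≤ m → lam m ≤ 1) (I : (d : ℕ) → Finset (Fin d)) {p : ℝ} (hp : 0 < p) (d : ℕ)
    (M : ℝ≥0∞)
    (h : ∀ ε : ℝ, 0 < ε → ε ≤ 1 → (nSym lam I ε d : ℝ≥0∞) ≤ M * ENNReal.ofReal (ε ^ (-p))) :
    symSum (fun m => ENNReal.ofReal (lam m) ^ p) I d ≤ M * dyadicConst p := by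
  have hpt : ∀ k : nablaSym I d, ∏ l, ENNReal.ofReal (lam ((k : Fin d → ℕ) l)) ^ p ≤
      ∑' j : ℕ, ENNReal.ofReal ((1 / 4) ^ j) ^ p *
        {k : Fin d → ℕ | ((1 / 2 : ℝ) ^ (j + 1)) ^ 2 < ∏ l, lam (k l)}.indicator
          (fun _ => (1 : ℝ≥0∞)) (k : Fin d → ℕ) := by
    intro k
    rw [prod_ofReal_rpow_eq lam hnn hp]
    have h0 : 0 ≤ ∏ l, lam ((k : Fin d → ℕ) l) := Finset.prod_nonneg fun _ _ => hnn _
    rcases h0.eq_or_lt with h0 | h0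
    · rw [← h0, ENNReal.ofReal_zero, ENNReal.zero_rpow_of_pos hp]
      exact zero_le
    · have h1 : ∏ l, lam ((k : Fin d → ℕ) l) ≤ 1 :=
        Finset.prod_le_one (fun _ _ => hnn _) fun l _ => hle _ (k.2.1 l)
      obtain ⟨j, hj1, hj2⟩ := exists_nat_pow_near_of_lt_one h0 h1
        (show (0 : ℝ) < 1 / 4 by norm_num) (by norm_num)
      refine le_trans ?_ (ENNReal.le_tsum j)
      have hmem : (k : Fin d → ℕ) ∈
          {k : Fin d → ℕ | ((1 / 2 : ℝ) ^ (j + 1)) ^ 2 < ∏ l, lam (k l)} := by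
        have h2 : ((1 / 2 : ℝ) ^ (j + 1)) ^ 2 = (1 / 4) ^ (j + 1) := by
          rw [← pow_mul, mul_comm, pow_mul, show (1 / 2 : ℝ) ^ 2 = 1 / 4 by norm_num]
        exact h2.trans_lt hj1
      rw [Set.indicator_of_mem hmem, mul_one]
      exact ENNReal.rpow_le_rpow (ENNReal.ofReal_le_ofReal hj2) hp.le
  refine (ENNReal.tsum_le_tsum hpt).trans ?_
  rw [ENNReal.tsum_comm]
  simp_rw [ENNReal.tsum_mul_left, tsum_nablaSym_ite]
  rw [dyadicConst, ← ENNReal.tsum_mul_left, ← ENNReal.tsum_mul_left]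
  refine ENNReal.tsum_le_tsum fun j => ?_
  refine (mul_le_mul_right (h ((1 / 2) ^ (j + 1)) (by positivity)
    (pow_le_one₀ (by norm_num) (by norm_num))) _).trans (le_of_eq ?_)
  rw [mul_left_comm, ENNReal.ofReal_rpow_of_nonneg (by positivity) hp.le,
    ← ENNReal.ofReal_mul (by positivity), ← ENNReal.ofReal_pow (by positivity),
    ← ENNReal.ofReal_mul (by positivity)]
  congr 2
  have e1 : (1 / 2 : ℝ) ^ (j + 1) = 2 ^ (-(j + 1 : ℝ)) := by
    rw [Real.rpow_neg (by norm_num), ← Nat.cast_add_one, Real.rpow_natCast]; simp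
  have e2 : (1 / 4 : ℝ) ^ j = 2 ^ (-(2 * j : ℝ)) := by
    rw [Real.rpow_neg (by norm_num), Real.rpow_mul (by norm_num), Real.rpow_natCast,
      show (2 : ℝ) ^ (2 : ℝ) = 4 by norm_num]
    simp
  rw [e1, e2, ← Real.rpow_natCast, ← Real.rpow_mul (by norm_num), ← Real.rpow_mul (by norm_num),
    ← Real.rpow_mul (by norm_num), ← Real.rpow_add (by norm_num), ← Real.rpow_add (by norm_num)]
  congr 1
  ring

theorem tsum_ofReal_rpow_ne_top_iff (lam : ℕ → ℝ) (hnn : ∀ m, 0 ≤ lam m) {τ : ℝ} (hτ : 0 < τ) :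
    ∑' j, ENNReal.ofReal (lam (1 + j)) ^ τ ≠ ⊤ ↔ Summable (fun m : ℕ => lam (m + 1) ^ τ) := by
  have h : ∀ j, ENNReal.ofReal (lam (1 + j)) ^ τ = ENNReal.ofReal (lam (j + 1) ^ τ) := fun j => by
    rw [ENNReal.ofReal_rpow_of_nonneg (hnn _) hτ.le, add_comm]
  simp_rw [h]
  refine ⟨fun hs => ?_, fun hs => hs.tsum_ofReal_ne_top⟩
  refine (ENNReal.summable_toReal hs).congr fun j => ?_
  rw [ENNReal.toReal_ofReal (Real.rpow_nonneg (hnn _) _)]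

theorem exists_tail_le_half (lam : ℕ → ℝ) (hnn : ∀ m, 0 ≤ lam m)
    (hord : ∀ m m' : ℕ, 1 ≤ m → m ≤ m' → lam m' ≤ lam m)
    (hsum : ∃ τ : ℝ, 0 < τ ∧ Summable (fun m : ℕ => lam (m + 1) ^ τ))
    (M : ℕ) (hM : lam (1 + M) < 1) :
    ∃ τ : ℝ, 0 < τ ∧ ∑' j, ENNReal.ofReal (lam (1 + M + j)) ^ τ ≤ 2⁻¹ := by
  obtain ⟨τ, hτ, hs⟩ := hsum
  have hT := (tsum_ofReal_rpow_ne_top_iff lam hnn hτ).2 hs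
  set T := ∑' j, ENNReal.ofReal (lam (1 + j)) ^ τ with hTdef
  have hr : ENNReal.ofReal (lam (1 + M)) < 1 := ENNReal.ofReal_lt_one.2 hM
  have hlim : Filter.Tendsto (fun n => ENNReal.ofReal (lam (1 + M)) ^ n * T) Filter.atTop
      (nhds (0 * T)) :=
    ENNReal.Tendsto.mul_const (ENNReal.tendsto_pow_atTop_nhds_zero_of_lt_one hr) (Or.inr hT)
  rw [zero_mul] at hlim
  obtain ⟨n, hn⟩ := (hlim.eventually (gt_mem_nhds (show (0 : ℝ≥0∞) < 2⁻¹ by simp))).exists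
  refine ⟨n + τ, by positivity, le_trans ?_ hn.le⟩
  calc ∑' j, ENNReal.ofReal (lam (1 + M + j)) ^ (n + τ : ℝ)
      ≤ ∑' j, ENNReal.ofReal (lam (1 + M)) ^ n * ENNReal.ofReal (lam (1 + M + j)) ^ τ := by
        refine ENNReal.tsum_le_tsum fun j => ?_
        rw [ENNReal.rpow_add_of_nonneg _ _ (by positivity) hτ.le, ENNReal.rpow_natCast]
        gcongr
        exact hord _ _ (by omega) (by omega)
    _ = ENNReal.ofReal (lam (1 + M)) ^ n * ∑' j, ENNReal.ofReal (lam (1 + (M + j))) ^ τ := by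
        rw [ENNReal.tsum_mul_left]
        simp_rw [add_assoc]
    _ ≤ _ := by
        gcongr
        exact ENNReal.tsum_comp_le_tsum_of_injective (f := fun j => M + j)
          (add_right_injective M) (fun j => ENNReal.ofReal (lam (1 + j)) ^ τ)

theorem natCast_le_nSym (lam : ℕ → ℝ) (I : (d : ℕ) → Finset (Fin d)) (ε : ℝ) (d J : ℕ)
    (hJ : J ≤ d) (h : ∀ j < J, ε ^ 2 < lam 1 ^ (d - j) * lam 2 ^ j) :
    (J : ℕ∞) ≤ nSym lam I ε d := by
  let g : ℕ → Fin d → ℕ := fun j l => if (l : ℕ) < d - j then 1 else 2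
  have hprod : ∀ j < J, ∏ l, lam (g j l) = lam 1 ^ (d - j) * lam 2 ^ j := by
    intro j hj
    rw [Fin.prod_univ_eq_prod_range (fun i => lam (if i < d - j then 1 else 2)) d,
      ← Finset.prod_range_mul_prod_Ico _ (Nat.sub_le d j)]
    congr 1
    · rw [Finset.prod_congr rfl (g := fun _ => lam 1) fun i hi => by
        rw [if_pos (Finset.mem_range.1 hi)]]
      simp
    · rw [Finset.prod_congr rfl (g := fun _ => lam 2) fun i hi => by
        rw [if_neg (Finset.mem_Ico.1 hi).1.not_gt]]
      rw [Finset.prod_const, Nat.card_Ico, Nat.sub_sub_self (by omega)]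
  have hcard : ((Finset.range J : Finset ℕ) : Set ℕ).encard = J := by
    rw [Set.encard_coe_eq_coe_finsetCard, Finset.card_range]
  rw [← hcard]
  refine Set.encard_le_encard_of_injOn (f := g) ?_ ?_
  · intro j hj
    have hj : j < J := by simpa using hj
    refine ⟨⟨fun l => by dsimp only [g]; split_ifs <;> simp, fun a _ b _ hab => ?_⟩, ?_⟩
    · have : (a : ℕ) ≤ b := hab
      dsimp only [g]
      split_ifs <;> omega
    · rw [hprod j hj]
      exact h j hj
  · have aux : ∀ j j', j < j' → j' < J → g j ≠ g j' := by
      intro j j' hjj hj' heq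
      have h1 := congrFun heq ⟨d - j', by omega⟩
      simp only [g] at h1
      rw [if_pos (by omega), if_neg (by omega)] at h1
      omega
    intro j hj j' hj' heq
    have hj : j < J := by simpa using hj
    have hj' : j' < J := by simpa using hj'
    rcases lt_trichotomy j j' with hlt | rfl | hlt
    · exact absurd heq (aux _ _ hlt hj')
    · rfl
    · exact absurd heq.symm (aux _ _ hlt hj)

theorem not_SPTSym (lam : ℕ → ℝ) (I : (d : ℕ) → Finset (Fin d)) (h1 : 1 ≤ lam 1) {c : ℝ}
    (hc0 : 0 < c) (hc1 : c ≤ 1) (hc2 : c ≤ lam 2)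
    (h : ∀ J : ℕ, ∃ n : ℕ, 1 / 4 < lam 1 ^ n * c ^ J) : ¬ SPTSym lam I := by
  rintro ⟨C, hC, p, hp, hb⟩
  obtain ⟨J, hJ⟩ := exists_nat_gt (C * (1 / 2 : ℝ) ^ (-p))
  have hJ0 : 0 < J := by
    have : (0 : ℝ) < J := lt_trans (by positivity) hJ
    exact_mod_cast this
  obtain ⟨n, hn⟩ := h J
  have h2 : (J : ℕ∞) ≤ nSym lam I (1 / 2) (n + J) := by
    refine natCast_le_nSym lam I _ _ J (by omega) fun j hj => ?_
    calc (1 / 2 : ℝ) ^ 2 = 1 / 4 := by norm_num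
      _ < lam 1 ^ n * c ^ J := hn
      _ ≤ lam 1 ^ (n + J - j) * lam 2 ^ j := by
        refine mul_le_mul (pow_le_pow_right₀ h1 (by omega)) ?_ (by positivity) (by positivity)
        exact (pow_le_pow_of_le_one hc0.le hc1 hj.le).trans (pow_le_pow_left₀ hc0.le hc2 j)
  have h3 := hb (n + J) (by omega) (1 / 2) (by norm_num) (by norm_num)
  have h4 : ((J : ℕ∞) : ℝ≥0∞) ≤ ENNReal.ofReal (C * (1 / 2 : ℝ) ^ (-p)) :=
    (ENat.toENNReal_le.2 h2).trans h3
  rw [ENat.toENNReal_coe, ENNReal.natCast_le_ofReal hJ0.ne'] at h4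
  linarith

theorem exists_symSum_le_of_nSym_le (lam : ℕ → ℝ) (hnn : ∀ m, 0 ≤ lam m)
    (hle : ∀ m, 1 ≤ m → lam m ≤ 1) (I : (d : ℕ) → Finset (Fin d)) {C p q : ℝ} (hC : 0 < C)
    (hp : 0 < p)
    (h : ∀ d : ℕ, 1 ≤ d → ∀ ε : ℝ, 0 < ε → ε ≤ 1 →
      (nSym lam I ε d : ℝ≥0∞) ≤ ENNReal.ofReal (C * ε ^ (-p) * (d : ℝ) ^ q)) :
    ∃ D : ℝ, 0 < D ∧ ∀ d : ℕ, 1 ≤ d →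
      symSum (fun m => ENNReal.ofReal (lam m) ^ p) I d ≤ ENNReal.ofReal (D * (d : ℝ) ^ q) := by
  refine ⟨C * ((dyadicConst p).toReal + 1), by positivity, fun d hd => ?_⟩
  have h1 := symSum_le_of_nSym_le lam hnn hle I hp d (ENNReal.ofReal (C * (d : ℝ) ^ q))
    fun ε hε hε1 => by
      rw [← ENNReal.ofReal_mul (by positivity), mul_right_comm]
      exact h d hd ε hε hε1
  refine h1.trans ?_
  rw [← ENNReal.ofReal_toReal (dyadicConst_ne_top hp), ← ENNReal.ofReal_mul (by positivity)]
  refine ENNReal.ofReal_le_ofReal ?_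
  rw [mul_right_comm]
  gcongr
  rw [ENNReal.toReal_ofReal ENNReal.toReal_nonneg]
  linarith

theorem summable_of_symSum_le (lam : ℕ → ℝ) (hnn : ∀ m, 0 ≤ lam m)
    (I : (d : ℕ) → Finset (Fin d)) {p B : ℝ} (hp : 0 < p)
    (h : symSum (fun m => ENNReal.ofReal (lam m) ^ p) I 1 ≤ ENNReal.ofReal B) :
    Summable (fun m : ℕ => lam (m + 1) ^ p) :=
  (tsum_ofReal_rpow_ne_top_iff lam hnn hp).1
    (ne_top_of_le_ne_top ENNReal.ofReal_ne_top ((tsum_le_symSum_one _ I).trans h))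

theorem one_add_pow_le_of_symSum_le (lam : ℕ → ℝ) (hnn : ∀ m, 0 ≤ lam m) (h1 : lam 1 = 1)
    (I : (d : ℕ) → Finset (Fin d)) {p B : ℝ} (hp : 0 < p) (hB : 0 ≤ B) (d : ℕ)
    (h : symSum (fun m => ENNReal.ofReal (lam m) ^ p) I d ≤ ENNReal.ofReal B) :
    (1 + lam 2 ^ p) ^ (d - (I d).card) ≤ B := by
  have h2 := (one_add_pow_le_symSum (fun m => ENNReal.ofReal (lam m) ^ p) (by simp [h1]) I d).trans h
  have hnn' := Real.rpow_nonneg (hnn 2) p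
  rw [ENNReal.ofReal_rpow_of_nonneg (hnn 2) hp.le, ← ENNReal.ofReal_one,
    ← ENNReal.ofReal_add zero_le_one hnn', ← ENNReal.ofReal_pow (by positivity)] at h2
  exact (ENNReal.ofReal_le_ofReal_iff hB).1 h2

theorem SPTSym.pTSym {lam : ℕ → ℝ} {I : (d : ℕ) → Finset (Fin d)} (h : SPTSym lam I) :
    PTSym lam I := by
  obtain ⟨C, hC, p, hp, hb⟩ := h
  exact ⟨C, hC, p, hp, 0, le_rfl, by simpa using hb⟩

theorem SPTSym_of_symSum_le (lam : ℕ → ℝ) (hnn : ∀ m, 0 ≤ lam m)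
    (I : (d : ℕ) → Finset (Fin d)) {τ B : ℝ} (hτ : 0 < τ) (hB : 0 < B)
    (h : ∀ d, 1 ≤ d → symSum (fun m => ENNReal.ofReal (lam m) ^ τ) I d ≤ ENNReal.ofReal B) :
    SPTSym lam I :=
  ⟨B, hB, 2 * τ, by positivity, fun d hd _ hε _ =>
    nSym_le_of_symSum_le lam hnn I hτ hε d (h d hd)⟩

theorem SPTSym_of_lt_one (lam : ℕ → ℝ) (hnn : ∀ m, 0 ≤ lam m)
    (hord : ∀ m m' : ℕ, 1 ≤ m → m ≤ m' → lam m' ≤ lam m) (I : (d : ℕ) → Finset (Fin d))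
    (hsum : ∃ τ : ℝ, 0 < τ ∧ Summable (fun m : ℕ => lam (m + 1) ^ τ)) (h1 : lam 1 < 1) :
    SPTSym lam I := by
  obtain ⟨τ, hτ, ht⟩ := exists_tail_le_half lam hnn hord hsum 0 h1
  refine SPTSym_of_symSum_le lam hnn I hτ one_pos fun d _ => ?_
  rw [ENNReal.ofReal_one]
  refine (tsum_le_tail_pow (fun m => ENNReal.ofReal (lam m) ^ τ) 1 d (nablaSym I d)
    fun k hk => hk.1).trans (pow_le_one₀ zero_le (ht.trans (by simp)))

theorem tsum_le_add_half (lam : ℕ → ℝ) (hle : ∀ m, 1 ≤ m → lam m ≤ 1) {τ : ℝ} (hτ : 0 < τ)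
    (M : ℕ) (ht : ∑' j, ENNReal.ofReal (lam (1 + M + j)) ^ τ ≤ 2⁻¹) :
    ∑' j, ENNReal.ofReal (lam (1 + j)) ^ τ ≤ (M : ℝ≥0∞) + 1 := by
  rw [← Summable.sum_add_tsum_nat_add' (f := fun j => ENNReal.ofReal (lam (1 + j)) ^ τ) (k := M)
    ENNReal.summable]
  refine add_le_add ?_ ?_
  · calc _ ≤ ∑ _j ∈ Finset.range M, (1 : ℝ≥0∞) := Finset.sum_le_sum fun j _ =>
          ENNReal.rpow_le_one (ENNReal.ofReal_le_one.2 (hle _ (by omega))) hτ.le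
      _ = M := by simp
  · refine (le_of_eq (tsum_congr fun j => ?_)).trans (ht.trans (by simp))
    rw [add_comm j M, ← add_assoc]

theorem SPTSym_of_eq_one (lam : ℕ → ℝ) (hnn : ∀ m, 0 ≤ lam m)
    (hord : ∀ m m' : ℕ, 1 ≤ m → m ≤ m' → lam m' ≤ lam m) (I : (d : ℕ) → Finset (Fin d))
    (hsum : ∃ τ : ℝ, 0 < τ ∧ Summable (fun m : ℕ => lam (m + 1) ^ τ)) (h1 : lam 1 = 1)
    (h2 : lam 2 < 1) {K : ℕ} (hK : ∀ d : ℕ, 1 ≤ d → d - (I d).card ≤ K) : SPTSym lam I := by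
  have hle : ∀ m, 1 ≤ m → lam m ≤ 1 := fun m hm => (hord 1 m le_rfl hm).trans h1.le
  obtain ⟨τ, hτ, ht⟩ := exists_tail_le_half lam hnn hord hsum 1 h2
  refine SPTSym_of_symSum_le lam hnn I hτ (B := 2 ^ K * 2) (by positivity) fun d hd => ?_
  refine (symSum_le_mul _ I d).trans ?_
  have hS := tsum_le_add_half lam hle hτ 1 ht
  rw [ENNReal.ofReal_mul (by positivity), ENNReal.ofReal_pow (by positivity),
    ENNReal.ofReal_ofNat]
  refine mul_le_mul' ?_ (monoSum_le_two _ 1 _ (by simp [h1]) ht)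
  refine (pow_le_pow_left₀ zero_le hS _).trans ?_
  rw [Nat.cast_one, one_add_one_eq_two]
  exact pow_le_pow_right₀ (by norm_num) (hK d hd)

theorem exists_lt_one_of_summable (lam : ℕ → ℝ)
    (hsum : ∃ τ : ℝ, 0 < τ ∧ Summable (fun m : ℕ => lam (m + 1) ^ τ)) :
    ∃ M : ℕ, lam (1 + M) < 1 := by
  obtain ⟨τ, hτ, hs⟩ := hsum
  obtain ⟨M, hM⟩ := (hs.tendsto_atTop_zero.eventually (gt_mem_nhds one_pos)).exists
  refine ⟨M, ?_⟩
  by_contra! hge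
  rw [add_comm] at hge
  exact hM.not_ge (Real.one_le_rpow hge hτ.le)

theorem PTSym_of_le_one (lam : ℕ → ℝ) (hnn : ∀ m, 0 ≤ lam m)
    (hord : ∀ m m' : ℕ, 1 ≤ m → m ≤ m' → lam m' ≤ lam m) (I : (d : ℕ) → Finset (Fin d))
    (hsum : ∃ τ : ℝ, 0 < τ ∧ Summable (fun m : ℕ => lam (m + 1) ^ τ)) (h1 : lam 1 ≤ 1)
    {K : ℝ} (hK : ∀ d : ℕ, 2 ≤ d → (d : ℝ) - (I d).card ≤ K * Real.log d) : PTSym lam I := by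
  have hle : ∀ m, 1 ≤ m → lam m ≤ 1 := fun m hm => (hord 1 m le_rfl hm).trans h1
  obtain ⟨M, hM⟩ := exists_lt_one_of_summable lam hsum
  obtain ⟨τ, hτ, ht⟩ := exists_tail_le_half lam hnn hord hsum M hM
  set s : ℝ := M + 1 with hs
  have hs1 : 1 ≤ s := by simp [hs]
  have hls : 0 ≤ Real.log s := Real.log_nonneg hs1
  refine ⟨s * 2 ^ M, by positivity, 2 * τ, by positivity, |K| * Real.log s + M, by positivity,
    fun d hd ε hε _ => ?_⟩
  rw [mul_right_comm]
  refine nSym_le_of_symSum_le lam hnn I hτ hε d ((symSum_le_mul _ I d).trans ?_)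
  have hd0 : (0 : ℝ) < d := by exact_mod_cast hd
  have hld : 0 ≤ Real.log d := Real.log_nonneg (by exact_mod_cast hd)
  have hcard : (I d).card ≤ d := by simpa using Finset.card_le_univ (I d)
  have hb : ((d - (I d).card : ℕ) : ℝ) ≤ 1 + |K| * Real.log d := by
    rcases hd.eq_or_lt with rfl | hd2
    · simp
    · rw [Nat.cast_sub hcard]
      have := mul_le_mul_of_nonneg_right (le_abs_self K) hld
      linarith [hK d hd2]
  have hpow : s ^ (d - (I d).card) ≤ s * (d : ℝ) ^ (|K| * Real.log s) := by
    rw [← Real.rpow_natCast s]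
    refine (Real.rpow_le_rpow_of_exponent_le hs1 hb).trans (le_of_eq ?_)
    rw [Real.rpow_add (by positivity), Real.rpow_one, Real.rpow_def_of_pos (by positivity),
      Real.rpow_def_of_pos hd0]
    ring_nf
  have hmono := monoSum_le_pow (fun m => ENNReal.ofReal (lam m) ^ τ) M 1
    (fun j _ => ENNReal.rpow_le_one (ENNReal.ofReal_le_one.2 (hle _ (by omega))) hτ.le)
    (ht.trans (by simp)) (I d).card
  have hreal : s ^ (d - (I d).card) * ((I d).card + 1 : ℝ) ^ M ≤
      s * 2 ^ M * (d : ℝ) ^ (|K| * Real.log s + M) := by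
    have h2 : ((I d).card + 1 : ℝ) ≤ 2 * d := by
      have h3 : ((I d).card : ℝ) ≤ d := by exact_mod_cast hcard
      have h4 : (1 : ℝ) ≤ d := by exact_mod_cast hd
      linarith
    calc s ^ (d - (I d).card) * ((I d).card + 1 : ℝ) ^ M
        ≤ (s * (d : ℝ) ^ (|K| * Real.log s)) * (2 * d : ℝ) ^ M := by gcongr
      _ = _ := by
        rw [Real.rpow_add hd0, Real.rpow_natCast, mul_pow]
        ring
  refine le_trans ?_ (ENNReal.ofReal_le_ofReal hreal)
  rw [ENNReal.ofReal_mul (by positivity), ENNReal.ofReal_pow (by positivity),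
    ENNReal.ofReal_pow (by positivity), hs, ENNReal.ofReal_add (by positivity) zero_le_one,
    ENNReal.ofReal_add (by positivity) zero_le_one, ENNReal.ofReal_natCast,
    ENNReal.ofReal_natCast, ENNReal.ofReal_one]
  exact mul_le_mul' (pow_le_pow_left₀ zero_le (tsum_le_add_half lam hle hτ M ht) _) hmono

/-- **Paper Theorem 5.8** (polynomial tractability of symmetric tensor product
problems, absolute error criterion): the `I`-symmetric problem is strongly polynomially
tractable iff `λ ∈ ℓ_τ` for some `τ > 0` and either `λ₁ < 1`, or `1 = λ₁ > λ₂` and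
`d − #I_d ∈ O(1)`; moreover, if `λ₁ ≤ 1`, it is polynomially tractable iff `λ ∈ ℓ_τ`
for some `τ > 0` and either `λ₁ < 1`, or `λ₁ = 1` and `d − #I_d ∈ O(ln d)`. -/
theorem stmt18 (lam : ℕ → ℝ)
    (hnn : ∀ m, 0 ≤ lam m)
    (hord : ∀ m m' : ℕ, 1 ≤ m → m ≤ m' → lam m' ≤ lam m)
    (hlam2 : 0 < lam 2)
    (I : (d : ℕ) → Finset (Fin d)) (hI : ∀ d, 2 ≤ d → (I d).Nonempty) :
    (SPTSym lam I ↔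
      ((∃ τ : ℝ, 0 < τ ∧ Summable (fun m : ℕ => lam (m + 1) ^ τ)) ∧
        (lam 1 < 1 ∨
          (lam 1 = 1 ∧ lam 2 < 1 ∧ ∃ K : ℕ, ∀ d : ℕ, 1 ≤ d → d - (I d).card ≤ K)))) ∧
    (lam 1 ≤ 1 →
      (PTSym lam I ↔
        ((∃ τ : ℝ, 0 < τ ∧ Summable (fun m : ℕ => lam (m + 1) ^ τ)) ∧
          (lam 1 < 1 ∨
            (lam 1 = 1 ∧ ∃ K : ℝ, ∀ d : ℕ, 2 ≤ d →
              (d : ℝ) - (I d).card ≤ K * Real.log d))))) := by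
  constructor
  · constructor
    · intro hspt
      have h1 : lam 1 ≤ 1 := by
        by_contra! hgt
        refine not_SPTSym lam I hgt.le (c := min (lam 2) 1) (lt_min hlam2 one_pos)
          (min_le_right _ _) (min_le_left _ _) (fun J => ?_) hspt
        have hpos : 0 < min (lam 2) 1 ^ J := pow_pos (lt_min hlam2 one_pos) J
        obtain ⟨n, hn⟩ := pow_unbounded_of_one_lt (1 / 4 / min (lam 2) 1 ^ J) hgt
        exact ⟨n, (div_lt_iff₀ hpos).1 hn⟩
      have hle : ∀ m, 1 ≤ m → lam m ≤ 1 := fun m hm => (hord 1 m le_rfl hm).trans h1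
      have h12 : lam 1 = 1 → lam 2 < 1 := by
        intro h1e
        by_contra! h2
        exact not_SPTSym lam I h1e.ge one_pos le_rfl h2
          (fun J => ⟨0, by norm_num⟩) hspt
      obtain ⟨C, hC, p, hp, hb⟩ := hspt
      obtain ⟨D, hD, hsym⟩ := exists_symSum_le_of_nSym_le lam hnn hle I (q := 0) hC hp
        (by simpa using hb)
      refine ⟨⟨p, hp, summable_of_symSum_le lam hnn I hp (hsym 1 le_rfl)⟩, ?_⟩
      rcases h1.lt_or_eq with h1 | h1
      · exact Or.inl h1
      · refine Or.inr ⟨h1, h12 h1, ?_⟩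
        have hgt : 1 < 1 + lam 2 ^ p := by linarith [Real.rpow_pos_of_pos hlam2 p]
        obtain ⟨K, hK⟩ := pow_unbounded_of_one_lt D hgt
        refine ⟨K, fun d hd => ?_⟩
        have h3 := one_add_pow_le_of_symSum_le lam hnn h1 I hp (by positivity) d (hsym d hd)
        rw [Real.rpow_zero, mul_one] at h3
        exact ((pow_lt_pow_iff_right₀ hgt).1 (h3.trans_lt hK)).le
    · rintro ⟨hsum, h1 | ⟨h1, h2, K, hK⟩⟩
      · exact SPTSym_of_lt_one lam hnn hord I hsum h1
      · exact SPTSym_of_eq_one lam hnn hord I hsum h1 h2 hK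
  · intro h1
    have hle : ∀ m, 1 ≤ m → lam m ≤ 1 := fun m hm => (hord 1 m le_rfl hm).trans h1
    constructor
    · rintro ⟨C, hC, p, hp, q, hq, hb⟩
      obtain ⟨D, hD, hsym⟩ := exists_symSum_le_of_nSym_le lam hnn hle I hC hp hb
      refine ⟨⟨p, hp, summable_of_symSum_le lam hnn I hp (hsym 1 le_rfl)⟩, ?_⟩
      rcases h1.lt_or_eq with h1 | h1
      · exact Or.inl h1
      · refine Or.inr ⟨h1, ?_⟩
        have hgt : 1 < 1 + lam 2 ^ p := by linarith [Real.rpow_pos_of_pos hlam2 p]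
        have hlog := Real.log_pos hgt
        have hlog2 : 0 < Real.log 2 := Real.log_pos (by norm_num)
        refine ⟨(|Real.log D| / Real.log 2 + q) / Real.log (1 + lam 2 ^ p), fun d hd => ?_⟩
        have hd0 : (0 : ℝ) < d := by exact_mod_cast (by omega : 0 < d)
        have hcard : (I d).card ≤ d := by simpa using Finset.card_le_univ (I d)
        have h3 := one_add_pow_le_of_symSum_le lam hnn h1 I hp (by positivity) d
          (hsym d (by omega))
        have h4 := Real.log_le_log (by positivity) h3
        rw [Real.log_pow, Real.log_mul hD.ne' (by positivity), Real.log_rpow hd0,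
          Nat.cast_sub hcard] at h4
        have hld : Real.log 2 ≤ Real.log d :=
          Real.log_le_log (by norm_num) (by exact_mod_cast hd)
        have h5 : Real.log D ≤ |Real.log D| / Real.log 2 * Real.log d := by
          rw [div_mul_eq_mul_div, le_div_iff₀ hlog2]
          exact mul_le_mul (le_abs_self _) hld hlog2.le (abs_nonneg _)
        rw [div_mul_eq_mul_div, le_div_iff₀ hlog]
        linarith
    · rintro ⟨hsum, h1 | ⟨_, K, hK⟩⟩
      · exact (SPTSym_of_lt_one lam hnn hord I hsum h1).pTSym
      · exact PTSym_of_le_one lam hnn hord I hsum h1 hK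
end
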